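/- There exists a constant c > 0 such that for every even integer k ≥ 6 and every two-coloring of the edges of the complete graph K_n on n = 3k/2 − 1 vertices, the number of monochromatic copies of the cycle C_k is at least (ck)^k. -/

import Mathlib

open Finset

/-- A path copy as a sequence: `k` distinct vertices with consecutive vertices adjacent. -/
def IsPathSeq {V : Type*} (G : SimpleGraph V) (k : ℕ) (f : Fin k → V) : Prop :=
  Function.Injective f ∧ ∀ (i : Fin k) (h : i.val + 1 < k), G.Adj (f i) (f ⟨i.val + 1, h⟩)

/-- Number of copies of the path `P_k` in `G` (sequences identified with their reversals). -/
noncomputable def pathCount {V : Type*} (G : SimpleGraph V) (k : ℕ) : ℕ :=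
  Nat.card {f : Fin k → V // IsPathSeq G k f} / 2

/-- A cycle copy as a cyclic sequence: `k` distinct vertices, cyclically consecutive adjacent. -/
def IsCycleSeq {V : Type*} (G : SimpleGraph V) (k : ℕ) (f : Fin k → V) : Prop :=
  Function.Injective f ∧ ∀ i : Fin k, G.Adj (f i) (f ⟨(i.val + 1) % k, Nat.mod_lt _ i.pos⟩)

/-- Number of copies of the cycle `C_k` in `G` (identified up to rotation and reflection). -/
noncomputable def cycleCount {V : Type*} (G : SimpleGraph V) (k : ℕ) : ℕ :=
  Nat.card {f : Fin k → V // IsCycleSeq G k f} / (2 * k)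

/-- The red graph of the coloring `χ(a,b)`: complete bipartite between the first `a`
vertices and the remaining `b` vertices. The blue graph is its complement. -/
def chiRed (a b : ℕ) : SimpleGraph (Fin (a + b)) :=
  SimpleGraph.fromRel (fun x y => (x.val < a) ≠ (y.val < a))

/-- Number of neighbors of `x` inside the set `Y`. -/
noncomputable def nbrCount {V : Type*} (G : SimpleGraph V) (x : V) (Y : Finset V) : ℕ :=
  Nat.card {y : V // y ∈ Y ∧ G.Adj x y}

/-- `e(X,Y)`: number of pairs in `X × Y` that are edges. -/
noncomputable def eCnt {V : Type*} (G : SimpleGraph V) (X Y : Finset V) : ℕ :=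
  Nat.card {p : V × V // p.1 ∈ X ∧ p.2 ∈ Y ∧ G.Adj p.1 p.2}

/-- Edge density `d(X,Y) = e(X,Y)/(|X||Y|)`. -/
noncomputable def dens {V : Type*} (G : SimpleGraph V) (X Y : Finset V) : ℝ :=
  (eCnt G X Y : ℝ) / ((X.card : ℝ) * (Y.card : ℝ))

/-- `(X,Y)` is an `ε`-regular pair in `G`. -/
def IsRegularPair {V : Type*} (G : SimpleGraph V) (X Y : Finset V) (ε : ℝ) : Prop :=
  ∀ U, U ⊆ X → ∀ W, W ⊆ Y → ε * X.card ≤ (U.card : ℝ) → ε * Y.card ≤ (W.card : ℝ) →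
    |dens G U W - dens G X Y| ≤ ε

/-- `W` is `(t,l)`-well-connected in `G`: any two distinct vertices of `W` are joined by
at least `t` internally vertex-disjoint paths of length at most `l`. -/
def WellConnected {V : Type*} (G : SimpleGraph V) (W : Set V) (t l : ℕ) : Prop :=
  ∀ u ∈ W, ∀ v ∈ W, u ≠ v →
    ∃ P : Fin t → G.Walk u v, Function.Injective P ∧
      (∀ i, (P i).IsPath ∧ (P i).length ≤ l) ∧
      (∀ i j, i ≠ j → ∀ x, x ∈ (P i).support → x ∈ (P j).support → x = u ∨ x = v)

/-- Extremal coloring with parameter `α` (the red graph is `R`, blue is `Rᶜ`). -/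
def IsExtremalColoring {V : Type*} [Fintype V] [DecidableEq V] (R : SimpleGraph V) (α : ℝ) : Prop :=
  ∃ A : Finset V,
    (2/3 - α) * (Fintype.card V : ℝ) ≤ (A.card : ℝ) ∧
    (1/3 - α) * (Fintype.card V : ℝ) ≤ ((Aᶜ).card : ℝ) ∧
    ((1 - α ≤ dens R A A ∧ 1 - α ≤ dens Rᶜ A Aᶜ) ∨
     (1 - α ≤ dens Rᶜ A A ∧ 1 - α ≤ dens R A Aᶜ))

/-- A path of length `l` in `G[A,B]`: `l+1` distinct vertices alternating between the
parts `A` and `B`, with consecutive vertices adjacent in `G`. -/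
def IsAltPath {Ω : Type*} (G : SimpleGraph Ω) (A B : Finset Ω) (l : ℕ) (f : Fin (l + 1) → Ω) : Prop :=
  Function.Injective f ∧
  (∀ i : Fin (l + 1), f i ∈ A ∨ f i ∈ B) ∧
  (∀ (i : Fin (l + 1)) (h : i.val + 1 < l + 1),
    G.Adj (f i) (f ⟨i.val + 1, h⟩) ∧
    ((f i ∈ A ∧ f ⟨i.val + 1, h⟩ ∈ B) ∨ (f i ∈ B ∧ f ⟨i.val + 1, h⟩ ∈ A)))

/-- A path with `k` vertices alternating between `V` and `U`, starting in `V`. -/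
def IsBipPathFromV {Ω : Type*} (G : SimpleGraph Ω) (U V : Finset Ω) (k : ℕ) (f : Fin k → Ω) : Prop :=
  Function.Injective f ∧
  (∀ i : Fin k, (i.val % 2 = 0 → f i ∈ V) ∧ (i.val % 2 = 1 → f i ∈ U)) ∧
  (∀ (i : Fin k) (h : i.val + 1 < k), G.Adj (f i) (f ⟨i.val + 1, h⟩))

def CycF {V : Type*} (G : SimpleGraph V) (l : ℕ) (x : ℕ → V) : Prop :=
  3 ≤ l ∧ (∀ i, x (i + l) = x i) ∧ (∀ i, G.Adj (x i) (x (i + 1))) ∧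
    ∀ i j, i < l → j < l → x i = x j → i = j

def HasC {V : Type*} (G : SimpleGraph V) (l : ℕ) : Prop := ∃ x, CycF G l x

lemma CycF.mod {V : Type*} {G : SimpleGraph V} {l : ℕ} {x : ℕ → V} (h : CycF G l x) (i : ℕ) :
    x (i % l) = x i := by
  have hp : Function.Periodic x l := h.2.1
  exact hp.map_mod_nat i

lemma CycF.inj_mod {V : Type*} {G : SimpleGraph V} {l : ℕ} {x : ℕ → V} (h : CycF G l x) {i j : ℕ}
    (e : x i = x j) : i % l = j % l := by
  have hl : 0 < l := by have := h.1; omega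
  exact h.2.2.2 _ _ (Nat.mod_lt _ hl) (Nat.mod_lt _ hl) (by rw [h.mod, h.mod, e])

lemma CycF.inj' {V : Type*} {G : SimpleGraph V} {l : ℕ} {x : ℕ → V} (h : CycF G l x) {i j : ℕ}
    (hij : i ≤ j) (hj : j < i + l) (e : x i = x j) : i = j := by
  have := h.inj_mod e
  have h2 : (j - i) % l = 0 := Nat.sub_mod_eq_zero_of_mod_eq this.symm
  rw [Nat.mod_eq_of_lt (by omega)] at h2
  omega

lemma CycF.shift {V : Type*} {G : SimpleGraph V} {l : ℕ} {x : ℕ → V} (h : CycF G l x) (a : ℕ) :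
    CycF G l (fun i => x (i + a)) := by
  refine ⟨h.1, fun i => ?_, fun i => ?_, fun i j hi hj e => ?_⟩
  · show x (i + l + a) = x (i + a)
    rw [show i + l + a = (i + a) + l by ring, h.2.1]
  · show G.Adj (x (i + a)) (x (i + 1 + a))
    rw [show i + 1 + a = i + a + 1 by ring]; exact h.2.2.1 _
  · rcases le_total i j with hh | hh
    · have := h.inj' (i := i + a) (j := j + a) (by omega) (by omega) e; omega
    · have := h.inj' (i := j + a) (j := i + a) (by omega) (by omega) e.symm; omega

lemma cycF_of_fun {V : Type*} {G : SimpleGraph V} {k : ℕ} (f : ℕ → V) (hk : 3 ≤ k)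
    (hadj : ∀ i, i + 1 < k → G.Adj (f i) (f (i + 1))) (hc : G.Adj (f (k - 1)) (f 0))
    (hinj : ∀ i j, i < j → j < k → f i ≠ f j) : CycF G k (fun i => f (i % k)) := by
  refine ⟨hk, fun i => by simp, fun i => ?_, fun i j hi hj e => ?_⟩
  · show G.Adj (f (i % k)) (f ((i + 1) % k))
    have hlt : i % k < k := Nat.mod_lt _ (by omega)
    rw [Nat.add_mod, Nat.mod_eq_of_lt (show 1 < k by omega)]
    by_cases h : i % k + 1 < k
    · rw [Nat.mod_eq_of_lt h]; exact hadj _ h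
    · have : i % k = k - 1 := by omega
      rw [this, show k - 1 + 1 = k by omega, Nat.mod_self]; exact hc
  · simp only [Nat.mod_eq_of_lt hi, Nat.mod_eq_of_lt hj] at e
    rcases lt_trichotomy i j with hh | hh | hh
    · exact absurd e (hinj _ _ hh hj)
    · exact hh
    · exact absurd e.symm (hinj _ _ hh hi)

lemma hasC_of_fun {V : Type*} {G : SimpleGraph V} {k : ℕ} (f : ℕ → V) (hk : 3 ≤ k)
    (hadj : ∀ i, i + 1 < k → G.Adj (f i) (f (i + 1))) (hc : G.Adj (f (k - 1)) (f 0))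
    (hinj : ∀ i j, i < j → j < k → f i ≠ f j) : HasC G k := ⟨_, cycF_of_fun f hk hadj hc hinj⟩

lemma cycF_of_list {V : Type*} {G : SimpleGraph V} (L : List V) (h3 : 3 ≤ L.length)
    (hn : L.Nodup) (hc : L.IsChain G.Adj)
    (hl : ∀ a ∈ L.getLast?, ∀ b ∈ L.head?, G.Adj a b) :
    ∃ x, CycF G L.length x ∧ ∀ i (h : i < L.length), x i = L[i] := by
  have hne : L ≠ [] := by rintro rfl; simp at h3
  obtain ⟨v, hv⟩ : ∃ v, v ∈ L := List.exists_mem_of_ne_nil L hne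
  let f : ℕ → V := fun i => L.getD i v
  have hf : ∀ i (h : i < L.length), f i = L[i] := fun i h => by simp [f, h]
  refine ⟨_, cycF_of_fun f h3 ?_ ?_ ?_, ?_⟩
  · intro i hi
    rw [hf _ (by omega), hf _ hi]
    exact hc.getElem i hi
  · rw [hf _ (by omega), hf _ (by omega)]
    apply hl
    · rw [List.getLast?_eq_some_getLast hne, List.getLast_eq_getElem]; simp
    · rw [List.head?_eq_some_head hne, List.head_eq_getElem]; simp
  · intro i j hij hj e
    rw [hf _ (by omega), hf _ hj] at e
    have := (hn.getElem_inj_iff).1 e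
    omega
  · intro i h
    simp only [Nat.mod_eq_of_lt h, hf i h]

lemma down_odd {V : Type*} {G H : SimpleGraph V} (hGH : ∀ u v, u ≠ v → G.Adj u v ∨ H.Adj u v)
    {p : ℕ} (hp : 7 ≤ p) (hodd : p % 2 = 1) {x : ℕ → V} (hx : CycF G p x) :
    HasC G (p - 1) ∨ HasC H (p - 1) := by
  by_contra hcon
  push Not at hcon
  have step : ∀ (G' : SimpleGraph V), ¬ HasC G' (p - 1) → ∀ y, CycF G' p y → ∀ i,
      ¬ G'.Adj (y i) (y (i + 2)) := by
    intro G' hn y hy i ha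
    apply hn
    refine hasC_of_fun (fun j => y (i + 2 + j)) (by omega) (fun j _ => hy.2.2.1 _) ?_ ?_
    · show G'.Adj (y (i + 2 + (p - 1 - 1))) (y (i + 2))
      rw [show i + 2 + (p - 1 - 1) = i + p by omega, hy.2.1]; exact ha
    · intro a b hab hb e
      have := hy.inj' (i := i + 2 + a) (j := i + 2 + b) (by omega) (by omega) e
      omega
  have hne : ∀ a b, a < b → b < a + p → x a ≠ x b := fun a b h1 h2 e => by
    have := hx.inj' h1.le h2 e; omega
  have h2 : ∀ i, H.Adj (x i) (x (i + 2)) := fun i =>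
    (hGH _ _ (hne i (i+2) (by omega) (by omega))).resolve_left (step G hcon.1 x hx i)
  have hy : CycF H p (fun j => x (2 * j)) := by
    refine ⟨by omega, fun i => ?_, fun i => ?_, fun i j hi hj e => ?_⟩
    · show x (2 * (i + p)) = x (2 * i)
      rw [show 2 * (i + p) = 2 * i + p + p by ring, hx.2.1, hx.2.1]
    · exact h2 _
    · have := hx.inj_mod e
      have h3 : i ≡ j [MOD p] := by
        refine Nat.ModEq.cancel_left_of_coprime (c := 2) ?_ this
        exact (Nat.coprime_two_right.2 (Nat.odd_iff.2 hodd))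
      have := Nat.ModEq.eq_of_lt_of_lt h3 hi hj
      exact this
  have h4 : ∀ i, G.Adj (x i) (x (i + 4)) := by
    have he : ∀ j, G.Adj (x (2 * j)) (x (2 * j + 4)) := fun j => by
      have := step H hcon.2 _ hy j
      rw [show 2 * (j + 2) = 2 * j + 4 by ring] at this
      exact (hGH _ _ (hne _ _ (by omega) (by omega))).resolve_right this
    intro i
    rcases Nat.even_or_odd' i with ⟨j, rfl | rfl⟩
    · exact he j
    · have := he (j + (p + 1) / 2)
      rw [show 2 * (j + (p + 1) / 2) = 2 * j + 1 + p by omega, hx.2.1,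
        show 2 * j + 1 + p + 4 = 2 * j + 1 + 4 + p by omega, hx.2.1] at this
      exact this
  apply hcon.1
  let g : ℕ → ℕ := fun j => if j = 0 then 0 else if j = 1 then 4 else if j = 2 then 5 else
    if j = 3 then 1 else if j = 4 then 2 else j + 1
  refine hasC_of_fun (fun j => x (g j)) (by omega) ?_ ?_ ?_
  · intro i hi
    by_cases hh : 5 ≤ i
    · have e1 : g i = i + 1 := by simp only [g]; split_ifs <;> omega
      have e2 : g (i + 1) = i + 1 + 1 := by simp only [g]; split_ifs <;> omega
      simp only [e1, e2]; exact hx.2.2.1 _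
    · have : i = 0 ∨ i = 1 ∨ i = 2 ∨ i = 3 ∨ i = 4 := by omega
      rcases this with rfl | rfl | rfl | rfl | rfl <;> simp only [g] <;> norm_num
      · exact h4 0
      · exact hx.2.2.1 _
      · exact (h4 1).symm
      · exact hx.2.2.1 _
      · exact h4 2
  · have e1 : g (p - 1 - 1) = p - 1 := by simp only [g]; split_ifs <;> omega
    show G.Adj (x (g (p - 1 - 1))) (x 0)
    rw [e1, ← hx.2.1 0, show 0 + p = p - 1 + 1 by omega]; exact hx.2.2.1 _
  · intro i j hij hj e
    have := hx.2.2.2 (g i) (g j) (by simp only [g]; split_ifs <;> omega)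
      (by simp only [g]; split_ifs <;> omega) e
    revert this; simp only [g]; split_ifs <;> intro this <;> omega

lemma down_even {V : Type*} {G H : SimpleGraph V} (hGH : ∀ u v, u ≠ v → G.Adj u v ∨ H.Adj u v)
    {l : ℕ} (hl : 4 ≤ l) {x : ℕ → V} (hx : CycF G (2 * l) x) :
    HasC G (2 * l - 2) ∨ HasC H (2 * l - 2) := by
  by_contra hcon
  push Not at hcon
  have hne : ∀ y, CycF G (2 * l) y → ∀ a b, a < b → b < a + 2 * l → y a ≠ y b :=
    fun y hy a b h1 h2 e => by have := hy.inj' h1.le h2 e; omega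
  have h3 : ∀ y, CycF G (2 * l) y → ∀ i, H.Adj (y i) (y (i + 3)) := by
    intro y hy i
    refine (hGH _ _ (hne y hy _ _ (by omega) (by omega))).resolve_left fun ha => hcon.1 ?_
    refine hasC_of_fun (fun j => y (i + 3 + j)) (by omega) (fun j _ => hy.2.2.1 _) ?_ ?_
    · show G.Adj (y (i + 3 + (2 * l - 2 - 1))) (y (i + 3))
      rw [show i + 3 + (2 * l - 2 - 1) = i + 2 * l by omega, hy.2.1]; exact ha
    · intro a b hab hb e
      exact hne y hy (i + 3 + a) (i + 3 + b) (by omega) (by omega) e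
  have hpair : ∀ y, CycF G (2 * l) y → ∀ j, 2 ≤ j → j ≤ 2 * l - 2 → G.Adj (y 0) (y 2) →
      ¬ G.Adj (y j) (y (j + 2)) := by
    intro y hy j hj1 hj2 h0 hj
    apply hcon.1
    refine hasC_of_fun (fun t => y (if t ≤ j - 2 then 2 + t else 3 + t)) (by omega) ?_ ?_ ?_
    · intro t ht
      by_cases c1 : t + 1 ≤ j - 2
      · rw [if_pos (by omega), if_pos c1]; exact hy.2.2.1 _
      · rw [if_neg c1]
        by_cases c2 : t ≤ j - 2
        · rw [if_pos c2, show 2 + t = j by omega, show 3 + (t + 1) = j + 2 by omega]; exact hj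
        · rw [if_neg c2]; exact hy.2.2.1 _
    · rw [if_neg (by omega), if_pos (by omega), show 3 + (2 * l - 2 - 1) = 0 + 2 * l by omega, hy.2.1]
      exact h0
    · intro a b hab hb e
      refine hne y hy _ _ ?_ ?_ e <;> split_ifs <;> omega
  have hpair2 : ∀ i j, i + 2 ≤ j → j ≤ i + 2 * l - 2 → G.Adj (x i) (x (i + 2)) →
      ¬ G.Adj (x j) (x (j + 2)) := by
    intro i j h1 h2 h0 hj
    refine hpair _ (hx.shift i) (j - i) (by omega) (by omega) ?_ ?_
    · simpa [Nat.add_comm] using h0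
    · rw [show j - i + i = j by omega, show j - i + 2 + i = j + 2 by omega]; exact hj
  obtain ⟨a, ha⟩ : ∃ a, ∀ j, a + 2 ≤ j → j < a + 2 * l → ¬ G.Adj (x j) (x (j + 2)) := by
    by_cases h : ∃ i, G.Adj (x i) (x (i + 2))
    · obtain ⟨i, hi⟩ := h
      by_cases h' : G.Adj (x (i + 1)) (x (i + 1 + 2))
      · refine ⟨i, fun j h1 h2 => ?_⟩
        by_cases h3 : j ≤ i + 2 * l - 2
        · exact hpair2 i j h1 h3 hi
        · exact hpair2 (i + 1) j (by omega) (by omega) h'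
      · refine ⟨i + 2 * l - 1, fun j h1 h2 => ?_⟩
        obtain ⟨j', rfl⟩ : ∃ j', j = j' + 2 * l := ⟨j - 2 * l, by omega⟩
        rw [hx.2.1, show j' + 2 * l + 2 = j' + 2 + 2 * l by ring, hx.2.1]
        by_cases h3 : j' = i + 1
        · subst h3; exact h'
        · exact hpair2 i j' (by omega) (by omega) hi
    · push Not at h
      exact ⟨0, fun j _ _ => h j⟩
  have hy := hx.shift (a + 2)
  set y : ℕ → V := fun i => x (i + (a + 2)) with hydef
  have h2 : ∀ i, i < 2 * l - 2 → H.Adj (y i) (y (i + 2)) := by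
    intro i hi
    refine (hGH _ _ (hne y hy _ _ (by omega) (by omega))).resolve_left ?_
    have := ha (i + (a + 2)) (by omega) (by omega)
    rw [show i + (a + 2) + 2 = i + 2 + (a + 2) by ring] at this
    exact this
  apply hcon.2
  let g : ℕ → ℕ := fun t => if t < l - 1 then 2 * t else 4 * l - 3 - 2 * t
  refine hasC_of_fun (fun t => y (g t)) (by omega) ?_ ?_ ?_
  · intro t ht
    by_cases c1 : t + 1 < l - 1
    · have e1 : g t = 2 * t := by simp only [g]; split_ifs <;> omega
      have e2 : g (t + 1) = 2 * t + 2 := by simp only [g]; split_ifs; omega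
      simp only [e1, e2]; exact h2 _ (by omega)
    · by_cases c2 : t < l - 1
      · have e1 : g t = 2 * l - 4 := by simp only [g]; split_ifs; omega
        have e2 : g (t + 1) = 2 * l - 4 + 3 := by simp only [g]; split_ifs; omega
        simp only [e1, e2]; exact h3 y hy _
      · have e1 : g t = 4 * l - 5 - 2 * t + 2 := by simp only [g]; split_ifs; omega
        have e2 : g (t + 1) = 4 * l - 5 - 2 * t := by simp only [g]; split_ifs; omega
        simp only [e1, e2]; exact (h2 _ (by omega)).symm
  · have e1 : g (2 * l - 2 - 1) = 0 + 3 := by simp only [g]; split_ifs <;> omega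
    have e2 : g 0 = 0 := by simp only [g]; split_ifs <;> omega
    simp only [e1, e2]; exact (h3 y hy 0).symm
  · intro i j hij hj e
    have := hy.2.2.2 (g i) (g j) (by simp only [g]; split_ifs <;> omega)
      (by simp only [g]; split_ifs <;> omega) e
    revert this; simp only [g]; split_ifs <;> intro this <;> omega

lemma down_all {V : Type*} {G H : SimpleGraph V} (hGH : ∀ u v, u ≠ v → G.Adj u v ∨ H.Adj u v)
    {m : ℕ} (hm : 3 ≤ m) (p : ℕ) (hp : 2 * m ≤ p) (h : HasC G p ∨ HasC H p) :
    HasC G (2 * m) ∨ HasC H (2 * m) := by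
  have hHG : ∀ u v, u ≠ v → H.Adj u v ∨ G.Adj u v := fun u v e => (hGH u v e).symm
  induction p using Nat.strong_induction_on with
  | _ p ih =>
    by_cases e : p = 2 * m
    · subst e; exact h
    rcases Nat.even_or_odd' p with ⟨l, rfl | rfl⟩
    · apply ih (2 * l - 2) (by omega) (by omega)
      rcases h with ⟨x, hx⟩ | ⟨x, hx⟩
      · exact down_even hGH (by omega) hx
      · exact (down_even hHG (by omega) hx).symm
    · apply ih (2 * l + 1 - 1) (by omega) (by omega)
      rcases h with ⟨x, hx⟩ | ⟨x, hx⟩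
      · exact down_odd hGH (by omega) (by omega) hx
      · exact (down_odd hHG (by omega) (by omega) hx).symm

lemma not_pairwise_perm {α : Type*} {R : α → α → Prop} (l : List α) (h : ¬ l.Pairwise R) :
    ∃ P Q rest, l.Perm (P :: Q :: rest) ∧ ¬ R P Q := by
  classical
  induction l with
  | nil => simp at h
  | cons a l ih =>
    rw [List.pairwise_cons] at h
    by_cases h1 : ∀ b ∈ l, R a b
    · obtain ⟨P, Q, rest, hp, hr⟩ := ih (fun h2 => h ⟨h1, h2⟩)
      refine ⟨P, Q, a :: rest, ?_, hr⟩
      exact (hp.cons a).trans ((List.Perm.swap _ _ _).trans ((List.Perm.swap _ _ _).cons _))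
    · push Not at h1
      obtain ⟨b, hb, hr⟩ := h1
      exact ⟨a, b, l.erase b, (List.perm_cons_erase hb).cons a, hr⟩

def MRel {V : Type*} (H : SimpleGraph V) (W : Finset V) (a b : V) : Prop :=
  H.Adj a b ∧ (a ∈ W ∨ b ∈ W)

lemma MRel.symm {V : Type*} {H : SimpleGraph V} {W : Finset V} {a b : V} (h : MRel H W a b) :
    MRel H W b a := ⟨h.1.symm, h.2.symm⟩

def MGood {V : Type*} (H : SimpleGraph V) (W : Finset V) (P : List V) : Prop :=
  P ≠ [] ∧ P.IsChain (MRel H W) ∧ (∀ a ∈ P.head?, a ∈ W) ∧ (∀ a ∈ P.getLast?, a ∈ W)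

lemma MGood.merge {V : Type*} {H : SimpleGraph V} {W : Finset V} {P Q : List V} {y : V}
    (hP : MGood H W P) (hQ : MGood H W Q) (h1 : ∀ a ∈ P.getLast?, H.Adj a y)
    (h2 : ∀ a ∈ Q.getLast?, H.Adj a y) : MGood H W (P ++ y :: Q.reverse) := by
  obtain ⟨hP0, hPc, hPh, hPl⟩ := hP
  obtain ⟨hQ0, hQc, hQh, hQl⟩ := hQ
  refine ⟨by simp, ?_, ?_, ?_⟩
  · rw [List.isChain_append, List.isChain_cons]
    refine ⟨hPc, ⟨?_, ?_⟩, ?_⟩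
    · intro z hz
      rw [List.head?_reverse] at hz
      exact ⟨(h2 z hz).symm, Or.inr (hQl z hz)⟩
    · rw [List.isChain_reverse]
      exact hQc.imp fun a b h => h.symm
    · intro a ha b hb
      simp only [List.head?_cons, Option.mem_def, Option.some.injEq] at hb
      subst hb
      exact ⟨h1 a ha, Or.inl (hPl a ha)⟩
  · intro a ha
    apply hPh
    cases P with
    | nil => exact absurd rfl hP0
    | cons p P => simpa using ha
  · intro a ha
    apply hQh
    have : (P ++ y :: Q.reverse).getLast? = Q.head? := by
      rw [List.getLast?_append, List.getLast?_cons, List.getLast?_reverse]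
      cases Q with
      | nil => exact absurd rfl hQ0
      | cons q Q => simp
    rwa [this] at ha

theorem merge_lemma {V γ : Type*} (H : SimpleGraph V) (cls : V → γ) (W : Finset V) (s : ℕ)
    (hW : W.card = s + 2) (hcross : ∀ u ∈ W, ∀ v ∈ W, cls u ≠ cls v → H.Adj u v)
    (e : ℕ → Bool → V) (heW : ∀ j < s, ∀ b, e j b ∉ W)
    (hee : ∀ i j, i < j → j < s → ∀ b b', e i b ≠ e j b')
    (hpair : ∀ j < s, ∀ κ, ∃ b, ∀ u ∈ W, cls u = κ → H.Adj u (e j b))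
    (h2 : ∃ u ∈ W, ∃ v ∈ W, cls u ≠ cls v) :
    ∃ P Q : List V, (P ++ Q).Nodup ∧ MGood H W P ∧ MGood H W Q ∧ P.length + Q.length = 2 * s + 2 ∧
      (∀ v ∈ P ++ Q, v ∈ W ∨ ∃ i < s, ∃ b, v = e i b) ∧ (∀ w ∈ W, w ∈ P ++ Q) ∧
      ∀ u ∈ P, ∀ v ∈ Q, u ∈ W → v ∈ W → H.Adj u v := by
  classical
  let D : List V → List V → Prop := fun P Q => ∀ u ∈ P, ∀ v ∈ Q, u ∈ W → v ∈ W → cls u ≠ cls v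
  have hDs : ∀ P Q, D P Q → D Q P := fun P Q h u hu v hv hu' hv' => (h v hv u hu hv' hu').symm
  let M : List V → Prop := fun P => ∀ u ∈ P, ∀ v ∈ P, u ∈ W → v ∈ W → cls u = cls v
  let B : ℕ → List (List V) → Prop := fun j Ps => Ps.flatten.Nodup ∧ (∀ P ∈ Ps, MGood H W P) ∧
    (∀ v ∈ Ps.flatten, v ∈ W ∨ ∃ i < j, ∃ b, v = e i b) ∧ (∀ w ∈ W, w ∈ Ps.flatten) ∧
    Ps.flatten.length = s + 2 + j
  have hBp : ∀ j Ps Ps', Ps.Perm Ps' → B j Ps → B j Ps' := by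
    rintro j Ps Ps' hp ⟨b1, b2, b3, b4, b5⟩
    have hf := hp.flatten
    exact ⟨hf.nodup_iff.1 b1, fun P hP => b2 P (hp.mem_iff.2 hP), fun v hv => b3 v (hf.mem_iff.2 hv),
      fun w hw => hf.mem_iff.1 (b4 w hw), by rw [← hf.length_eq]; exact b5⟩
  have hlastmem : ∀ (P : List V) (a : V), a ∈ P.getLast? → a ∈ P := fun P a h => by
    exact List.mem_of_getLast? h
  have hBm : ∀ j < s, ∀ P Q rest b, B j (P :: Q :: rest) → (∀ a ∈ P.getLast?, H.Adj a (e j b)) →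
      (∀ a ∈ Q.getLast?, H.Adj a (e j b)) → B (j + 1) ((P ++ e j b :: Q.reverse) :: rest) := by
    rintro j hj P Q rest b ⟨b1, b2, b3, b4, b5⟩ hP hQ
    have hperm : ((P ++ e j b :: Q.reverse) :: rest).flatten.Perm (e j b :: (P :: Q :: rest).flatten) := by
      simp only [List.flatten_cons, List.append_assoc, List.cons_append]
      refine List.perm_middle.trans (List.Perm.cons _ ?_)
      exact List.Perm.append_left _ ((List.reverse_perm Q).append_right _)
    have hnot : e j b ∉ (P :: Q :: rest).flatten := by
      intro hm
      rcases b3 _ hm with h | ⟨i, hi, b', h⟩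
      · exact heW j hj b h
      · exact hee i j hi hj b' b h.symm
    refine ⟨?_, ?_, ?_, ?_, ?_⟩
    · rw [hperm.nodup_iff, List.nodup_cons]; exact ⟨hnot, b1⟩
    · intro P' hP'
      rcases List.mem_cons.1 hP' with rfl | h
      · exact (b2 P (by simp)).merge (b2 Q (by simp)) hP hQ
      · exact b2 P' (by simp [h])
    · intro v hv
      rcases List.mem_cons.1 (hperm.mem_iff.1 hv) with rfl | h
      · exact Or.inr ⟨j, by omega, b, rfl⟩
      · rcases b3 v h with h | ⟨i, hi, b', h⟩
        · exact Or.inl h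
        · exact Or.inr ⟨i, by omega, b', h⟩
    · intro w hw
      exact hperm.mem_iff.2 (List.mem_cons_of_mem _ (b4 w hw))
    · rw [hperm.length_eq, List.length_cons, b5]; ring
  have main : ∀ d j Ps, j + d = s → Ps.length = d + 2 → B j Ps →
      ((∀ P ∈ Ps, M P) ∨ Ps.Pairwise D) → ∃ P Q, B s [P, Q] ∧ D P Q := by
    intro d
    induction d with
    | zero =>
      intro j Ps hj hlen hB hI
      obtain rfl : j = s := by omega
      match Ps, hlen with
      | [P, Q], _ =>
        by_cases hD : D P Q
        · exact ⟨P, Q, hB, hD⟩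
        · exfalso
          have hM : ∀ R ∈ [P, Q], M R := by
            rcases hI with h | h
            · exact h
            · simp only [List.pairwise_cons, List.mem_singleton] at h
              exact absurd (h.1 Q rfl) hD
          simp only [D] at hD
          push Not at hD
          obtain ⟨u, hu, v, hv, huW, hvW, huv⟩ := hD
          obtain ⟨a, ha, b, hb, hab⟩ := h2
          have key : ∀ w ∈ W, cls w = cls u := by
            intro w hw
            have := hB.2.2.2.1 w hw
            simp only [List.flatten_cons, List.flatten_nil, List.append_nil, List.mem_append] at this
            rcases this with h | h
            · exact hM P (by simp) w h u hu hw huW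
            · exact (hM Q (by simp) w h v hv hw hvW).trans huv.symm
          exact hab ((key a ha).trans (key b hb).symm)
    | succ d ih =>
      intro j Ps hj hlen hB hI
      have hjs : j < s := by omega
      by_cases hpw : Ps.Pairwise D
      · match Ps, hlen with
        | P1 :: P2 :: P3 :: rest, hlen =>
          have fin : ∀ P Q R b, (P1 :: P2 :: P3 :: rest).Perm (P :: Q :: R :: rest) →
              (∀ a ∈ P.getLast?, H.Adj a (e j b)) → (∀ a ∈ Q.getLast?, H.Adj a (e j b)) →
              ∃ P Q, B s [P, Q] ∧ D P Q := by
            intro P Q R b hp hP hQ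
            have hB' := hBm j hjs P Q (R :: rest) b (hBp _ _ _ hp hB) hP hQ
            refine ih (j + 1) _ (by omega) (by simp only [List.length_cons] at hlen ⊢; omega) hB' (Or.inr ?_)
            have hpw' := (hp.pairwise_iff (fun h => hDs _ _ h)).1 hpw
            rw [List.pairwise_cons, List.pairwise_cons] at hpw'
            rw [List.pairwise_cons]
            refine ⟨fun S hS u hu v hv huW hvW => ?_, hpw'.2.2⟩
            rw [List.mem_append, List.mem_cons, List.mem_reverse] at hu
            rcases hu with h | rfl | h
            · exact hpw'.1 S (by simp only [List.mem_cons] at hS ⊢; tauto) u h v hv huW hvW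
            · exact absurd huW (heW j hjs b)
            · exact hpw'.2.1 S hS u h v hv huW hvW
          have hl : ∀ P ∈ P1 :: P2 :: P3 :: rest, ∃ b, ∀ a ∈ P.getLast?, H.Adj a (e j b) := by
            intro P hP
            obtain ⟨h0, -, -, hl⟩ := hB.2.1 P hP
            obtain ⟨b, hb⟩ := hpair j hjs (cls (P.getLast h0))
            refine ⟨b, fun a ha => hb a (hl a ha) ?_⟩
            rw [List.getLast?_eq_some_getLast h0] at ha
            simp only [Option.mem_def, Option.some.injEq] at ha
            rw [ha]
          obtain ⟨c1, hc1⟩ := hl P1 (by simp)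
          obtain ⟨c2, hc2⟩ := hl P2 (by simp)
          obtain ⟨c3, hc3⟩ := hl P3 (by simp)
          have : c1 = c2 ∨ c1 = c3 ∨ c2 = c3 := by
            cases c1 <;> cases c2 <;> cases c3 <;> simp
          rcases this with rfl | rfl | rfl
          · exact fin P1 P2 P3 c1 (List.Perm.refl _) hc1 hc2
          · exact fin P1 P3 P2 c1 ((List.Perm.swap _ _ _).cons _) hc1 hc3
          · exact fin P2 P3 P1 c2 ((List.Perm.swap _ _ _).trans ((List.Perm.swap _ _ _).cons _)) hc2 hc3
      · have hM := hI.resolve_right hpw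
        obtain ⟨P, Q, rest, hp, hPQ⟩ := not_pairwise_perm Ps hpw
        simp only [D] at hPQ
        push Not at hPQ
        obtain ⟨u, hu, v, hv, huW, hvW, huv⟩ := hPQ
        obtain ⟨b, hb⟩ := hpair j hjs (cls u)
        have hB1 := hBp _ _ _ hp hB
        have hM1 : ∀ P' ∈ P :: Q :: rest, M P' := fun P' h => hM P' (hp.mem_iff.2 h)
        have hPc : ∀ w ∈ P, w ∈ W → cls w = cls u := fun w hw hwW =>
          hM1 P (by simp) w hw u hu hwW huW
        have hQc : ∀ w ∈ Q, w ∈ W → cls w = cls u := fun w hw hwW =>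
          (hM1 Q (by simp) w hw v hv hwW hvW).trans huv.symm
        have hB' := hBm j hjs P Q rest b hB1
          (fun a ha => hb a ((hB1.2.1 P (by simp)).2.2.2 a ha)
            (hPc a (hlastmem _ _ ha) ((hB1.2.1 P (by simp)).2.2.2 a ha)))
          (fun a ha => hb a ((hB1.2.1 Q (by simp)).2.2.2 a ha)
            (hQc a (hlastmem _ _ ha) ((hB1.2.1 Q (by simp)).2.2.2 a ha)))
        have hlen' := hp.length_eq
        refine ih (j + 1) _ (by omega) (by simp only [List.length_cons] at hlen' ⊢; omega) hB' (Or.inl ?_)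
        intro P' hP'
        rcases List.mem_cons.1 hP' with rfl | h
        · have : ∀ w ∈ P ++ e j b :: Q.reverse, w ∈ W → cls w = cls u := by
            intro w hw hwW
            rw [List.mem_append, List.mem_cons, List.mem_reverse] at hw
            rcases hw with h | rfl | h
            · exact hPc w h hwW
            · exact absurd hwW (heW j hjs b)
            · exact hQc w h hwW
          intro w hw w' hw' h1 h2
          exact (this w hw h1).trans (this w' hw' h2).symm
        · exact hM1 P' (by simp [h])
  have hfl : (W.toList.map (fun w => [w])).flatten = W.toList := by
    induction W.toList with
    | nil => rfl
    | cons a l ih => simp [ih]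
  obtain ⟨P, Q, hB, hD⟩ := main s 0 (W.toList.map (fun w => [w])) (by omega) (by simp [hW]) (by
    refine ⟨by rw [hfl]; exact W.nodup_toList, ?_, ?_, ?_, ?_⟩
    · intro P hP
      obtain ⟨w, hw, rfl⟩ := List.mem_map.1 hP
      have hw := Finset.mem_toList.1 hw
      exact ⟨by simp, by simp, by simpa using hw, by simpa using hw⟩
    · intro v hv; rw [hfl] at hv; exact Or.inl (Finset.mem_toList.1 hv)
    · intro w hw; rw [hfl]; exact Finset.mem_toList.2 hw
    · rw [hfl]; simp [hW]) (Or.inl (by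
      intro P hP u hu v hv _ _
      obtain ⟨w, hw, rfl⟩ := List.mem_map.1 hP
      simp only [List.mem_singleton] at hu hv
      rw [hu, hv]))
  obtain ⟨b1, b2, b3, b4, b5⟩ := hB
  simp only [List.flatten_cons, List.flatten_nil, List.append_nil] at b1 b3 b4 b5
  exact ⟨P, Q, b1, b2 P (by simp), b2 Q (by simp), by rw [List.length_append] at b5; omega, b3, b4,
    fun u hu v hv huW hvW => hcross u huW v hvW (hD u hu v hv huW hvW)⟩

lemma CycF.mono {V : Type*} {G G' : SimpleGraph V} {l : ℕ} {x : ℕ → V} (h : CycF G l x)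
    (hh : ∀ u v, G.Adj u v → G'.Adj u v) : CycF G' l x :=
  ⟨h.1, h.2.1, fun i => hh _ _ (h.2.2.1 i), h.2.2.2⟩

lemma hasC_of_list {V : Type*} {G : SimpleGraph V} (L : List V) (h3 : 3 ≤ L.length)
    (hn : L.Nodup) (hc : L.IsChain G.Adj)
    (hl : ∀ a ∈ L.getLast?, ∀ b ∈ L.head?, G.Adj a b) : HasC G L.length := by
  obtain ⟨x, hx, -⟩ := cycF_of_list L h3 hn hc hl
  exact ⟨x, hx⟩

lemma insert_cycle {V : Type*} {G : SimpleGraph V} {l : ℕ} {x : ℕ → V} (h : CycF G l x)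
    (p : List V) (u u' : V) (hu : p.head? = some u) (hu' : p.getLast? = some u') (hn : p.Nodup)
    (hc : p.IsChain G.Adj) (i s : ℕ) (hs : s < l) (h3 : 3 ≤ l - s + p.length)
    (hd : ∀ v ∈ p, ∀ t < l - s, v ≠ x (i + 1 + s + t)) (h1 : G.Adj (x i) u)
    (h2 : G.Adj u' (x (i + 1 + s))) : HasC G (l - s + p.length) := by
  set A : List V := (List.range (l - s)).map (fun t => x (i + 1 + s + t)) with hA
  have hAl : A.length = l - s := by simp [hA]
  have hlast : A.getLast? = some (x i) := by
    rw [List.getLast?_eq_getElem?, hAl, hA, List.getElem?_map, List.getElem?_range (by omega)]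
    simp only [Option.map_some, Option.some.injEq]
    rw [show i + 1 + s + (l - s - 1) = i + l by omega, h.2.1]
  have hhead : A.head? = some (x (i + 1 + s)) := by
    rw [List.head?_eq_getElem?, hA, List.getElem?_map, List.getElem?_range (by omega)]
    simp
  have hlen : (A ++ p).length = l - s + p.length := by simp [hAl]
  rw [← hlen] at h3 ⊢
  refine hasC_of_list (A ++ p) h3 ?_ ?_ ?_
  · rw [List.nodup_append]
    refine ⟨?_, hn, ?_⟩
    · rw [hA]
      refine List.Nodup.map_on ?_ List.nodup_range
      intro a ha b hb e
      rw [List.mem_range] at ha hb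
      rcases le_total a b with hab | hab
      · have := h.inj' (i := i + 1 + s + a) (j := i + 1 + s + b) (by omega) (by omega) e; omega
      · have := h.inj' (i := i + 1 + s + b) (j := i + 1 + s + a) (by omega) (by omega) e.symm; omega
    · intro a ha b hb e
      rw [hA, List.mem_map] at ha
      obtain ⟨t, ht, rfl⟩ := ha
      exact hd b hb t (List.mem_range.1 ht) e.symm
  · rw [List.isChain_append]
    refine ⟨?_, hc, ?_⟩
    · rw [hA, List.isChain_map, List.isChain_iff_getElem]
      intro j hj
      simp only [List.getElem_range]
      exact h.2.2.1 _
    · intro a ha b hb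
      rw [hlast] at ha; rw [hu] at hb
      cases ha; cases hb; exact h1
  · intro a ha b hb
    rw [List.getLast?_append, hu'] at ha
    rw [List.head?_append, hhead] at hb
    cases ha; cases hb; exact h2

def GOn {V : Type*} (G : SimpleGraph V) (S : Finset V) : SimpleGraph V where
  Adj u v := G.Adj u v ∧ u ∈ S ∧ v ∈ S
  symm := ⟨fun _ _ h => ⟨h.1.symm, h.2.2, h.2.1⟩⟩
  loopless := ⟨fun _ h => G.loopless.irrefl _ h.1⟩

lemma path_list {V : Type*} {G : SimpleGraph V} {S : Finset V} {u u' : V}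
    (hr : (GOn G S).Reachable u u') (hu : u ∈ S) :
    ∃ p : List V, p.head? = some u ∧ p.getLast? = some u' ∧ p.Nodup ∧ p.IsChain G.Adj ∧
      (∀ v ∈ p, v ∈ S ∧ (GOn G S).Reachable u v) ∧ (1 ≤ p.length) ∧ (u ≠ u' → 2 ≤ p.length) := by
  classical
  obtain ⟨w, hw⟩ := hr.exists_isPath
  have hmem : ∀ v ∈ w.support, v ∈ S ∧ (GOn G S).Reachable u v := by
    intro v hv
    have hr' : (GOn G S).Reachable u v := ⟨w.takeUntil v hv⟩
    refine ⟨?_, hr'⟩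
    by_cases e : u = v
    · rwa [← e]
    · obtain ⟨q⟩ := hr'.symm
      cases q with
      | nil => exact absurd rfl e
      | cons ha _ => exact ha.2.1
  refine ⟨w.support, ?_, ?_, hw.support_nodup, ?_, hmem, by simp, ?_⟩
  · rw [List.head?_eq_some_head w.support_ne_nil, SimpleGraph.Walk.head_support]
  · rw [List.getLast?_eq_some_getLast w.support_ne_nil, SimpleGraph.Walk.getLast_support]
  · exact w.isChain_adj_support.imp fun a b h => h.1
  · intro hne
    rw [SimpleGraph.Walk.length_support]
    have : w.length ≠ 0 := fun h => hne (SimpleGraph.Walk.eq_of_length_eq_zero h)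
    omega

lemma no_ins {V : Type*} {G : SimpleGraph V} {l : ℕ} {x : ℕ → V} (h : CycF G l x)
    (hmax : ∀ l' > l, ¬ HasC G l') (p : List V) (u u' : V) (hu : p.head? = some u)
    (hu' : p.getLast? = some u') (hn : p.Nodup) (hc : p.IsChain G.Adj)
    (hd : ∀ v ∈ p, ∀ i, v ≠ x i) (i s : ℕ) (hs : s < p.length) (hsl : s < l)
    (h1 : G.Adj (x i) u) (h2 : G.Adj u' (x (i + 1 + s))) : False := by
  have := h.1
  exact hmax _ (by omega) (insert_cycle h p u u' hu hu' hn hc i s hsl (by omega)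
    (fun v hv t _ => hd v hv _) h1 h2)

lemma exists_inj_fun {V : Type*} (X : Finset V) (m : ℕ) (hm : 0 < m) (hX : m ≤ X.card) :
    ∃ a : ℕ → V, (∀ i < m, a i ∈ X) ∧ ∀ i j, i < m → j < m → a i = a j → i = j := by
  have hne : X.Nonempty := by rw [← Finset.card_pos]; omega
  obtain ⟨v, hv⟩ := hne
  have hf : ∀ i (h : i < X.toList.length), X.toList.getD i v = X.toList[i] := fun i h => by
    rw [List.getD_eq_getElem?_getD, List.getElem?_eq_getElem h]; rfl
  have hl : X.toList.length = X.card := X.length_toList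
  refine ⟨fun i => X.toList.getD i v, fun i hi => ?_, fun i j hi hj e => ?_⟩
  · dsimp only
    rw [hf i (by omega)]
    exact Finset.mem_toList.1 (List.getElem_mem _)
  · dsimp only at e
    rw [hf i (by omega), hf j (by omega)] at e
    exact (X.nodup_toList.getElem_inj_iff).1 e

lemma hasC_bip {V : Type*} {H : SimpleGraph V} (X Y : Finset V) (m : ℕ) (hm : 2 ≤ m)
    (hX : m ≤ X.card) (hY : m ≤ Y.card) (hXY : ∀ u ∈ X, ∀ v ∈ Y, H.Adj u v) : HasC H (2 * m) := by
  obtain ⟨a, ha, hai⟩ := exists_inj_fun X m (by omega) hX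
  obtain ⟨b, hb, hbi⟩ := exists_inj_fun Y m (by omega) hY
  refine hasC_of_fun (fun t => if t % 2 = 0 then a (t / 2) else b (t / 2)) (by omega) ?_ ?_ ?_
  · intro i hi
    by_cases c : i % 2 = 0
    · rw [if_pos c, if_neg (by omega)]
      exact hXY _ (ha _ (by omega)) _ (hb _ (by omega))
    · rw [if_neg c, if_pos (by omega)]
      exact (hXY _ (ha _ (by omega)) _ (hb _ (by omega))).symm
  · rw [if_neg (by omega), if_pos (by omega)]
    exact (hXY _ (ha _ (by omega)) _ (hb _ (by omega))).symm
  · intro i j hij hj e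
    have hne : ∀ s t, s < m → t < m → a s ≠ b t := fun s t hs ht e =>
      (hXY _ (ha s hs) _ (hb t ht)).ne e
    by_cases c : i % 2 = 0 <;> by_cases c' : j % 2 = 0 <;> simp only [c, c', if_true, if_false] at e
    · have := hai _ _ (by omega) (by omega) e; omega
    · exact hne _ _ (by omega) (by omega) e
    · exact hne _ _ (by omega) (by omega) e.symm
    · have := hbi _ _ (by omega) (by omega) e; omega

lemma cyc_outside {V : Type*} [Fintype V] {G : SimpleGraph V} {l : ℕ} {x : ℕ → V} (h : CycF G l x) :
    ∃ W : Finset V, W.card + l = Fintype.card V ∧ ∀ v, v ∈ W ↔ ∀ i, v ≠ x i := by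
  classical
  have hi : ((range l).image x).card = l := by
    rw [Finset.card_image_of_injOn, Finset.card_range]
    intro a ha b hb e
    exact h.2.2.2 a b (by simpa using ha) (by simpa using hb) e
  refine ⟨((range l).image x)ᶜ, ?_, fun v => ?_⟩
  · have := Finset.card_compl_add_card ((range l).image x)
    omega
  · rw [Finset.mem_compl, Finset.mem_image]
    constructor
    · intro hh i e
      refine hh ⟨i % l, ?_, by rw [h.mod, e]⟩
      rw [Finset.mem_range]; exact Nat.mod_lt _ (by have := h.1; omega)
    · rintro hh ⟨i, _, e⟩
      exact hh i e.symm

lemma card_ge_of_pos {V : Type*} {G : SimpleGraph V} {l : ℕ} {x : ℕ → V} (h : CycF G l x)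
    (Y : Finset V) (m : ℕ) (F : ℕ → ℕ) (hF : ∀ t < m, x (F t) ∈ Y)
    (hF2 : ∀ s t, s < t → t < m → F s < F t ∧ F t < F s + l) : m ≤ Y.card := by
  have key : ∀ a b, a < b → b < m → x (F a) ≠ x (F b) := fun a b hab hb e => by
    have h1 := hF2 a b hab hb
    have := h.inj' h1.1.le h1.2 e; omega
  calc m = (range m).card := (Finset.card_range m).symm
    _ ≤ Y.card := Finset.card_le_card_of_injOn (fun t => x (F t)) (fun t ht => hF t (by simpa using ht)) ?_
  intro a ha b hb e
  have ha' : a < m := by simpa using ha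
  have hb' : b < m := by simpa using hb
  rcases lt_trichotomy a b with hh | hh | hh
  · exact absurd e (key a b hh hb')
  · exact hh
  · exact absurd e.symm (key b a hh ha')

lemma odd_cover {V : Type*} {G : SimpleGraph V} {m : ℕ} {x : ℕ → V} (h : CycF G (2 * m - 1) x)
    (Y : Finset V) (hc : ∀ i, x i ∈ Y ∨ x (i + 1) ∈ Y) : m ≤ Y.card := by
  have h3 := h.1
  obtain ⟨a, ha⟩ : ∃ a, x a ∈ Y := by
    rcases hc 0 with h | h
    · exact ⟨_, h⟩
    · exact ⟨_, h⟩
  have hg : ∀ t, ∃ g, (g = a + 1 + 2 * t ∨ g = a + 2 + 2 * t) ∧ x g ∈ Y := fun t => by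
    rcases hc (a + 1 + 2 * t) with h | h
    · exact ⟨_, Or.inl rfl, h⟩
    · exact ⟨_, Or.inr (by ring), h⟩
  choose g hg1 hg2 using hg
  refine card_ge_of_pos h Y m (fun t => if t = 0 then a else g (t - 1)) ?_ ?_
  · intro t _
    split_ifs
    · exact ha
    · exact hg2 _
  · intro s t hst ht
    have h1 := hg1 (s - 1)
    have h2 := hg1 (t - 1)
    simp only [show t ≠ 0 by omega, if_false]
    split_ifs <;> omega

lemma consec_cover {V : Type*} {G : SimpleGraph V} {m : ℕ} {x : ℕ → V} (h : CycF G (2 * m - 2) x)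
    (Y : Finset V) (hc : ∀ i, x i ∈ Y ∨ x (i + 1) ∈ Y) (a : ℕ) (ha : x a ∈ Y) (ha' : x (a + 1) ∈ Y) :
    m ≤ Y.card := by
  have h3 := h.1
  have hg : ∀ t, ∃ g, (g = a + 2 + 2 * t ∨ g = a + 3 + 2 * t) ∧ x g ∈ Y := fun t => by
    rcases hc (a + 2 + 2 * t) with h | h
    · exact ⟨_, Or.inl rfl, h⟩
    · exact ⟨_, Or.inr (by ring), h⟩
  choose g hg1 hg2 using hg
  refine card_ge_of_pos h Y m (fun t => if t = 0 then a else if t = 1 then a + 1 else g (t - 2)) ?_ ?_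
  · intro t _
    split_ifs
    · exact ha
    · exact ha'
    · exact hg2 _
  · intro s t hst ht
    have h1 := hg1 (s - 2)
    have h2 := hg1 (t - 2)
    simp only [show t ≠ 0 by omega, if_false]
    split_ifs <;> omega

lemma hasC_of_PQ {V : Type*} {H : SimpleGraph V} {W : Finset V} {P Q : List V}
    (hn : (P ++ Q).Nodup) (hP : MGood H W P) (hQ : MGood H W Q) (h3 : 3 ≤ P.length + Q.length)
    (hx : ∀ u ∈ P, ∀ v ∈ Q, u ∈ W → v ∈ W → H.Adj u v) : HasC H (P.length + Q.length) := by
  obtain ⟨hP0, hPc, hPh, hPl⟩ := hP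
  obtain ⟨hQ0, hQc, hQh, hQl⟩ := hQ
  have hlen : (P ++ Q).length = P.length + Q.length := List.length_append
  rw [← hlen] at h3 ⊢
  refine hasC_of_list (P ++ Q) h3 hn ?_ ?_
  · rw [List.isChain_append]
    exact ⟨hPc.imp fun a b h => h.1, hQc.imp fun a b h => h.1, fun a ha b hb =>
      hx a (List.mem_of_getLast? ha) b (List.mem_of_head? hb) (hPl a ha) (hQh b hb)⟩
  · intro a ha b hb
    rw [List.getLast?_append_of_ne_nil _ hQ0] at ha
    rw [List.head?_append_of_ne_nil _ hP0] at hb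
    exact (hx b (List.mem_of_head? hb) a (List.mem_of_getLast? ha) (hPh b hb) (hQl a ha)).symm

lemma cross_adj {V : Type*} {G H : SimpleGraph V} (hGH : ∀ u v, u ≠ v → G.Adj u v ∨ H.Adj u v)
    (W : Finset V) (u : V) (hu : u ∈ W) (v : V) (hv : v ∈ W)
    (h : (GOn G W).connectedComponentMk u ≠ (GOn G W).connectedComponentMk v) : H.Adj u v := by
  refine (hGH u v (fun e => h (by rw [e]))).resolve_left fun ha => h ?_
  rw [SimpleGraph.ConnectedComponent.eq]
  exact SimpleGraph.Adj.reachable (⟨ha, hu, hv⟩ : (GOn G W).Adj u v)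

lemma class_pair {V : Type*} {G : SimpleGraph V}
    {l : ℕ} {x : ℕ → V} (h : CycF G l x) (hmax : ∀ l' > l, ¬ HasC G l') (W : Finset V)
    (hW : ∀ v ∈ W, ∀ i, v ≠ x i) (i : ℕ) (u u' : V) (hu : u ∈ W)
    (hr : (GOn G W).Reachable u u') (h1 : G.Adj u (x i)) (h2 : G.Adj u' (x (i + 1))) : False := by
  obtain ⟨p, p1, p2, p3, p4, p5, p6, -⟩ := path_list hr hu
  exact no_ins h hmax p u u' p1 p2 p3 p4 (fun v hv => hW v (p5 v hv).1) i 0 (by omega)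
    (by have := h.1; omega) h1.symm h2

lemma class_dist2 {V : Type*} {G : SimpleGraph V}
    {l : ℕ} {x : ℕ → V} (h : CycF G l x) (hmax : ∀ l' > l, ¬ HasC G l') (W : Finset V)
    (hW : ∀ v ∈ W, ∀ i, v ≠ x i) (i : ℕ) (u u' : V) (hu : u ∈ W) (hne : u ≠ u')
    (hr : (GOn G W).Reachable u u') (h1 : G.Adj u (x i)) (h2 : G.Adj u' (x (i + 2))) : False := by
  obtain ⟨p, p1, p2, p3, p4, p5, p6, p7⟩ := path_list hr hu
  exact no_ins h hmax p u u' p1 p2 p3 p4 (fun v hv => hW v (p5 v hv).1) i 1 (by have := p7 hne; omega)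
    (by have := h.1; omega) h1.symm h2

lemma pair_prop {V γ : Type*} {G H : SimpleGraph V} (hGH : ∀ u v, u ≠ v → G.Adj u v ∨ H.Adj u v)
    (W : Finset V) (cls : V → γ) (e : Bool → V) (he : ∀ b, e b ∉ W)
    (hno : ∀ u ∈ W, ∀ u' ∈ W, cls u = cls u' → G.Adj u (e false) → G.Adj u' (e true) → False)
    (κ : γ) : ∃ b, ∀ u ∈ W, cls u = κ → H.Adj u (e b) := by
  by_contra hcon
  push Not at hcon
  obtain ⟨u, hu, hk, hn⟩ := hcon false
  obtain ⟨u', hu', hk', hn'⟩ := hcon true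
  refine hno u hu u' hu' (hk.trans hk'.symm) ?_ ?_
  · exact (hGH u (e false) (fun h => he false (h ▸ hu))).resolve_right hn
  · exact (hGH u' (e true) (fun h => he true (h ▸ hu'))).resolve_right hn'

lemma caseA {V : Type*} [Fintype V] {G H : SimpleGraph V}
    (hGH : ∀ u v, u ≠ v → G.Adj u v ∨ H.Adj u v) {m : ℕ} (hm : 3 ≤ m)
    (hV : Fintype.card V = 3 * m - 1) {x : ℕ → V} (hx : CycF G (2 * m - 2) x)
    (hmax : ∀ l' > 2 * m - 2, ¬ HasC G l') : HasC H (2 * m) := by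
  classical
  obtain ⟨W, hWc, hWm⟩ := cyc_outside hx
  have hW : ∀ v ∈ W, ∀ i, v ≠ x i := fun v hv => (hWm v).1 hv
  have hWc' : W.card = m + 1 := by omega
  set cls : V → (GOn G W).ConnectedComponent := (GOn G W).connectedComponentMk with hcls
  have hre : ∀ u v, cls u = cls v → (GOn G W).Reachable u v := fun u v h =>
    SimpleGraph.ConnectedComponent.eq.1 h
  by_cases h2 : ∃ u ∈ W, ∃ v ∈ W, cls u ≠ cls v
  · obtain ⟨P, Q, q1, q2, q3, q4, q5, q6, q7⟩ := merge_lemma H cls W (m - 1) (by omega)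
      (fun u hu v hv => cross_adj hGH W u hu v hv) (fun j b => x (2 * j + b.toNat))
      (fun j _ b h => hW _ h _ rfl) (by
        intro i j hij hj b b' e
        have := hx.2.2.2 _ _ (by cases b <;> simp <;> omega) (by cases b' <;> simp <;> omega) e
        cases b <;> cases b' <;> simp at this <;> omega) (by
        intro j hj κ
        refine pair_prop hGH W cls (fun b => x (2 * j + b.toNat)) (fun b h => hW _ h _ rfl) ?_ κ
        intro u hu u' hu' hc h1 h2
        exact class_pair hx hmax W hW (2 * j) u u' hu (hre _ _ hc) h1 h2) h2
    have := hasC_of_PQ q1 q2 q3 (by omega) q7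
    rwa [q4, show 2 * (m - 1) + 2 = 2 * m by omega] at this
  · push Not at h2
    have hrr : ∀ u ∈ W, ∀ v ∈ W, (GOn G W).Reachable u v := fun u hu v hv => hre _ _ (h2 u hu v hv)
    set Y : Finset V := univ.filter (fun v => (∃ i, v = x i) ∧ ∀ u ∈ W, ¬ G.Adj u v) with hY
    have hYm : ∀ i, x i ∈ Y ↔ ∀ u ∈ W, ¬ G.Adj u (x i) := fun i => by
      simp only [hY, Finset.mem_filter, Finset.mem_univ, true_and]
      exact ⟨fun h => h.2, fun h => ⟨⟨i, rfl⟩, h⟩⟩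
    have hcov : ∀ i, x i ∈ Y ∨ x (i + 1) ∈ Y := by
      intro i
      by_contra hcon
      push Not at hcon
      rw [hYm, hYm] at hcon
      push Not at hcon
      obtain ⟨⟨u, hu, h1⟩, ⟨u', hu', h2⟩⟩ := hcon
      exact class_pair hx hmax W hW i u u' hu (hrr u hu u' hu') h1 h2
    by_cases hcons : ∃ a, x a ∈ Y ∧ x (a + 1) ∈ Y
    · obtain ⟨a, ha, ha'⟩ := hcons
      refine hasC_bip W Y m (by omega) (by omega) (consec_cover hx Y hcov a ha ha') ?_
      intro u hu v hv
      obtain ⟨⟨i, hi⟩, h⟩ := (Finset.mem_filter.1 hv).2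
      exact (hGH u v (by rw [hi]; exact hW u hu i)).resolve_left (h u hu)
    · push Not at hcons
      obtain ⟨a, ha⟩ : ∃ a, x a ∉ Y := by
        by_cases h : x 0 ∈ Y
        · exact ⟨_, hcons 0 h⟩
        · exact ⟨0, h⟩
      have hodd : ∀ t, x (a + 2 * t) ∉ Y := by
        intro t
        induction t with
        | zero => exact ha
        | succ t ih => exact hcons _ ((hcov (a + 2 * t)).resolve_left ih)
      have hodd' : ∀ t, x (a + 2 * t + 1) ∈ Y := fun t => (hcov _).resolve_left (hodd t)
      have hw0 := hodd 0
      rw [hYm] at hw0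
      push Not at hw0
      obtain ⟨w, hw, hwa⟩ := hw0
      have hall : ∀ t, ∀ u ∈ W, G.Adj u (x (a + 2 * t)) → u = w := by
        have hstep : ∀ t, ∀ v ∈ W, G.Adj v (x (a + 2 * t)) →
            ∀ u ∈ W, G.Adj u (x (a + 2 * (t + 1))) → u = v := by
          intro t v hv hva u hu hua
          by_contra hne
          exact class_dist2 hx hmax W hW (a + 2 * t) v u hv (Ne.symm hne) (hrr _ hv _ hu) hva hua
        have hone : ∀ t, G.Adj w (x (a + 2 * t)) := by
          intro t
          induction t with
          | zero => exact hwa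
          | succ t ih =>
            have := hodd (t + 1)
            rw [hYm] at this
            push Not at this
            obtain ⟨u, hu, hua⟩ := this
            rwa [hstep t w hw ih u hu hua] at hua
        intro t u hu hua
        have e : a + 2 * t + (2 * m - 2) = a + 2 * (t + (m - 2) + 1) := by omega
        rw [← hx.2.1, e] at hua
        exact hstep (t + (m - 2)) w hw (hone _) u hu hua
      have hno : ∀ u ∈ W, u ≠ w → ∀ i, ¬ G.Adj u (x i) := by
        intro u hu hne i hi
        have hper : ∀ q, x (i + q * (2 * m - 2)) = x i := by
          intro q
          induction q with
          | zero => simp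
          | succ q ih => rw [← ih, add_mul, one_mul, ← add_assoc, hx.2.1]
        have hge : a ≤ i + a * (2 * m - 2) := by nlinarith [show 1 ≤ 2 * m - 2 by omega]
        rw [← hper a] at hi
        obtain ⟨d, hd⟩ := Nat.exists_eq_add_of_le hge
        rw [hd] at hi
        rcases Nat.even_or_odd' d with ⟨t, rfl | rfl⟩
        · exact hne (hall t u hu hi)
        · exact (hYm _).1 (hodd' t) u hu (by rwa [← add_assoc] at hi)
      have hcc := Finset.card_erase_of_mem hw
      refine hasC_bip (W.erase w) Wᶜ m (by omega) (by omega) (by rw [Finset.card_compl]; omega) ?_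
      intro u hu v hv
      rw [Finset.mem_compl, hWm] at hv
      push Not at hv
      obtain ⟨i, rfl⟩ := hv
      have hu' := Finset.mem_erase.1 hu
      exact (hGH _ _ (hW u hu'.2 i)).resolve_left (hno u hu'.2 hu'.1 i)

lemma caseB1 {V : Type*} [Fintype V] {G H : SimpleGraph V}
    (hGH : ∀ u v, u ≠ v → G.Adj u v ∨ H.Adj u v) {m : ℕ} (hm : 3 ≤ m)
    (hV : Fintype.card V = 3 * m - 1) {x : ℕ → V} (hx : CycF G (2 * m - 1) x)
    (hmax : ∀ l' > 2 * m - 1, ¬ HasC G l') (w : V) (hw : ∀ i, w ≠ x i) (i : ℕ)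
    (h1 : G.Adj w (x i)) (h2 : G.Adj w (x (i + 2))) : HasC H (2 * m) := by
  classical
  obtain ⟨y, hy, hwy, a1, a2⟩ : ∃ y, CycF G (2 * m - 1) y ∧ (∀ i, w ≠ y i) ∧
      G.Adj w (y (2 * m - 2)) ∧ G.Adj w (y 1) := by
    refine ⟨fun j => x (j + (i + 1)), hx.shift (i + 1), fun j => hw _, ?_, ?_⟩
    · show G.Adj w (x (2 * m - 2 + (i + 1)))
      rw [show 2 * m - 2 + (i + 1) = i + (2 * m - 1) by omega, hx.2.1]; exact h1
    · show G.Adj w (x (1 + (i + 1)))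
      rwa [show 1 + (i + 1) = i + 2 by omega]
  clear h1 h2 hw hx x
  obtain ⟨W, hWc, hWm⟩ := cyc_outside hy
  have hW : ∀ v ∈ W, ∀ i, v ≠ y i := fun v hv => (hWm v).1 hv
  have hwW : w ∈ W := (hWm w).2 hwy
  have hy0 : y 0 ∉ W := fun h => hW _ h 0 rfl
  set W' := insert (y 0) W with hW'
  have hW'c : W'.card = m + 1 := by rw [hW', Finset.card_insert_of_notMem hy0]; omega
  have hne : ∀ a b, a < b → b < a + (2 * m - 1) → y a ≠ y b := fun a b h1 h2 e => by
    have := hy.inj' h1.le h2 e; omega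
  have hnr : ¬ (GOn G W').Reachable w (y 0) := by
    intro hr
    obtain ⟨p, p1, p2, p3, p4, p5, p6, p7⟩ := path_list hr (by simp [hW', hwW])
    have p7 := p7 (hwy 0)
    have := insert_cycle hy p w (y 0) p1 p2 p3 p4 (2 * m - 2) 1 (by omega) (by omega) (by
      intro v hv t ht e
      have hvS := (p5 v hv).1
      rw [show 2 * m - 2 + 1 + 1 + t = t + 1 + (2 * m - 1) by omega, hy.2.1] at e
      rcases Finset.mem_insert.1 hvS with h | h
      · exact hne 0 (t + 1) (by omega) (by omega) (h.symm.trans e)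
      · exact hW v h _ e) a1.symm (by
      rw [show 2 * m - 2 + 1 + 1 = 1 + (2 * m - 1) by omega, hy.2.1]; exact hy.2.2.1 0)
    exact hmax _ (by omega) this
  let f : ℕ → V := fun t => if t = 0 then w else y t
  have hz : CycF G (2 * m - 1) (fun t => f (t % (2 * m - 1))) := by
    refine cycF_of_fun f (by omega) ?_ ?_ ?_
    · intro t ht
      by_cases h : t = 0
      · subst h; simpa [f] using a2
      · simp only [f, h, if_false, show t + 1 ≠ 0 by omega]; exact hy.2.2.1 _
    · simp only [f, if_true, show 2 * m - 1 - 1 ≠ 0 by omega, if_false]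
      rw [show 2 * m - 1 - 1 = 2 * m - 2 by omega]; exact a1.symm
    · intro s t hst ht
      simp only [f, show t ≠ 0 by omega, if_false]
      split_ifs with h
      · exact hwy t
      · exact hne s t hst (by omega)
  have hzt : ∀ t, 0 < t → t < 2 * m - 1 → f (t % (2 * m - 1)) = y t := by
    intro t h1 h2
    rw [Nat.mod_eq_of_lt h2]; simp only [f, show t ≠ 0 by omega, if_false]
  set cls : V → (GOn G W').ConnectedComponent := (GOn G W').connectedComponentMk with hcls
  have hre : ∀ u v, cls u = cls v → (GOn G W').Reachable u v := fun u v h =>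
    SimpleGraph.ConnectedComponent.eq.1 h
  have heW : ∀ t, 0 < t → t < 2 * m - 1 → y t ∉ W' := by
    intro t h1 h2 h
    rcases Finset.mem_insert.1 h with h | h
    · exact hne 0 t h1 (by omega) h.symm
    · exact hW _ h t rfl
  obtain ⟨P, Q, q1, q2, q3, q4, q5, q6, q7⟩ := merge_lemma H cls W' (m - 1) (by omega)
      (fun u hu v hv => cross_adj hGH W' u hu v hv) (fun j b => y (1 + 2 * j + b.toNat))
      (fun j _ b h => heW _ (by omega) (by cases b <;> simp <;> omega) h) (by
        intro i j hij hj b b' e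
        have := hy.2.2.2 _ _ (by cases b <;> simp <;> omega) (by cases b' <;> simp <;> omega) e
        cases b <;> cases b' <;> simp at this <;> omega) (by
        intro j hj κ
        refine pair_prop hGH W' cls (fun b => y (1 + 2 * j + b.toNat))
          (fun b h => heW _ (by omega) (by cases b <;> simp <;> omega) h) ?_ κ
        intro u hu u' hu' hc h1 h2
        simp only [Bool.toNat_false, Bool.toNat_true, add_zero] at h1 h2
        obtain ⟨p, p1, p2, p3, p4, p5, p6, p7⟩ := path_list (hre _ _ hc) hu
        by_cases hin : y 0 ∈ p
        · have hwp : w ∉ p := fun h => hnr ((p5 w h).2.symm.trans (p5 _ hin).2)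
          refine no_ins hz hmax p u u' p1 p2 p3 p4 ?_ (1 + 2 * j) 0 (by omega) (by omega) ?_ ?_
          · intro v hv t e
            simp only [f] at e
            split_ifs at e with h
            · exact hwp (e ▸ hv)
            · exact heW _ (by omega) (Nat.mod_lt _ (by omega)) (e ▸ (p5 v hv).1)
          · rw [hzt _ (by omega) (by omega)]; exact h1.symm
          · rw [hzt _ (by omega) (by omega)]; exact h2
        · refine no_ins hy hmax p u u' p1 p2 p3 p4 ?_ (1 + 2 * j) 0 (by omega) (by omega) h1.symm h2
          intro v hv t
          rcases Finset.mem_insert.1 (p5 v hv).1 with h | h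
          · exact absurd (h ▸ hv) hin
          · exact hW v h t) ⟨w, by simp [hW', hwW], y 0, by simp [hW'], fun h => hnr (hre _ _ h)⟩
  have := hasC_of_PQ q1 q2 q3 (by omega) q7
  rwa [q4, show 2 * (m - 1) + 2 = 2 * m by omega] at this

def HM {V : Type*} (H : SimpleGraph V) (W : Finset V) : SimpleGraph V where
  Adj := MRel H W
  symm := ⟨fun _ _ h => h.symm⟩
  loopless := ⟨fun _ h => H.loopless.irrefl _ h.1⟩

set_option maxHeartbeats 1000000 in
lemma caseB {V : Type*} [Fintype V] {G H : SimpleGraph V}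
    (hGH : ∀ u v, u ≠ v → G.Adj u v ∨ H.Adj u v) {m : ℕ} (hm : 3 ≤ m)
    (hV : Fintype.card V = 3 * m - 1) {x : ℕ → V} (hx : CycF G (2 * m - 1) x)
    (hmax : ∀ l' > 2 * m - 1, ¬ HasC G l') (hmaxH : ∀ l' > 2 * m - 1, ¬ HasC H l') : False := by
  classical
  have hHG : ∀ u v, u ≠ v → H.Adj u v ∨ G.Adj u v := fun u v e => (hGH u v e).symm
  have hd2 : ∀ w, (∀ i, w ≠ x i) → ∀ i, G.Adj w (x i) → ¬ G.Adj w (x (i + 2)) := fun w hw i h1 h2 =>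
    hmaxH (2 * m) (by omega) (caseB1 hGH hm hV hx hmax w hw i h1 h2)
  have hd1 : ∀ w, (∀ i, w ≠ x i) → ∀ i, G.Adj w (x i) → ¬ G.Adj w (x (i + 1)) := fun w hw i h1 h2 =>
    no_ins hx hmax [w] w w rfl rfl (by simp) (by simp) (by simpa using hw) i 0 (by simp) (by omega)
      h1.symm h2
  obtain ⟨W, hWc, hWm⟩ := cyc_outside hx
  have hW : ∀ v ∈ W, ∀ i, v ≠ x i := fun v hv => (hWm v).1 hv
  have hWc' : W.card = m := by omega
  have hne : ∀ a b, a < b → b < a + (2 * m - 1) → x a ≠ x b := fun a b h1 h2 e => by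
    have := hx.inj' h1.le h2 e; omega
  set cls : V → (GOn G W).ConnectedComponent := (GOn G W).connectedComponentMk with hcls
  have hre : ∀ u v, cls u = cls v → (GOn G W).Reachable u v := fun u v h =>
    SimpleGraph.ConnectedComponent.eq.1 h
  have hH : ∀ u ∈ W, ∀ i, ¬ G.Adj u (x i) → H.Adj u (x i) := fun u hu i h =>
    (hGH _ _ (hW u hu i)).resolve_left h
  by_cases h2 : ∃ u ∈ W, ∃ v ∈ W, cls u ≠ cls v
  swap
  · push Not at h2
    set Y : Finset V := univ.filter (fun v => (∃ i, v = x i) ∧ ∀ u ∈ W, ¬ G.Adj u v) with hY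
    have hYm : ∀ i, x i ∈ Y ↔ ∀ u ∈ W, ¬ G.Adj u (x i) := fun i => by
      simp only [hY, Finset.mem_filter, Finset.mem_univ, true_and]
      exact ⟨fun h => h.2, fun h => ⟨⟨i, rfl⟩, h⟩⟩
    have hcov : ∀ i, x i ∈ Y ∨ x (i + 1) ∈ Y := by
      intro i
      by_contra hcon
      push Not at hcon
      rw [hYm, hYm] at hcon
      push Not at hcon
      obtain ⟨⟨u, hu, h1⟩, ⟨u', hu', h2'⟩⟩ := hcon
      exact class_pair hx hmax W hW i u u' hu (hre _ _ (h2 u hu u' hu')) h1 h2'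
    refine hmaxH (2 * m) (by omega) (hasC_bip W Y m (by omega) (by omega) (odd_cover hx Y hcov) ?_)
    intro u hu v hv
    obtain ⟨⟨i, hi⟩, h⟩ := (Finset.mem_filter.1 hv).2
    rw [hi] at h ⊢
    exact hH u hu i (h u hu)
  have hpp : ∀ i κ, ∃ b : Bool, ∀ u ∈ W, cls u = κ → H.Adj u (x (i + b.toNat)) := by
    intro i κ
    refine pair_prop hGH W cls (fun b => x (i + b.toNat)) (fun b h => hW _ h _ rfl) ?_ κ
    intro u hu u' hu' hc h1 h2
    exact class_pair hx hmax W hW i u u' hu (hre _ _ hc) h1 h2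
  obtain ⟨P, Q, q1, q2, q3, q4, q5, q6, q7⟩ := merge_lemma H cls W (m - 2) (by omega)
      (fun u hu v hv => cross_adj hGH W u hu v hv) (fun j b => x (3 + 2 * j + b.toNat))
      (fun j _ b h => hW _ h _ rfl) (by
        intro i j hij hj b b' e
        have := hx.2.2.2 _ _ (by cases b <;> simp <;> omega) (by cases b' <;> simp <;> omega) e
        cases b <;> cases b' <;> simp at this <;> omega)
      (fun j hj κ => hpp (3 + 2 * j) κ) h2
  obtain ⟨hP0, hPc, hPh, hPl⟩ := q2
  obtain ⟨hQ0, hQc, hQh, hQl⟩ := q3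
  have hpl := List.getLast?_eq_some_getLast hP0
  have hqh := List.head?_eq_some_head hQ0
  set p := P.getLast hP0
  set q := Q.head hQ0
  have hpW : p ∈ W := hPl p hpl
  have hqW : q ∈ W := hQh q hqh
  obtain ⟨t, ht3, htp, htq⟩ : ∃ t < 3, ¬ G.Adj p (x t) ∧ ¬ G.Adj q (x t) := by
    by_contra hcon
    push Not at hcon
    have c0 := hcon 0 (by omega)
    have c1 := hcon 1 (by omega)
    have c2 := hcon 2 (by omega)
    have p01 := hd1 p (hW p hpW) 0
    have p12 := hd1 p (hW p hpW) 1
    have p02 := hd2 p (hW p hpW) 0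
    have q01 := hd1 q (hW q hqW) 0
    have q12 := hd1 q (hW q hqW) 1
    have q02 := hd2 q (hW q hqW) 0
    norm_num at p01 p12 p02 q01 q12 q02
    tauto
  set L : List V := P ++ x t :: Q with hL
  have hLlen : L.length = 2 * m - 1 := by
    simp only [hL, List.length_append, List.length_cons]; omega
  have hxt : x t ∉ P ++ Q := by
    intro h
    rcases q5 _ h with h | ⟨i, hi, b, h⟩
    · exact hW _ h t rfl
    · exact hne t _ (by omega) (by cases b <;> simp <;> omega) h
  have hLperm : L.Perm (x t :: (P ++ Q)) := List.perm_middle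
  have hLn : L.Nodup := by rw [hLperm.nodup_iff, List.nodup_cons]; exact ⟨hxt, q1⟩
  obtain ⟨y, hyM, hyL⟩ := cycF_of_list (G := HM H W) L (by omega) hLn (by
      rw [hL, List.isChain_append, List.isChain_cons]
      refine ⟨hPc, ⟨?_, hQc⟩, ?_⟩
      · intro z hz
        rw [hqh] at hz; cases hz
        exact ⟨(hH q hqW t htq).symm, Or.inr hqW⟩
      · intro a ha b hb
        rw [hpl] at ha; cases ha
        simp only [List.head?_cons, Option.mem_def, Option.some.injEq] at hb
        subst hb
        exact ⟨hH p hpW t htp, Or.inl hpW⟩) (by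
      intro a ha b hb
      rw [hL, List.getLast?_append_of_ne_nil _ (by simp)] at ha
      have ha' : a ∈ Q.getLast? := by
        rw [List.getLast?_cons] at ha
        rw [List.getLast?_eq_some_getLast hQ0] at ha ⊢
        simpa using ha
      rw [hL, List.head?_append_of_ne_nil _ hP0] at hb
      exact ⟨(q7 b (List.mem_of_head? hb) a (List.mem_of_getLast? ha') (hPh b hb) (hQl a ha')).symm,
        Or.inl (hQl a ha')⟩)
  rw [hLlen] at hyM
  have hy : CycF H (2 * m - 1) y := hyM.mono fun u v h => h.1
  have hyW : ∀ i, y i ∈ W ∨ y (i + 1) ∈ W := fun i => (hyM.2.2.1 i).2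
  have hyin : ∀ v, v ∈ L → ∃ i, y i = v := by
    intro v hv
    obtain ⟨i, hi, e⟩ := List.mem_iff_getElem.1 hv
    exact ⟨i, by rw [hyL i hi, e]⟩
  have hynot : ∀ v, v ∉ L → ∀ i, v ≠ y i := by
    intro v hv i e
    apply hv
    have hlt : i % (2 * m - 1) < 2 * m - 1 := Nat.mod_lt _ (by omega)
    rw [e, ← hy.mod i, hyL _ (by omega)]
    exact List.getElem_mem _
  have hWL : ∀ w ∈ W, w ∈ L := fun w hw => hLperm.mem_iff.2 (List.mem_cons_of_mem _ (q6 w hw))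
  obtain ⟨i, hi0, hi1⟩ : ∃ i, x i ∉ L ∧ x (i + 1) ∉ L := by
    by_contra hcon
    push Not at hcon
    set Y : Finset V := L.toFinset \ W with hY
    have hYc := odd_cover hx Y (by
      intro i
      simp only [hY, Finset.mem_sdiff, List.mem_toFinset]
      by_cases h : x i ∈ L
      · exact Or.inl ⟨h, fun h' => hW _ h' _ rfl⟩
      · exact Or.inr ⟨hcon i h, fun h' => hW _ h' _ rfl⟩)
    have h1 : (L.toFinset \ W).card + W.card = L.toFinset.card :=
      Finset.card_sdiff_add_card_eq_card (fun w hw => List.mem_toFinset.2 (hWL w hw))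
    have h2 : L.toFinset.card = 2 * m - 1 := by rw [List.toFinset_card_of_nodup hLn, hLlen]
    rw [← hY] at h1
    omega
  have hred : ∀ w ∈ W, G.Adj w (x i) ∨ G.Adj w (x (i + 1)) := by
    intro w hw
    by_contra hcon
    push Not at hcon
    obtain ⟨a, ha⟩ := hyin w (hWL w hw)
    have b0 := hH w hw i hcon.1
    have b1 := hH w hw (i + 1) hcon.2
    rw [← ha] at b0 b1
    have hins : ∀ v, v ∉ L → H.Adj (y a) v → ¬ H.Adj (y (a + 1)) v := fun v hv h1 h2 =>
      no_ins hy hmaxH [v] v v rfl rfl (by simp) (by simp) (by simpa using hynot v hv) a 0 (by simp)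
        (by omega) h1 h2.symm
    have hins2 : ∀ v, v ∉ L → H.Adj (y a) v → ¬ H.Adj (y (a + 2)) v := fun v hv h1 h2 =>
      hmax (2 * m) (by omega) (caseB1 hHG hm hV hy hmaxH v (hynot v hv) a h1.symm h2.symm)
    rcases hyW (a + 1) with h | h
    · have c0 := (hHG _ _ (hW _ h i)).resolve_left (hins _ hi0 b0)
      have c1 := (hHG _ _ (hW _ h (i + 1))).resolve_left (hins _ hi1 b1)
      exact hd1 _ (hW _ h) i c0 c1
    · have c0 := (hHG _ _ (hW _ h i)).resolve_left (hins2 _ hi0 b0)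
      have c1 := (hHG _ _ (hW _ h (i + 1))).resolve_left (hins2 _ hi1 b1)
      exact hd1 _ (hW _ h) i c0 c1
  have hu : ∀ w ∈ W, H.Adj w (x (i + 2)) := by
    intro w hw
    apply hH w hw
    rcases hred w hw with h | h
    · exact hd2 w (hW w hw) i h
    · exact hd1 w (hW w hw) (i + 1) h
  have hv : ∀ w ∈ W, H.Adj w (x (i + (2 * m - 2))) := by
    intro w hw
    apply hH w hw
    intro hc
    rcases hred w hw with h | h
    · refine hd1 w (hW w hw) _ hc ?_
      rw [show i + (2 * m - 2) + 1 = i + (2 * m - 1) by omega, hx.2.1]; exact h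
    · refine hd2 w (hW w hw) _ hc ?_
      rw [show i + (2 * m - 2) + 2 = i + 1 + (2 * m - 1) by omega, hx.2.1]; exact h
  clear hLn hLperm hxt hLlen hyL hyM hy hyW hyin hynot hWL hi0 hi1 hred htp htq hpl hqh q1 q4 q5 q6 q7
  clear hPc hPh hPl hQc hQh hQl
  let g : ℕ → ℕ := fun j => if j = 0 then 0 else 2 * j + 1
  have hg : ∀ j, g j = 0 ∧ j = 0 ∨ g j = 2 * j + 1 ∧ 0 < j := fun j => by
    simp only [g]; split_ifs <;> omega
  have hbt : ∀ b : Bool, b.toNat = 0 ∨ b.toNat = 1 := fun b => by cases b <;> simp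
  obtain ⟨P, Q, q1, q2, q3, q4, q5, q6, q7⟩ := merge_lemma H cls W (m - 2) (by omega)
      (fun u hu v hv => cross_adj hGH W u hu v hv) (fun j b => x (i + g j + b.toNat))
      (fun j _ b h => hW _ h _ rfl) (by
        intro j1 j2 hij hj b b' e
        have g1 := hg j1
        have g2 := hg j2
        have b1 := hbt b
        have b2 := hbt b'
        exact hne _ _ (by omega) (by omega) e)
      (fun j hj κ => hpp (i + g j) κ) h2
  obtain ⟨hP0, hPc, hPh, hPl⟩ := q2
  obtain ⟨hQ0, hQc, hQh, hQl⟩ := q3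
  have hnm : ∀ r, (r = 2 ∨ r = 2 * m - 2) → x (i + r) ∉ P ++ Q := by
    intro r hr h
    rcases q5 _ h with h | ⟨j, hj, b, h⟩
    · exact hW _ h _ rfl
    · have g1 := hg j
      have b1 := hbt b
      rcases lt_or_gt_of_ne (show i + r ≠ i + g j + b.toNat by omega) with hlt | hlt
      · exact hne _ _ hlt (by omega) h
      · exact hne _ _ hlt (by omega) h.symm
  set a := x (i + 2) with ha
  set c := x (i + (2 * m - 2)) with hc
  have hac : a ≠ c := hne _ _ (by omega) (by omega)
  have ham := hnm 2 (Or.inl rfl)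
  have hcm := hnm _ (Or.inr rfl)
  rw [← ha] at ham
  rw [← hc] at hcm
  have hperm : ((P ++ a :: Q) ++ [c]).Perm (c :: a :: (P ++ Q)) :=
    List.perm_append_comm.trans (List.Perm.cons _ List.perm_middle)
  have hlen : ((P ++ a :: Q) ++ [c]).length = 2 * m := by
    rw [hperm.length_eq]; simp only [List.length_cons, List.length_append]; omega
  apply hmaxH (2 * m) (by omega)
  rw [← hlen]
  refine hasC_of_list _ (by omega) ?_ ?_ ?_
  · rw [hperm.nodup_iff, List.nodup_cons, List.nodup_cons]
    refine ⟨?_, ham, q1⟩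
    rw [List.mem_cons]
    rintro (h | h)
    · exact hac h.symm
    · exact hcm h
  · rw [List.isChain_append, List.isChain_append, List.isChain_cons]
    refine ⟨⟨hPc.imp fun _ _ h => h.1, ⟨?_, hQc.imp fun _ _ h => h.1⟩, ?_⟩, by simp, ?_⟩
    · intro z hz
      exact (hu z (hQh z hz)).symm
    · intro z hz z' hz'
      simp only [List.head?_cons, Option.mem_def, Option.some.injEq] at hz'
      subst hz'
      exact hu z (hPl z hz)
    · intro z hz z' hz'
      simp only [List.head?_cons, Option.mem_def, Option.some.injEq] at hz'
      subst hz'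
      rw [List.getLast?_append_of_ne_nil _ (by simp), List.getLast?_cons] at hz
      apply hv z (hQl z _)
      rw [List.getLast?_eq_some_getLast hQ0] at hz ⊢
      simpa using hz
  · intro z hz z' hz'
    simp only [List.getLast?_append, List.getLast?_singleton, Option.some_or, Option.mem_def, Option.some.injEq] at hz
    subst hz
    rw [List.append_assoc, List.head?_append_of_ne_nil _ hP0] at hz'
    exact (hv z' (hPh z' hz')).symm

lemma hasC4 {V : Type*} {G : SimpleGraph V} (u v a b : V) (huv : u ≠ v) (hab : a ≠ b)
    (h1 : G.Adj u a) (h2 : G.Adj u b) (h3 : G.Adj v a) (h4 : G.Adj v b) : HasC G 4 := by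
  refine hasC_of_list [u, a, v, b] (by simp) ?_ (by simp [h1, h3.symm, h4]) (by simp [h2.symm])
  simp [h1.ne, h2.ne, huv, hab, h3.ne.symm, h4.ne]

lemma hasC4_aux {V : Type*} [Fintype V] {G H : SimpleGraph V}
    (hGH : ∀ u v, u ≠ v → G.Adj u v ∨ H.Adj u v) (hV : Fintype.card V = 8) (v : V) (N : Finset V)
    (hN : N.card = 4) (hNv : ∀ a ∈ N, G.Adj v a) : HasC G 4 ∨ HasC H 4 := by
  classical
  by_cases hred : ∃ u, u ≠ v ∧ u ∉ N ∧ ∃ a ∈ N, ∃ b ∈ N, a ≠ b ∧ G.Adj u a ∧ G.Adj u b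
  · obtain ⟨u, hu, -, a, ha, b, hb, hab, h1, h2⟩ := hred
    exact Or.inl (hasC4 u v a b hu hab h1 h2 (hNv a ha) (hNv b hb))
  · right
    push Not at hred
    have hvN : v ∉ N := fun h => (hNv v h).ne rfl
    have hc : ((insert v N)ᶜ).card = 3 := by
      rw [Finset.card_compl, Finset.card_insert_of_notMem hvN]; omega
    obtain ⟨u, hu, u', hu', huu⟩ := Finset.one_lt_card.1 (show 1 < ((insert v N)ᶜ).card by omega)
    simp only [Finset.mem_compl, Finset.mem_insert, not_or] at hu hu'
    have hle : ∀ u, u ≠ v → u ∉ N → (N.filter (fun a => G.Adj u a)).card ≤ 1 := by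
      intro u h1 h2
      rw [Finset.card_le_one]
      intro a ha b hb
      rw [Finset.mem_filter] at ha hb
      by_contra hab
      exact hred u h1 h2 a ha.1 b hb.1 hab ha.2 hb.2
    have e1 := hle u hu.1 hu.2
    have e2 := hle u' hu'.1 hu'.2
    set F := N.filter (fun a => G.Adj u a)
    set F' := N.filter (fun a => G.Adj u' a)
    have e3 := Finset.card_union_le F F'
    have e4 := Finset.le_card_sdiff (F ∪ F') N
    obtain ⟨a, ha, b, hb, hab⟩ := Finset.one_lt_card.1 (show 1 < (N \ (F ∪ F')).card by omega)
    have hbl : ∀ a ∈ N \ (F ∪ F'), H.Adj u a ∧ H.Adj u' a := by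
      intro a ha
      simp only [F, F', Finset.mem_sdiff, Finset.mem_union, Finset.mem_filter, not_or, not_and] at ha
      exact ⟨(hGH u a (fun e => hu.2 (e ▸ ha.1))).resolve_left (ha.2.1 ha.1),
        (hGH u' a (fun e => hu'.2 (e ▸ ha.1))).resolve_left (ha.2.2 ha.1)⟩
    exact hasC4 u u' a b huu hab (hbl a ha).1 (hbl b hb).1 (hbl a ha).2 (hbl b hb).2

lemma hasC4_eight {V : Type*} [Fintype V] {G H : SimpleGraph V}
    (hGH : ∀ u v, u ≠ v → G.Adj u v ∨ H.Adj u v) (hV : Fintype.card V = 8) :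
    HasC G 4 ∨ HasC H 4 := by
  classical
  obtain ⟨v⟩ : Nonempty V := Fintype.card_pos_iff.1 (by omega)
  have h1 := Finset.card_filter_add_card_filter_not (s := univ.erase v) (fun a => G.Adj v a)
  rw [Finset.card_erase_of_mem (Finset.mem_univ _), Finset.card_univ, hV] at h1
  by_cases h4 : 4 ≤ ((univ.erase v).filter (fun a => G.Adj v a)).card
  · obtain ⟨N, hN, hc⟩ := Finset.exists_subset_card_eq h4
    exact hasC4_aux hGH hV v N hc fun a ha => (Finset.mem_filter.1 (hN ha)).2
  · obtain ⟨N, hN, hc⟩ := Finset.exists_subset_card_eq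
      (show 4 ≤ ((univ.erase v).filter (fun a => ¬ G.Adj v a)).card by omega)
    refine (hasC4_aux (fun u v e => (hGH u v e).symm) hV v N hc fun a ha => ?_).symm
    have := Finset.mem_filter.1 (hN ha)
    exact (hGH v a (Finset.ne_of_mem_erase this.1).symm).resolve_left this.2

lemma HasC.of_comap {V U : Type*} {G : SimpleGraph V} (f : U → V) (hf : Function.Injective f) {l : ℕ}
    (h : HasC (G.comap f) l) : HasC G l := by
  obtain ⟨x, hx⟩ := h
  exact ⟨fun i => f (x i), hx.1, fun i => by simp only [hx.2.1], fun i => hx.2.2.1 i,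
    fun i j hi hj e => hx.2.2.2 i j hi hj (hf e)⟩

theorem long_cycle (m : ℕ) (hm : 3 ≤ m) : ∀ {V : Type} [Fintype V] (G H : SimpleGraph V),
    (∀ u v, u ≠ v → G.Adj u v ∨ H.Adj u v) → Fintype.card V = 3 * m - 1 →
    ∃ l, 2 * m ≤ l ∧ (HasC G l ∨ HasC H l) := by
  induction m with
  | zero => omega
  | succ m ih =>
    intro V _ G H hGH hV
    have hHG : ∀ u v, u ≠ v → H.Adj u v ∨ G.Adj u v := fun u v e => (hGH u v e).symm
    by_contra hcon
    push Not at hcon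
    have hG : ∀ l > 2 * (m + 1) - 1, ¬ HasC G l := fun l hl => (hcon l (by omega)).1
    have hH : ∀ l > 2 * (m + 1) - 1, ¬ HasC H l := fun l hl => (hcon l (by omega)).2
    have hB : ¬ HasC G (2 * (m + 1) - 1) ∧ ¬ HasC H (2 * (m + 1) - 1) := by
      constructor
      · rintro ⟨x, hx⟩; exact caseB hGH hm hV hx hG hH
      · rintro ⟨x, hx⟩; exact caseB hHG hm hV hx hH hG
    obtain ⟨l, hl, hc⟩ : ∃ l, 2 * m ≤ l ∧ (HasC G l ∨ HasC H l) := by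
      by_cases h3 : m = 2
      · subst h3; exact ⟨4, by omega, hasC4_eight hGH (by omega)⟩
      · obtain ⟨S, -, hS⟩ := Finset.exists_subset_card_eq (s := (univ : Finset V)) (n := 3 * m - 1)
          (by rw [Finset.card_univ]; omega)
        obtain ⟨l, hl, h⟩ := ih (by omega) (V := S) (G.comap (fun v : S => (v : V))) (H.comap (fun v : S => (v : V)))
          (fun u v e => hGH u v (fun h => e (Subtype.ext h))) (by simp [hS])
        exact ⟨l, hl, h.imp (HasC.of_comap _ Subtype.val_injective) (HasC.of_comap _ Subtype.val_injective)⟩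
    have hl2 : l = 2 * (m + 1) - 2 := by
      by_contra hne
      by_cases h1 : l = 2 * (m + 1) - 1
      · subst h1; tauto
      · exact (not_or.2 (hcon l (by omega))) hc
    have hG' : ∀ l' > 2 * (m + 1) - 2, ¬ HasC G l' := fun l' h => by
      by_cases e : l' = 2 * (m + 1) - 1
      · rw [e]; exact hB.1
      · exact hG l' (by omega)
    have hH' : ∀ l' > 2 * (m + 1) - 2, ¬ HasC H l' := fun l' h => by
      by_cases e : l' = 2 * (m + 1) - 1
      · rw [e]; exact hB.2
      · exact hH l' (by omega)
    subst hl2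
    rcases hc with ⟨x, hx⟩ | ⟨x, hx⟩
    · exact hH _ (by omega) (caseA hGH hm hV hx hG')
    · exact hG _ (by omega) (caseA hHG hm hV hx hH')

theorem exists_mono_cycle (m : ℕ) (hm : 3 ≤ m) {V : Type} [Fintype V] (G : SimpleGraph V)
    (hV : Fintype.card V = 3 * m - 1) : HasC G (2 * m) ∨ HasC Gᶜ (2 * m) := by
  have hGH : ∀ u v, u ≠ v → G.Adj u v ∨ Gᶜ.Adj u v := fun u v e => by
    by_cases h : G.Adj u v
    · exact Or.inl h
    · exact Or.inr ((SimpleGraph.compl_adj _ _ _).2 ⟨e, h⟩)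
  obtain ⟨l, hl, h⟩ := long_cycle m hm G Gᶜ hGH hV
  exact down_all hGH hm l hl h

lemma cycleSeq_card_ge {V : Type*} [Finite V] {G : SimpleGraph V} {k : ℕ} (h : HasC G k) :
    2 * k ≤ Nat.card {f : Fin k → V // IsCycleSeq G k f} := by
  classical
  have := Fintype.ofFinite V
  obtain ⟨x, hx⟩ := h
  have h3 := hx.1
  have hne : ∀ a b, a < b → b < a + k → x a ≠ x b := fun a b h1 h2 e => by
    have := hx.inj' h1.le h2 e; omega
  have hmod : ∀ i, i < k → (i + 1 < k ∧ (i + 1) % k = i + 1) ∨ (i + 1 = k ∧ (i + 1) % k = 0) := by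
    intro i hi
    by_cases hh : i + 1 < k
    · exact Or.inl ⟨hh, Nat.mod_eq_of_lt hh⟩
    · have : i + 1 = k := by omega
      exact Or.inr ⟨this, by rw [this, Nat.mod_self]⟩
  have hf1 : ∀ a : Fin k, IsCycleSeq G k (fun i => x (i + a)) := by
    intro a
    refine ⟨fun i j e => ?_, fun i => ?_⟩
    · exact Fin.ext ((hx.shift a).2.2.2 i j i.2 j.2 e)
    · rcases hmod i i.2 with ⟨h1, h2⟩ | ⟨h1, h2⟩
      · simp only [h2]; exact (hx.shift a).2.2.1 i
      · simp only [h2]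
        have := (hx.shift a).2.2.1 i
        simp only [h1] at this
        rw [show x (k + a) = x (0 + a) by rw [add_comm k, hx.2.1, zero_add]] at this
        exact this
  have hf2 : ∀ a : Fin k, IsCycleSeq G k (fun i => x (a + (k - i))) := by
    intro a
    refine ⟨fun i j e => ?_, fun i => ?_⟩
    · rcases lt_trichotomy i.1 j.1 with hh | hh | hh
      · exact absurd e.symm (hne _ _ (by omega) (by omega))
      · exact Fin.ext hh
      · exact absurd e (hne _ _ (by omega) (by omega))
    · rcases hmod i i.2 with ⟨h1, h2⟩ | ⟨h1, h2⟩
      · simp only [h2]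
        have := (hx.2.2.1 (a + (k - (i + 1)))).symm
        rwa [show a.1 + (k - (i + 1)) + 1 = a + (k - i) by omega] at this
      · simp only [h2, Nat.sub_zero, hx.2.1]
        rw [show k - i.1 = 1 by omega]
        exact (hx.2.2.1 a).symm
  let F : Bool × Fin k → {f : Fin k → V // IsCycleSeq G k f} := fun q =>
    if q.1 then ⟨_, hf1 q.2⟩ else ⟨_, hf2 q.2⟩
  have hFi : Function.Injective F := by
    have k0 : 0 < k := by omega
    have k1 : 1 < k := by omega
    have h0 : ∀ q, (F q).1 ⟨0, k0⟩ = x q.2 := by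
      rintro ⟨b, a⟩
      cases b <;> simp [F, hx.2.1]
    rintro ⟨b, a⟩ ⟨b', a'⟩ e
    have ha : a = a' := by
      have := h0 (b, a)
      rw [e, h0] at this
      exact Fin.ext (hx.2.2.2 _ _ a'.2 a.2 this).symm
    subst ha
    have e1 := congrFun (congrArg Subtype.val e) ⟨1, k1⟩
    cases b <;> cases b' <;> simp [F] at e1 ⊢
    · exact hne (1 + a) (a + (k - 1)) (by omega) (by omega) e1.symm
    · exact hne (1 + a) (a + (k - 1)) (by omega) (by omega) e1
  have := Nat.card_le_card_of_injective F hFi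
  simpa [Nat.card_eq_fintype_card] using this

lemma perm_step {α β : Type*} [Fintype α] [Fintype β] [DecidableEq α] [DecidableEq β] (M Δ : ℕ)
    (hα : Fintype.card α = M) (hM : 4 * Δ + 2 ≤ M) (F : Finset (α × β)) (e : α × β)
    (he : e ∉ F) (hr : ∀ x, (univ.filter (fun y => (x, y) ∈ insert e F)).card ≤ Δ)
    (hc : ∀ y, (univ.filter (fun x => (x, y) ∈ insert e F)).card ≤ Δ) :
    (M : ℝ) * (univ.filter (fun σ : α ≃ β => ∀ x, (x, σ x) ∉ F)).card ≤
      (M + 2) * (univ.filter (fun σ : α ≃ β => ∀ x, (x, σ x) ∉ insert e F)).card := by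
  obtain ⟨x0, y0⟩ := e
  set N' := univ.filter (fun σ : α ≃ β => ∀ x, (x, σ x) ∉ insert (x0, y0) F) with hN'
  set K := univ.filter (fun σ : α ≃ β => (∀ x, (x, σ x) ∉ F) ∧ σ x0 = y0) with hK
  have hsplit : univ.filter (fun σ : α ≃ β => ∀ x, (x, σ x) ∉ F) = N' ∪ K := by
    ext σ
    simp only [hN', hK, Finset.mem_filter, Finset.mem_univ, true_and, Finset.mem_union,
      Finset.mem_insert, not_or, Prod.mk.injEq]
    constructor
    · intro h
      by_cases h0 : σ x0 = y0
      · exact Or.inr ⟨h, h0⟩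
      · exact Or.inl fun x => ⟨fun hh => h0 (hh.1 ▸ hh.2), h x⟩
    · rintro (h | h)
      · exact fun x => (h x).2
      · exact h.1
  have hcard : (univ.filter (fun σ : α ≃ β => ∀ x, (x, σ x) ∉ F)).card ≤ N'.card + K.card := by
    rw [hsplit]; exact Finset.card_union_le _ _
  let good : (α ≃ β) → Finset α := fun σ =>
    univ.filter (fun x => x ≠ x0 ∧ (x, y0) ∉ F ∧ (x0, σ x) ∉ insert (x0, y0) F)
  have hgood : ∀ σ : α ≃ β, M ≤ 2 * (good σ).card := by
    intro σ
    set B1 := univ.filter (fun x => (x, y0) ∈ insert (x0, y0) F)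
    set B2 := univ.filter (fun x => (x0, σ x) ∈ insert (x0, y0) F)
    have hb1 : B1.card ≤ Δ := hc y0
    have hb2 : B2.card ≤ Δ := by
      refine le_trans ?_ (hr x0)
      refine Finset.card_le_card_of_injOn σ ?_ (σ.injective.injOn)
      intro x hx
      simpa [B2] using hx
    have hsub : (univ : Finset α) ⊆ good σ ∪ (B1 ∪ B2) := by
      intro x _
      by_cases hx0 : x = x0
      · simp [B1, hx0]
      · simp only [good, B1, B2, Finset.mem_union, Finset.mem_filter, Finset.mem_univ, true_and,
          Finset.mem_insert, Prod.mk.injEq, hx0, false_and, false_or]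
        tauto
    have := Finset.card_le_card hsub
    rw [Finset.card_univ, hα] at this
    have h2 := Finset.card_union_le (good σ) (B1 ∪ B2)
    have h3 := Finset.card_union_le B1 B2
    omega
  have hinj : (K.sigma good).card ≤ N'.card := by
    refine Finset.card_le_card_of_injOn (fun q => (Equiv.swap x0 q.2).trans q.1) ?_ ?_
    · rintro ⟨σ, x1⟩ hq
      rw [Finset.mem_coe, Finset.mem_sigma] at hq
      simp only [hK, good, Finset.mem_filter, Finset.mem_univ, true_and] at hq
      obtain ⟨⟨hσ, h0⟩, hx1, hx1F, hx0F⟩ := hq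
      simp only [hN', Finset.coe_filter, Finset.mem_univ, true_and, Set.mem_setOf_eq, Equiv.trans_apply]
      intro x
      by_cases c0 : x = x0
      · subst c0; rw [Equiv.swap_apply_left]; exact hx0F
      · by_cases c1 : x = x1
        · subst c1
          rw [Equiv.swap_apply_right, h0, Finset.mem_insert, not_or]
          exact ⟨fun h => c0 (Prod.mk.inj h).1, hx1F⟩
        · rw [Equiv.swap_apply_of_ne_of_ne c0 c1, Finset.mem_insert, not_or]
          exact ⟨fun h => c0 (Prod.mk.inj h).1, hσ x⟩
    · rintro ⟨σ, x1⟩ hq ⟨σ', x1'⟩ hq' e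
      rw [Finset.mem_coe, Finset.mem_sigma] at hq hq'
      simp only [hK, good, Finset.mem_filter, Finset.mem_univ, true_and] at hq hq'
      simp only at e
      have e1 : x1 = x1' := by
        have a1 : ((Equiv.swap x0 x1).trans σ) x1 = y0 := by
          rw [Equiv.trans_apply, Equiv.swap_apply_right]; exact hq.1.2
        have a2 : ((Equiv.swap x0 x1').trans σ') x1' = y0 := by
          rw [Equiv.trans_apply, Equiv.swap_apply_right]; exact hq'.1.2
        rw [e] at a1
        exact Equiv.injective _ (a1.trans a2.symm)
      subst e1
      have : σ = σ' := by
        have := congrArg (fun τ => (Equiv.swap x0 x1).trans τ) e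
        simpa [← Equiv.trans_assoc] using this
      subst this
      rfl
  have hKc : M * K.card ≤ 2 * N'.card := by
    rw [Finset.card_sigma] at hinj
    calc M * K.card = ∑ σ ∈ K, M := by rw [Finset.sum_const, smul_eq_mul, mul_comm]
      _ ≤ ∑ σ ∈ K, 2 * (good σ).card := Finset.sum_le_sum fun σ _ => hgood σ
      _ = 2 * ∑ σ ∈ K, (good σ).card := by rw [Finset.mul_sum]
      _ ≤ 2 * N'.card := by omega
  have : M * (univ.filter (fun σ : α ≃ β => ∀ x, (x, σ x) ∉ F)).card ≤ (M + 2) * N'.card := by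
    nlinarith
  exact_mod_cast this

lemma perm_count {α β : Type*} [Fintype α] [Fintype β] [DecidableEq α] [DecidableEq β] (M Δ : ℕ)
    (hα : Fintype.card α = M) (hβ : Fintype.card β = M) (hM : 4 * Δ + 2 ≤ M) (F : Finset (α × β))
    (hr : ∀ x, (univ.filter (fun y => (x, y) ∈ F)).card ≤ Δ)
    (hc : ∀ y, (univ.filter (fun x => (x, y) ∈ F)).card ≤ Δ) :
    (M.factorial : ℝ) ≤ (1 + 2 / M) ^ F.card *
      (univ.filter (fun σ : α ≃ β => ∀ x, (x, σ x) ∉ F)).card := by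
  have hM0 : (0 : ℝ) < M := by exact_mod_cast (by omega : 0 < M)
  induction F using Finset.induction_on with
  | empty =>
    have e : α ≃ β := Fintype.equivOfCardEq (hα.trans hβ.symm)
    simp [Fintype.card_equiv e, hα]
  | insert e F he ih =>
    have h1 := ih (fun x => le_trans (Finset.card_le_card (fun y hy => by
      simp only [Finset.mem_filter, Finset.mem_univ, true_and, Finset.mem_insert] at hy ⊢; exact Or.inr hy)) (hr x))
      (fun y => le_trans (Finset.card_le_card (fun x hx => by
      simp only [Finset.mem_filter, Finset.mem_univ, true_and, Finset.mem_insert] at hx ⊢; exact Or.inr hx)) (hc y))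
    have h2 := perm_step M Δ hα hM F e he hr hc
    rw [Finset.card_insert_of_notMem he, pow_succ, mul_assoc]
    refine h1.trans (mul_le_mul_of_nonneg_left ?_ (by positivity))
    rw [show (1 + 2 / (M : ℝ)) = (M + 2) / M by field_simp, div_mul_eq_mul_div, le_div_iff₀ hM0]
    linarith

noncomputable def sdr {α β : Type*} [Fintype α] [Fintype β] (A : α → Finset β) (b0 : β)
    (S : Finset α) : Finset (α → β) := by
  classical
  exact univ.filter (fun f => (∀ i ∈ S, f i ∈ A i) ∧ (∀ i ∉ S, f i = b0) ∧ Set.InjOn f S)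

lemma mem_sdr {α β : Type*} [Fintype α] [Fintype β] (A : α → Finset β) (b0 : β)
    (S : Finset α) (f : α → β) : f ∈ sdr A b0 S ↔
    (∀ i ∈ S, f i ∈ A i) ∧ (∀ i ∉ S, f i = b0) ∧ Set.InjOn f S := by
  simp [sdr]

lemma sdr_step {α β : Type*} [Fintype α] [Fintype β] [DecidableEq α] (A : α → Finset β) (b0 : β)
    (S : Finset α) (i : α) (hi : i ∉ S) (c : ℕ) (hc : c + S.card ≤ (A i).card) :
    c * (sdr A b0 S).card ≤ (sdr A b0 (insert i S)).card := by
  classical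
  have h1 : c * (sdr A b0 S).card ≤ ((sdr A b0 S).sigma (fun f => A i \ S.image f)).card := by
    rw [Finset.card_sigma, mul_comm, ← smul_eq_mul]
    refine Finset.card_nsmul_le_sum _ _ _ fun f _ => ?_
    have h2 := Finset.le_card_sdiff (S.image f) (A i)
    have h3 : (S.image f).card ≤ S.card := Finset.card_image_le
    omega
  refine h1.trans (Finset.card_le_card_of_injOn (fun q => Function.update q.1 i q.2) ?_ ?_)
  · rintro ⟨f, b⟩ hq
    simp only [Finset.mem_coe, Finset.mem_sigma, mem_sdr, Finset.mem_sdiff, Finset.mem_image, not_exists, not_and] at hq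
    obtain ⟨⟨f1, f2, f3⟩, hb, hb'⟩ := hq
    have hfS : ∀ j ∈ S, Function.update f i b j = f j := fun j hj =>
      Function.update_of_ne (fun h : j = i => hi (h ▸ hj)) _ _
    simp only [Finset.mem_coe, mem_sdr]
    refine ⟨?_, ?_, ?_⟩
    · intro j hj
      rcases Finset.mem_insert.1 hj with rfl | hj
      · rw [Function.update_self]; exact hb
      · rw [hfS j hj]; exact f1 j hj
    · intro j hj
      rw [Finset.mem_insert, not_or] at hj
      rw [Function.update_of_ne hj.1]; exact f2 j hj.2
    · intro j hj j' hj' e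
      simp only [Finset.coe_insert, Set.mem_insert_iff, Finset.mem_coe] at hj hj'
      rcases hj with rfl | hj <;> rcases hj' with rfl | hj'
      · rfl
      · rw [Function.update_self, hfS j' hj'] at e; exact absurd e.symm (hb' j' hj')
      · rw [Function.update_self, hfS j hj] at e; exact absurd e (hb' j hj)
      · rw [hfS j hj, hfS j' hj'] at e; exact f3 hj hj' e
  · rintro ⟨f, b⟩ hq ⟨f', b'⟩ hq' e
    simp only [Finset.mem_coe, Finset.mem_sigma, mem_sdr] at hq hq'
    simp only at e
    have eb : b = b' := by simpa using congrFun e i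
    have ef : f = f' := by
      funext j
      by_cases h : j = i
      · rw [h, hq.1.2.1 i hi, hq'.1.2.1 i hi]
      · have := congrFun e j
        rwa [Function.update_of_ne h, Function.update_of_ne h] at this
    subst eb ef; rfl

lemma sdr_count {α β : Type*} [Fintype α] [Fintype β] [DecidableEq α] (A : α → Finset β) (b0 : β)
    (S0 : Finset α) (m c : ℕ) (hm : Fintype.card α = m) (hA : ∀ i, c + S0.card ≤ (A i).card)
    (hA' : ∀ i ∉ S0, m ≤ (A i).card) :
    c ^ S0.card * (m - S0.card).factorial ≤ (sdr A b0 univ).card := by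
  have h1 : ∀ S, S ⊆ S0 → c ^ S.card ≤ (sdr A b0 S).card := by
    intro S
    induction S using Finset.induction_on with
    | empty =>
      intro _
      rw [Finset.card_empty, pow_zero, Nat.one_le_iff_ne_zero, ← Nat.pos_iff_ne_zero, Finset.card_pos]
      exact ⟨fun _ => b0, by simp [mem_sdr]⟩
    | insert i S hi ih =>
      intro hS
      rw [Finset.insert_subset_iff] at hS
      refine le_trans ?_ (sdr_step A b0 S i hi c ?_)
      · rw [Finset.card_insert_of_notMem hi, pow_succ, mul_comm]
        exact Nat.mul_le_mul_left _ (ih hS.2)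
      · have := Finset.card_le_card hS.2; have := hA i; omega
  have h2 : ∀ T, Disjoint S0 T → c ^ S0.card * (m - S0.card).descFactorial T.card ≤
      (sdr A b0 (T ∪ S0)).card := by
    intro T
    induction T using Finset.induction_on with
    | empty => intro _; simpa using h1 S0 le_rfl
    | insert i T hi ih =>
      intro hT
      rw [Finset.disjoint_insert_right] at hT
      have hiu : i ∉ T ∪ S0 := by simp [hi, hT.1]
      have hcu : (T ∪ S0).card = T.card + S0.card := Finset.card_union_of_disjoint hT.2.symm
      have hlt : (T ∪ S0).card ≤ m := by rw [← hm]; exact Finset.card_le_univ _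
      rw [Finset.insert_union]
      refine le_trans ?_ (sdr_step A b0 (T ∪ S0) i hiu (m - S0.card - T.card) ?_)
      · rw [Finset.card_insert_of_notMem hi, Nat.descFactorial_succ, Nat.mul_left_comm]
        exact Nat.mul_le_mul_left _ (ih hT.2)
      · have := hA' i hT.1; omega
  have h3 := h2 S0ᶜ disjoint_compl_right
  rw [Finset.card_compl, hm, Nat.descFactorial_self, Finset.union_comm, Finset.union_compl] at h3
  exact h3

def nx {m : ℕ} (i : Fin m) : Fin m := ⟨(i.val + 1) % m, Nat.mod_lt _ i.pos⟩

lemma nx_inj {m : ℕ} : Function.Injective (nx (m := m)) := by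
  intro i j h
  have h1 : (i.val + 1) % m = (j.val + 1) % m := congrArg Fin.val h
  have hi := i.2
  have hj := j.2
  have e : ∀ a, a < m → (a + 1 < m ∧ (a + 1) % m = a + 1) ∨ (a + 1 = m ∧ (a + 1) % m = 0) := by
    intro a ha
    by_cases hh : a + 1 < m
    · exact Or.inl ⟨hh, Nat.mod_eq_of_lt hh⟩
    · have : a + 1 = m := by omega
      exact Or.inr ⟨this, by rw [this, Nat.mod_self]⟩
  apply Fin.ext
  rcases e i hi with h2 | h2 <;> rcases e j hj with h3 | h3 <;> omega

def Bz {V : Type} (G : SimpleGraph V) (m : ℕ) (x y : Fin m → V) : Prop :=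
  Function.Injective x ∧ Function.Injective y ∧ (∀ i j, x i ≠ y j) ∧
    (∀ i, G.Adj (y i) (x i)) ∧ ∀ i, G.Adj (y i) (x (nx i))

def mix {V : Type} {m : ℕ} (x y : Fin m → V) : Fin (2 * m) → V := fun j =>
  if j.val % 2 = 0 then x ⟨j.val / 2, by have := j.2; omega⟩ else y ⟨j.val / 2, by have := j.2; omega⟩

lemma mix_even {V : Type} {m : ℕ} (x y : Fin m → V) (j : Fin (2 * m)) (i : Fin m) (h : j.val = 2 * i.val) :
    mix x y j = x i := by
  unfold mix
  rw [if_pos (by omega)]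
  congr 1
  apply Fin.ext
  show j.val / 2 = i.val
  omega

lemma mix_odd {V : Type} {m : ℕ} (x y : Fin m → V) (j : Fin (2 * m)) (i : Fin m) (h : j.val = 2 * i.val + 1) :
    mix x y j = y i := by
  unfold mix
  rw [if_neg (by omega)]
  congr 1
  apply Fin.ext
  show j.val / 2 = i.val
  omega

lemma mix_cases {m : ℕ} (j : Fin (2 * m)) : ∃ i : Fin m, j.val = 2 * i.val ∨ j.val = 2 * i.val + 1 :=
  ⟨⟨j.val / 2, by have := j.2; omega⟩, by dsimp only; omega⟩

lemma mix_cycle {V : Type} {G : SimpleGraph V} {m : ℕ} {x y : Fin m → V} (h : Bz G m x y) :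
    IsCycleSeq G (2 * m) (mix x y) := by
  obtain ⟨hx, hy, hxy, h1, h2⟩ := h
  refine ⟨fun j j' e => ?_, fun j => ?_⟩
  · obtain ⟨i, hi⟩ := mix_cases j
    obtain ⟨i', hi'⟩ := mix_cases j'
    rcases hi with hi | hi <;> rcases hi' with hi' | hi'
    · rw [mix_even x y j i hi, mix_even x y j' i' hi'] at e
      have := congrArg Fin.val (hx e)
      exact Fin.ext (by omega)
    · rw [mix_even x y j i hi, mix_odd x y j' i' hi'] at e
      exact absurd e (hxy _ _)
    · rw [mix_odd x y j i hi, mix_even x y j' i' hi'] at e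
      exact absurd e.symm (hxy _ _)
    · rw [mix_odd x y j i hi, mix_odd x y j' i' hi'] at e
      have := congrArg Fin.val (hy e)
      exact Fin.ext (by omega)
  · obtain ⟨i, hi⟩ := mix_cases j
    have hj := j.2
    rcases hi with hi | hi
    · rw [mix_even x y j i hi, mix_odd x y _ i]
      · exact (h1 i).symm
      · show (j.val + 1) % (2 * m) = _
        rw [Nat.mod_eq_of_lt (by omega)]; omega
    · rw [mix_odd x y j i hi, mix_even x y _ (nx i)]
      · exact h2 i
      · show (j.val + 1) % (2 * m) = 2 * ((i.val + 1) % m)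
        rw [hi, show 2 * i.val + 1 + 1 = 2 * (i.val + 1) by ring, Nat.mul_mod_mul_left]

lemma mix_count {V : Type} [Fintype V] (G : SimpleGraph V) (m : ℕ)
    (P : Finset ((Fin m → V) × (Fin m → V))) (hP : ∀ q ∈ P, Bz G m q.1 q.2) :
    P.card ≤ Nat.card {f : Fin (2 * m) → V // IsCycleSeq G (2 * m) f} := by
  classical
  rw [Nat.card_eq_fintype_card, Fintype.card_subtype]
  refine Finset.card_le_card_of_injOn (fun q => mix q.1 q.2) ?_ ?_
  · intro q hq
    simp only [Finset.coe_filter, Finset.mem_univ, true_and]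
    exact mix_cycle (hP q hq)
  · rintro ⟨x, y⟩ - ⟨x', y'⟩ - e
    have e' : mix x y = mix x' y' := e
    have h1 : x = x' := by
      funext i
      have := congrFun e' ⟨2 * i.val, by have := i.2; omega⟩
      rwa [mix_even x y _ i rfl, mix_even x' y' _ i rfl] at this
    have h2 : y = y' := by
      funext i
      have := congrFun e' ⟨2 * i.val + 1, by have := i.2; omega⟩
      rwa [mix_odd x y _ i rfl, mix_odd x' y' _ i rfl] at this
    rw [h1, h2]

lemma lemH_perm {V : Type} [Fintype V] [DecidableEq V] (G : SimpleGraph V) [DecidableRel G.Adj]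
    (m : ℕ) (hm : 100 ≤ m) (Y D : Finset V)
    (hY : Y.card = m) (hDY : D ⊆ Y) (hD : 20 * D.card ≤ m) (x : Fin m → V)
    (hx : Function.Injective x) (hxY : ∀ i, x i ∉ Y) (q : V → Fin m) (hq : Set.InjOn q D)
    (hq1 : ∀ d ∈ D, G.Adj d (x (q d))) (hq2 : ∀ d ∈ D, G.Adj d (x (nx (q d))))
    (h1 : ∀ y ∈ Y \ D, 20 * (univ.filter (fun i => ¬ G.Adj y (x i))).card ≤ m)
    (h2 : ∀ i, 20 * ((Y \ D).filter (fun y => ¬ G.Adj y (x i))).card ≤ m)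
    (Z : Finset (Fin m → V)) (hZ : ∀ y, Bz G m x y → (∀ d ∈ D, y (q d) = d) → y ∈ Z) :
    ((m - D.card).factorial : ℝ) ≤ Real.exp (m / 5) * Z.card := by
  classical
  set s := m - D.card with hs
  have hi : (D.image q).card = D.card := Finset.card_image_of_injOn hq
  let α := {i // i ∈ (D.image q)ᶜ}
  let β := {y // y ∈ Y \ D}
  have hα : Fintype.card α = s := by
    rw [Fintype.card_coe, Finset.card_compl, hi, Fintype.card_fin]
  have hβ : Fintype.card β = s := by
    rw [Fintype.card_coe, Finset.card_sdiff_of_subset hDY, hY]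
  let F : Finset (α × β) := univ.filter (fun z => ¬ G.Adj z.2.1 (x z.1.1) ∨ ¬ G.Adj z.2.1 (x (nx z.1.1)))
  have hr : ∀ i : α, (univ.filter (fun y : β => (i, y) ∈ F)).card ≤ 2 * (m / 20) := by
    intro i
    have e1 : ((univ.filter (fun y : β => (i, y) ∈ F)).image Subtype.val) ⊆
        ((Y \ D).filter (fun y => ¬ G.Adj y (x i.1))) ∪ ((Y \ D).filter (fun y => ¬ G.Adj y (x (nx i.1)))) := by
      intro v hv
      obtain ⟨y, hy, rfl⟩ := Finset.mem_image.1 hv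
      simp only [F, Finset.mem_filter, Finset.mem_univ, true_and] at hy
      have := y.2
      rcases hy with hy | hy
      · exact Finset.mem_union_left _ (Finset.mem_filter.2 ⟨this, hy⟩)
      · exact Finset.mem_union_right _ (Finset.mem_filter.2 ⟨this, hy⟩)
    have e2 := (Finset.card_le_card e1).trans (Finset.card_union_le _ _)
    rw [Finset.card_image_of_injective _ Subtype.val_injective] at e2
    have := h2 i.1
    have := h2 (nx i.1)
    omega
  have hc : ∀ y : β, (univ.filter (fun i : α => (i, y) ∈ F)).card ≤ 2 * (m / 20) := by
    intro y
    have e1 : ((univ.filter (fun i : α => (i, y) ∈ F)).image Subtype.val) ⊆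
        (univ.filter (fun i => ¬ G.Adj y.1 (x i))) ∪ (univ.filter (fun i => ¬ G.Adj y.1 (x (nx i)))) := by
      intro v hv
      obtain ⟨i, hy, rfl⟩ := Finset.mem_image.1 hv
      simp only [F, Finset.mem_filter, Finset.mem_univ, true_and] at hy
      rcases hy with hy | hy
      · exact Finset.mem_union_left _ (Finset.mem_filter.2 ⟨Finset.mem_univ _, hy⟩)
      · exact Finset.mem_union_right _ (Finset.mem_filter.2 ⟨Finset.mem_univ _, hy⟩)
    have e2 := (Finset.card_le_card e1).trans (Finset.card_union_le _ _)
    rw [Finset.card_image_of_injective _ Subtype.val_injective] at e2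
    have e3 : (univ.filter (fun i => ¬ G.Adj y.1 (x (nx i)))).card ≤ (univ.filter (fun i => ¬ G.Adj y.1 (x i))).card :=
      Finset.card_le_card_of_injOn nx (fun i hi => by simpa using hi) (nx_inj.injOn)
    have := h1 y.1 y.2
    omega
  have hF : F.card ≤ s * (2 * (m / 20)) := by
    have e1 : F.card = ∑ i : α, (univ.filter (fun y : β => (i, y) ∈ F)).card := by
      rw [← Finset.card_sigma]
      refine Finset.card_bij (fun z _ => ⟨z.1, z.2⟩) ?_ ?_ ?_
      · intro z hz; simpa using hz
      · rintro ⟨a, b⟩ _ ⟨a', b'⟩ _ e; simpa using e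
      · rintro ⟨a, b⟩ hab; exact ⟨(a, b), by simpa using hab, rfl⟩
    rw [e1, ← hα]
    calc _ ≤ ∑ i : α, 2 * (m / 20) := Finset.sum_le_sum fun i _ => hr i
      _ = _ := by simp
  have hmain := perm_count s (2 * (m / 20)) hα hβ (by omega) F hr hc
  have hs0 : (0 : ℝ) < s := by have : 0 < s := by omega
                               exact_mod_cast this
  have hexp : (1 + 2 / (s : ℝ)) ^ F.card ≤ Real.exp (m / 5) := by
    calc (1 + 2 / (s : ℝ)) ^ F.card ≤ (Real.exp (2 / s)) ^ F.card := by
          gcongr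
          have := Real.add_one_le_exp (2 / (s : ℝ))
          linarith
      _ = Real.exp (F.card * (2 / s)) := (Real.exp_nat_mul _ _).symm
      _ ≤ Real.exp (m / 5) := by
          gcongr
          have a1 : (F.card : ℝ) ≤ s * (2 * (m / 20)) := by
            have : (F.card : ℝ) ≤ ((s * (2 * (m / 20)) : ℕ) : ℝ) := by exact_mod_cast hF
            refine this.trans ?_
            push_cast
            gcongr
            exact Nat.cast_div_le
          calc (F.card : ℝ) * (2 / s) ≤ s * (2 * (m / 20)) * (2 / s) := by gcongr
            _ = m / 5 := by field_simp; ring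
  refine hmain.trans (mul_le_mul hexp ?_ (by positivity) (by positivity))
  have hch : ∀ i (h : i ∈ D.image q), ∃ d, d ∈ D ∧ q d = i := fun i h => Finset.mem_image.1 h
  let ys : (α ≃ β) → Fin m → V := fun σ i =>
    if h : i ∈ D.image q then (hch i h).choose else (σ ⟨i, Finset.mem_compl.2 h⟩).1
  have ys1 : ∀ σ i (h : i ∈ D.image q), ys σ i ∈ D ∧ q (ys σ i) = i := by
    intro σ i h
    simp only [ys, dif_pos h]
    exact (hch i h).choose_spec
  have ys2 : ∀ σ i (h : i ∉ D.image q), ys σ i = (σ ⟨i, Finset.mem_compl.2 h⟩).1 := by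
    intro σ i h
    simp only [ys, dif_neg h]
  have ys3 : ∀ σ i (h : i ∉ D.image q), ys σ i ∈ Y \ D := by
    intro σ i h
    rw [ys2 σ i h]; exact (σ _).2
  have ysY : ∀ σ i, ys σ i ∈ Y := by
    intro σ i
    by_cases h : i ∈ D.image q
    · exact hDY (ys1 σ i h).1
    · exact (Finset.mem_sdiff.1 (ys3 σ i h)).1
  rw [Nat.cast_le]
  refine Finset.card_le_card_of_injOn ys ?_ ?_
  · intro σ hσ
    simp only [Finset.coe_filter, Finset.mem_univ, true_and, F, Finset.mem_filter, not_or, not_not] at hσ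
    have hσ' : ∀ i : α, G.Adj (σ i).1 (x i.1) ∧ G.Adj (σ i).1 (x (nx i.1)) := hσ
    refine hZ _ ⟨hx, ?_, ?_, ?_, ?_⟩ ?_
    · intro i j e
      by_cases h : i ∈ D.image q <;> by_cases h' : j ∈ D.image q
      · have a := (ys1 σ i h).2
        rw [e, (ys1 σ j h').2] at a
        exact a.symm
      · have a := (ys1 σ i h).1
        rw [e] at a
        exact absurd a (Finset.mem_sdiff.1 (ys3 σ j h')).2
      · have a := (ys1 σ j h').1
        rw [← e] at a
        exact absurd a (Finset.mem_sdiff.1 (ys3 σ i h)).2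
      · rw [ys2 σ i h, ys2 σ j h'] at e
        have := σ.injective (Subtype.ext e)
        exact congrArg Subtype.val this
    · intro i j e
      exact hxY i (e ▸ ysY σ j)
    · intro i
      by_cases h : i ∈ D.image q
      · have a := ys1 σ i h
        have b := hq1 _ a.1
        rwa [a.2] at b
      · rw [ys2 σ i h]; exact (hσ' _).1
    · intro i
      by_cases h : i ∈ D.image q
      · have a := ys1 σ i h
        have b := hq2 _ a.1
        rwa [a.2] at b
      · rw [ys2 σ i h]; exact (hσ' _).2
    · intro d hd
      have a := ys1 σ (q d) (Finset.mem_image_of_mem _ hd)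
      exact hq a.1 hd a.2
  · intro σ _ σ' _ e
    ext i
    have := congrFun e i.1
    rw [ys2 σ i.1 (Finset.mem_compl.1 i.2), ys2 σ' i.1 (Finset.mem_compl.1 i.2)] at this
    exact this

lemma fact_ge (n : ℕ) : ((n : ℝ) / 3) ^ n ≤ n.factorial := by
  have h1 := Real.pow_div_factorial_le_exp (n : ℝ) (Nat.cast_nonneg n) n
  have h2 : Real.exp n ≤ 3 ^ n := by
    have : Real.exp n = (Real.exp 1) ^ n := by rw [← Real.exp_nat_mul, mul_one]
    rw [this]
    gcongr
    have := Real.exp_one_lt_d9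
    linarith
  have h3 : (0 : ℝ) < n.factorial := by exact_mod_cast n.factorial_pos
  rw [div_pow, div_le_iff₀ (by positivity)]
  rw [div_le_iff₀ h3] at h1
  calc (n : ℝ) ^ n ≤ Real.exp n * n.factorial := h1
    _ ≤ 3 ^ n * n.factorial := by gcongr
    _ = _ := by ring

lemma lemH {V : Type} [Fintype V] [DecidableEq V] (G : SimpleGraph V) [DecidableRel G.Adj]
    (m : ℕ) (hm : 100 ≤ m) (X Y D : Finset V) (hXY : Disjoint X Y) (hX : m ≤ X.card)
    (hY : Y.card = m) (hDY : D ⊆ Y) (hD : 20 * D.card ≤ m)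
    (h1 : ∀ y ∈ Y \ D, 20 * (X.filter (fun x => ¬ G.Adj y x)).card ≤ m)
    (h2 : ∀ x ∈ X, 20 * ((Y \ D).filter (fun y => ¬ G.Adj y x)).card ≤ m)
    (h3 : ∀ d ∈ D, m ≤ 4 * (X.filter (fun x => G.Adj d x)).card) :
    ((m : ℝ) / 100) ^ (2 * m) ≤ Nat.card {f : Fin (2 * m) → V // IsCycleSeq G (2 * m) f} := by
  classical
  set t := D.card with ht
  let P : Finset ((Fin m → V) × (Fin m → V)) := univ.filter (fun z => Bz G m z.1 z.2)
  have hP := mix_count G m P (fun q hq => (Finset.mem_filter.1 hq).2)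
  refine le_trans ?_ (Nat.cast_le.2 hP)
  have hm0 : (100 : ℝ) ≤ m := by exact_mod_cast hm
  have hD' : 20 * (t : ℝ) ≤ m := by exact_mod_cast hD
  obtain ⟨b0, -⟩ : X.Nonempty := Finset.card_pos.1 (by omega)
  let Q : ({d // d ∈ D} ↪ Fin (m / 2)) → {d // d ∈ D} → Fin m := fun p d =>
    ⟨2 * (p d).val, by have := (p d).2; omega⟩
  have hQ1 : ∀ p d, (Q p d).val + 1 < m := fun p d => by
    have := (p d).2
    show 2 * (p d).val + 1 < m
    omega
  have hnx : ∀ p d, (nx (Q p d)).val = (Q p d).val + 1 := fun p d => Nat.mod_eq_of_lt (hQ1 p d)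
  have hQi : ∀ p d d', (Q p d).val / 2 = (Q p d').val / 2 → d = d' := by
    intro p d d' h
    have h' : 2 * (p d).val / 2 = 2 * (p d').val / 2 := h
    exact p.injective (Fin.ext (by omega))
  let A : ({d // d ∈ D} ↪ Fin (m / 2)) → Fin m → Finset V := fun p i =>
    X.filter (fun v => ∀ d, (Q p d = i ∨ nx (Q p d) = i) → G.Adj d.1 v)
  let W : ({d // d ∈ D} ↪ Fin (m / 2)) → Finset ((Fin m → V) × (Fin m → V)) := fun p =>
    P.filter (fun z => ∀ d, z.2 (Q p d) = d.1)
  have hW : ∀ p, ((m : ℝ) / 30) ^ m * ((m / 4 : ℝ) ^ (m - t) / Real.exp (m / 5)) ≤ (W p).card := by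
    intro p
    let S0 : Finset (Fin m) := (univ.image (Q p)) ∪ (univ.image (fun d => nx (Q p d)))
    have hS0 : S0.card ≤ 2 * t := by
      have e1 := Finset.card_union_le (univ.image (Q p)) (univ.image (fun d => nx (Q p d)))
      have e2 : (univ.image (Q p)).card ≤ t := Finset.card_image_le.trans (by simp [ht])
      have e3 : (univ.image (fun d => nx (Q p d))).card ≤ t := Finset.card_image_le.trans (by simp [ht])
      show ((univ.image (Q p)) ∪ (univ.image (fun d => nx (Q p d)))).card ≤ _
      omega
    have hA' : ∀ i ∉ S0, m ≤ (A p i).card := by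
      intro i hi
      have : A p i = X := by
        refine Finset.filter_true_of_mem fun v _ d hd => ?_
        exfalso
        apply hi
        rcases hd with rfl | rfl
        · exact Finset.mem_union_left _ (Finset.mem_image_of_mem _ (Finset.mem_univ _))
        · exact Finset.mem_union_right _ (Finset.mem_image_of_mem (fun d => nx (Q p d)) (Finset.mem_univ d))
      rw [this]; exact hX
    have hA : ∀ i, m / 8 + S0.card ≤ (A p i).card := by
      intro i
      by_cases hi : i ∈ S0
      · have : ∃ d, Q p d = i ∨ nx (Q p d) = i := by
          rcases Finset.mem_union.1 hi with h | h
          · obtain ⟨d, -, h⟩ := Finset.mem_image.1 h; exact ⟨d, Or.inl h⟩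
          · obtain ⟨d, -, h⟩ := Finset.mem_image.1 h; exact ⟨d, Or.inr h⟩
        obtain ⟨d, hd⟩ := this
        have hval : ∀ d, (Q p d = i ∨ nx (Q p d) = i) → (Q p d).val / 2 = i.val / 2 := by
          intro d hd
          have hev : (Q p d).val = 2 * (p d).val := rfl
          rcases hd with h | h
          · rw [h]
          · have := hnx p d
            rw [h] at this
            omega
        have hsub : X.filter (fun x => G.Adj d.1 x) ⊆ A p i := by
          intro v hv
          obtain ⟨hv1, hv2⟩ := Finset.mem_filter.1 hv
          refine Finset.mem_filter.2 ⟨hv1, fun d' hd' => ?_⟩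
          have : d' = d := hQi p d' d ((hval d' hd').trans (hval d hd).symm)
          rw [this]; exact hv2
        have := Finset.card_le_card hsub
        have := h3 d.1 d.2
        omega
      · have := hA' i hi; omega
    have hcount := sdr_count (A p) b0 S0 m (m / 8) (Fintype.card_fin m) hA hA'
    have hc1 : ((m : ℝ) / 30) ^ m ≤ (sdr (A p) b0 univ).card := by
      have hS : S0.card ≤ m := by omega
      have hSr : (S0.card : ℝ) ≤ 2 * t := by exact_mod_cast hS0
      calc ((m : ℝ) / 30) ^ m = ((m : ℝ) / 30) ^ S0.card * ((m : ℝ) / 30) ^ (m - S0.card) := by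
            rw [← pow_add]; congr 1; omega
        _ ≤ ((m / 8 : ℕ) : ℝ) ^ S0.card * (((m - S0.card : ℕ) : ℝ) / 3) ^ (m - S0.card) := by
            gcongr ?_ ^ _ * ?_ ^ _
            · have : m ≤ 30 * (m / 8) := by omega
              have : (m : ℝ) ≤ 30 * ((m / 8 : ℕ) : ℝ) := by exact_mod_cast this
              linarith
            · rw [Nat.cast_sub hS]; linarith
        _ ≤ ((m / 8 : ℕ) : ℝ) ^ S0.card * ((m - S0.card).factorial : ℝ) := by
            gcongr
            exact fact_ge _
        _ ≤ _ := by exact_mod_cast hcount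
    let q : V → Fin m := fun v => if h : v ∈ D then Q p ⟨v, h⟩ else ⟨0, by omega⟩
    have hqv : ∀ v (h : v ∈ D), q v = Q p ⟨v, h⟩ := fun v h => dif_pos h
    have hZ : ∀ g ∈ sdr (A p) b0 univ, ((m / 4 : ℝ) ^ (m - t) / Real.exp (m / 5)) ≤
        (univ.filter (fun y => Bz G m g y ∧ ∀ d ∈ D, y (q d) = d)).card := by
      intro g hg
      rw [mem_sdr] at hg
      obtain ⟨g1, -, g2⟩ := hg
      have g2' : Function.Injective g := by
        rw [Finset.coe_univ, Set.injOn_univ] at g2; exact g2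
      have gX : ∀ i, g i ∈ X := fun i => (Finset.mem_filter.1 (g1 i (Finset.mem_univ _))).1
      have key := lemH_perm G m hm Y D hY hDY hD g g2' (fun i => Finset.disjoint_left.1 hXY (gX i)) q
        (by
          intro v hv v' hv' e
          rw [hqv v hv, hqv v' hv'] at e
          have := hQi p ⟨v, hv⟩ ⟨v', hv'⟩ (by rw [e])
          exact congrArg Subtype.val this)
        (by
          intro d hd
          have := (Finset.mem_filter.1 (g1 (q d) (Finset.mem_univ _))).2 ⟨d, hd⟩ (Or.inl (hqv d hd).symm)
          exact this)
        (by
          intro d hd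
          have := (Finset.mem_filter.1 (g1 (nx (q d)) (Finset.mem_univ _))).2 ⟨d, hd⟩ (Or.inr (by rw [hqv d hd]))
          exact this)
        (by
          intro y hy
          refine le_trans (Nat.mul_le_mul_left _ ?_) (h1 y hy)
          refine Finset.card_le_card_of_injOn g ?_ g2'.injOn
          intro i hi
          simp only [Finset.coe_filter, Finset.mem_univ, true_and] at hi
          exact Finset.mem_filter.2 ⟨gX i, hi⟩)
        (fun i => h2 _ (gX i))
        (univ.filter (fun y => Bz G m g y ∧ ∀ d ∈ D, y (q d) = d))
        (fun y hy hy' => Finset.mem_filter.2 ⟨Finset.mem_univ _, hy, hy'⟩)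
      rw [div_le_iff₀ (Real.exp_pos _), mul_comm]
      refine le_trans ?_ key
      have hts : t ≤ m := by omega
      refine le_trans ?_ (fact_ge _)
      rw [← ht]
      gcongr ?_ ^ _
      rw [Nat.cast_sub hts]; linarith
    calc ((m : ℝ) / 30) ^ m * ((m / 4 : ℝ) ^ (m - t) / Real.exp (m / 5))
        ≤ (sdr (A p) b0 univ).card * ((m / 4 : ℝ) ^ (m - t) / Real.exp (m / 5)) := by gcongr
      _ = ∑ g ∈ sdr (A p) b0 univ, ((m / 4 : ℝ) ^ (m - t) / Real.exp (m / 5)) := by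
          rw [Finset.sum_const, nsmul_eq_mul]
      _ ≤ ∑ g ∈ sdr (A p) b0 univ, ((univ.filter (fun y => Bz G m g y ∧ ∀ d ∈ D, y (q d) = d)).card : ℝ) :=
          Finset.sum_le_sum hZ
      _ = (((sdr (A p) b0 univ).sigma (fun g => univ.filter (fun y => Bz G m g y ∧ ∀ d ∈ D, y (q d) = d))).card : ℝ) := by
          rw [Finset.card_sigma]; push_cast; rfl
      _ ≤ _ := by
          rw [Nat.cast_le]
          refine Finset.card_le_card_of_injOn (fun z => (z.1, z.2)) ?_ ?_
          · rintro ⟨g, y⟩ hz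
            have hz' := (Finset.mem_filter.1 (Finset.mem_sigma.1 hz).2).2
            refine Finset.mem_filter.2 ⟨Finset.mem_filter.2 ⟨Finset.mem_univ _, hz'.1⟩, fun d => ?_⟩
            rw [← hqv d.1 d.2]; exact hz'.2 d.1 d.2
          · rintro ⟨g, y⟩ - ⟨g', y'⟩ - e
            simpa using e
  have hdisj : ∀ p ∈ (univ : Finset ({d // d ∈ D} ↪ Fin (m / 2))), ∀ p' ∈ (univ : Finset ({d // d ∈ D} ↪ Fin (m / 2))),
      p ≠ p' → Disjoint (W p) (W p') := by
    intro p _ p' _ hne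
    rw [Finset.disjoint_left]
    intro z hz hz'
    apply hne
    ext d
    obtain ⟨hz1, hz2⟩ := Finset.mem_filter.1 hz
    have a := hz2 d
    rw [← (Finset.mem_filter.1 hz').2 d] at a
    have b := (Finset.mem_filter.1 hz1).2.2.1 a
    have c : 2 * (p d).val = 2 * (p' d).val := congrArg Fin.val b
    omega
  have hsum : ((univ : Finset ({d // d ∈ D} ↪ Fin (m / 2))).card : ℝ) * (((m : ℝ) / 30) ^ m * ((m / 4 : ℝ) ^ (m - t) / Real.exp (m / 5)))
      ≤ P.card := by
    calc _ = ∑ p : ({d // d ∈ D} ↪ Fin (m / 2)), (((m : ℝ) / 30) ^ m * ((m / 4 : ℝ) ^ (m - t) / Real.exp (m / 5))) := by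
          rw [Finset.sum_const, nsmul_eq_mul]
      _ ≤ ∑ p : ({d // d ∈ D} ↪ Fin (m / 2)), ((W p).card : ℝ) := Finset.sum_le_sum fun p _ => hW p
      _ = ((univ.biUnion W).card : ℝ) := by
          rw [Finset.card_biUnion hdisj]; push_cast; rfl
      _ ≤ _ := by
          rw [Nat.cast_le]
          refine Finset.card_le_card (Finset.biUnion_subset.2 fun p _ => Finset.filter_subset _ _)
  refine le_trans ?_ hsum
  have hp : ((m : ℝ) / 4) ^ t ≤ ((univ : Finset ({d // d ∈ D} ↪ Fin (m / 2))).card : ℝ) := by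
    rw [Finset.card_univ, Fintype.card_embedding_eq, Fintype.card_fin, Fintype.card_coe, ← ht]
    have := Nat.pow_sub_le_descFactorial (m / 2) t
    refine le_trans ?_ (Nat.cast_le.2 this)
    push_cast
    gcongr
    have : m ≤ 4 * (m / 2 + 1 - t) := by omega
    have : (m : ℝ) ≤ 4 * ((m / 2 + 1 - t : ℕ) : ℝ) := by exact_mod_cast this
    linarith
  have hexp : Real.exp ((m : ℝ) / 5) ≤ 2 ^ m := by
    have e1 : Real.exp ((m : ℝ) / 5) ≤ Real.exp ((m : ℝ) * Real.log 2) := by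
      have := Real.log_two_gt_d9
      gcongr
      nlinarith
    refine e1.trans ?_
    rw [Real.exp_nat_mul, Real.exp_log (by norm_num)]
  calc ((m : ℝ) / 100) ^ (2 * m) = ((m : ℝ) / 100) ^ m * ((m : ℝ) / 100) ^ m := by ring
    _ ≤ ((m : ℝ) / 30) ^ m * ((m : ℝ) / 8) ^ m := by gcongr <;> norm_num
    _ = ((m : ℝ) / 30) ^ m * (((m : ℝ) / 4) ^ m / 2 ^ m) := by
        rw [← div_pow]; congr 2; ring
    _ ≤ ((m : ℝ) / 30) ^ m * (((m : ℝ) / 4) ^ m / Real.exp ((m : ℝ) / 5)) := by gcongr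
    _ = ((m : ℝ) / 4) ^ t * (((m : ℝ) / 30) ^ m * ((m / 4 : ℝ) ^ (m - t) / Real.exp (m / 5))) := by
        rw [show ((m : ℝ) / 4) ^ m = ((m : ℝ) / 4) ^ t * ((m : ℝ) / 4) ^ (m - t) by
          rw [← pow_add]; congr 1; omega]
        ring
    _ ≤ _ := by gcongr

lemma bad_count {V : Type} [DecidableEq V] (S T : Finset V) (r : V → V → Prop) [DecidableRel r] (m : ℕ) (hm : 0 < m)
    (h : 4000 * ((S ×ˢ T).filter (fun p => r p.1 p.2)).card ≤ m ^ 2) :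
    100 * (S.filter (fun a => ¬ 40 * (T.filter (fun b => r a b)).card ≤ m)).card ≤ m := by
  set U := S.filter (fun a => ¬ 40 * (T.filter (fun b => r a b)).card ≤ m) with hU
  have h1 : U.card * m ≤ 40 * ((S ×ˢ T).filter (fun p => r p.1 p.2)).card := by
    have h2 : (U.sigma (fun a => T.filter (fun b => r a b))).card ≤ ((S ×ˢ T).filter (fun p => r p.1 p.2)).card := by
      refine Finset.card_le_card_of_injOn (fun z => (z.1, z.2)) ?_ ?_
      · rintro ⟨a, b⟩ hz
        obtain ⟨h3, h4⟩ := Finset.mem_sigma.1 hz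
        obtain ⟨h5, h6⟩ := Finset.mem_filter.1 h4
        exact Finset.mem_filter.2 ⟨Finset.mem_product.2 ⟨(Finset.mem_filter.1 h3).1, h5⟩, h6⟩
      · rintro ⟨g, y⟩ - ⟨g', y'⟩ - e
        simpa using e
    rw [Finset.card_sigma] at h2
    have h3 : U.card * m ≤ ∑ a ∈ U, 40 * (T.filter (fun b => r a b)).card := by
      rw [← smul_eq_mul]
      refine Finset.card_nsmul_le_sum _ _ _ fun a ha => ?_
      have := (Finset.mem_filter.1 ha).2
      omega
    rw [← Finset.mul_sum] at h3
    omega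
  have h2 : (100 * U.card) * m ≤ m * m := by nlinarith
  exact Nat.le_of_mul_le_mul_right h2 hm

lemma extremal {V : Type} [Fintype V] [DecidableEq V] (G H : SimpleGraph V) [DecidableRel G.Adj]
    [DecidableRel H.Adj] (hGH : ∀ u v, u ≠ v → G.Adj u v ∨ H.Adj u v)
    (m : ℕ) (hm : 100 ≤ m) (hV : Fintype.card V = 3 * m - 1) (A B : Finset V) (hAB : Disjoint A B)
    (hA : 7999 * m ≤ 4000 * A.card) (hB : 3999 * m ≤ 4000 * B.card)
    (h1 : 4000 * ((A ×ˢ A).filter (fun p => ¬ G.Adj p.1 p.2)).card ≤ m ^ 2)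
    (h2 : 4000 * ((A ×ˢ B).filter (fun p => ¬ H.Adj p.1 p.2)).card ≤ m ^ 2) :
    ((m : ℝ) / 100) ^ (2 * m) ≤ Nat.card {f : Fin (2 * m) → V // IsCycleSeq G (2 * m) f} ∨
    ((m : ℝ) / 100) ^ (2 * m) ≤ Nat.card {f : Fin (2 * m) → V // IsCycleSeq H (2 * m) f} := by
  classical
  have b1 := bad_count A A (fun a b => ¬ G.Adj a b) m (by omega) h1
  have b2 := bad_count A B (fun a b => ¬ H.Adj a b) m (by omega) h2
  have h2' : 4000 * ((B ×ˢ A).filter (fun p => ¬ H.Adj p.1 p.2)).card ≤ m ^ 2 := by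
    refine le_trans (Nat.mul_le_mul_left _ ?_) h2
    refine Finset.card_le_card_of_injOn Prod.swap ?_ Prod.swap_injective.injOn
    rintro ⟨a, b⟩ hz
    obtain ⟨h3, h4⟩ := Finset.mem_filter.1 hz
    obtain ⟨h5, h6⟩ := Finset.mem_product.1 h3
    exact Finset.mem_filter.2 ⟨Finset.mem_product.2 ⟨h6, h5⟩, fun h => h4 h.symm⟩
  have b3 := bad_count B A (fun a b => ¬ H.Adj a b) m (by omega) h2'
  set U1 := A.filter (fun a => ¬ 40 * (A.filter (fun b => ¬ G.Adj a b)).card ≤ m)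
  set U2 := A.filter (fun a => ¬ 40 * (B.filter (fun b => ¬ H.Adj a b)).card ≤ m)
  set U3 := B.filter (fun a => ¬ 40 * (A.filter (fun b => ¬ H.Adj a b)).card ≤ m)
  set A0 := A \ (U1 ∪ U2) with hA0
  set B0 := B \ U3 with hB0
  have a0 : A.card ≤ A0.card + U1.card + U2.card := by
    have e1 := Finset.le_card_sdiff (U1 ∪ U2) A
    rw [← hA0] at e1
    have e2 := Finset.card_union_le U1 U2
    omega
  have c0 : B.card ≤ B0.card + U3.card := by
    have e1 := Finset.le_card_sdiff U3 B
    rw [← hB0] at e1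
    omega
  have A0A : A0 ⊆ A := Finset.sdiff_subset
  have B0B : B0 ⊆ B := Finset.sdiff_subset
  have pA1 : ∀ a ∈ A0, 40 * (A.filter (fun b => ¬ G.Adj a b)).card ≤ m := by
    intro a ha
    obtain ⟨h3, h4⟩ := Finset.mem_sdiff.1 ha
    by_contra h
    exact h4 (Finset.mem_union_left _ (Finset.mem_filter.2 ⟨h3, h⟩))
  have pA2 : ∀ a ∈ A0, 40 * (B.filter (fun b => ¬ H.Adj a b)).card ≤ m := by
    intro a ha
    obtain ⟨h3, h4⟩ := Finset.mem_sdiff.1 ha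
    by_contra h
    exact h4 (Finset.mem_union_right _ (Finset.mem_filter.2 ⟨h3, h⟩))
  have pB : ∀ a ∈ B0, 40 * (A.filter (fun b => ¬ H.Adj a b)).card ≤ m := by
    intro a ha
    obtain ⟨h3, h4⟩ := Finset.mem_sdiff.1 ha
    by_contra h
    exact h4 (Finset.mem_filter.2 ⟨h3, h⟩)
  have hd0 : Disjoint A0 B0 := hAB.mono A0A B0B
  set Rs := (univ : Finset V) \ (A0 ∪ B0) with hRs
  have hRc : Rs.card + A0.card + B0.card = 3 * m - 1 := by
    have e1 := Finset.card_sdiff_add_card_eq_card (Finset.subset_univ (A0 ∪ B0))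
    rw [Finset.card_univ, hV, Finset.card_union_of_disjoint hd0, ← hRs] at e1
    omega
  have hRs20 : 20 * Rs.card ≤ m := by omega
  set RA := Rs.filter (fun v => 3 * A0.card ≤ 4 * (A0.filter (fun a => G.Adj v a)).card) with hRA
  set RB := Rs.filter (fun v => ¬ 3 * A0.card ≤ 4 * (A0.filter (fun a => G.Adj v a)).card) with hRB
  have hRAB : RA.card + RB.card = Rs.card := Finset.card_filter_add_card_filter_not _
  have hRA0 : ∀ v ∈ Rs, v ∉ A0 ∧ v ∉ B0 := by
    intro v hv
    have := (Finset.mem_sdiff.1 hv).2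
    rw [Finset.mem_union, not_or] at this
    exact this
  have hRAs : RA ⊆ Rs := Finset.filter_subset _ _
  have hRBs : RB ⊆ Rs := Finset.filter_subset _ _
  have dA : Disjoint A0 RA := Finset.disjoint_right.2 fun v hv => (hRA0 v (hRAs hv)).1
  have dB : Disjoint B0 RB := Finset.disjoint_right.2 fun v hv => (hRA0 v (hRBs hv)).2
  by_cases hc : 2 * m ≤ A0.card + RA.card
  · left
    obtain ⟨X, hXs, hXc⟩ := Finset.exists_subset_card_eq (show m ≤ A0.card by omega)
    obtain ⟨Y, hYs, hYc⟩ := Finset.exists_subset_card_eq (show m ≤ ((A0 ∪ RA) \ X).card by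
      have := Finset.le_card_sdiff X (A0 ∪ RA)
      rw [Finset.card_union_of_disjoint dA] at this
      omega)
    have hYD : ∀ y ∈ Y \ (Y ∩ RA), y ∈ A0 := by
      intro y hy
      obtain ⟨h3, h4⟩ := Finset.mem_sdiff.1 hy
      have h5 := (Finset.mem_sdiff.1 (hYs h3)).1
      rcases Finset.mem_union.1 h5 with h | h
      · exact h
      · exact absurd (Finset.mem_inter.2 ⟨h3, h⟩) h4
    refine lemH G m hm X Y (Y ∩ RA) ?_ hXc.ge hYc Finset.inter_subset_left ?_ ?_ ?_ ?_
    · exact Finset.disjoint_right.2 fun v hv => (Finset.mem_sdiff.1 (hYs hv)).2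
    · have e1 : (Y ∩ RA).card ≤ Rs.card := Finset.card_le_card (Finset.inter_subset_right.trans hRAs)
      omega
    · intro y hy
      have e1 := pA1 y (hYD y hy)
      have e2 : (X.filter (fun x => ¬ G.Adj y x)).card ≤ (A.filter (fun x => ¬ G.Adj y x)).card :=
        Finset.card_le_card (Finset.filter_subset_filter _ (hXs.trans A0A))
      omega
    · intro x hx
      have e1 := pA1 x (hXs hx)
      have e2 : ((Y \ (Y ∩ RA)).filter (fun y => ¬ G.Adj y x)).card ≤ (A.filter (fun y => ¬ G.Adj x y)).card := by
        refine Finset.card_le_card fun y hy => ?_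
        obtain ⟨h3, h4⟩ := Finset.mem_filter.1 hy
        exact Finset.mem_filter.2 ⟨A0A (hYD y h3), fun h => h4 h.symm⟩
      omega
    · intro d hd
      have e1 := (Finset.mem_filter.1 (Finset.mem_inter.1 hd).2).2
      have e2 : (A0.filter (fun a => G.Adj d a)).card ≤ (X.filter (fun a => G.Adj d a)).card + (A0 \ X).card := by
        rw [← Finset.card_union_of_disjoint]
        · refine Finset.card_le_card fun y hy => ?_
          obtain ⟨h3, h4⟩ := Finset.mem_filter.1 hy
          by_cases hyX : y ∈ X
          · exact Finset.mem_union_left _ (Finset.mem_filter.2 ⟨hyX, h4⟩)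
          · exact Finset.mem_union_right _ (Finset.mem_sdiff.2 ⟨h3, hyX⟩)
        · exact Finset.disjoint_left.2 fun v hv hv' => (Finset.mem_sdiff.1 hv').2 (Finset.mem_filter.1 hv).1
      rw [Finset.card_sdiff_of_subset hXs] at e2
      omega
  · right
    obtain ⟨Y, hYs, hYc⟩ := Finset.exists_subset_card_eq (show m ≤ (B0 ∪ RB).card by
      rw [Finset.card_union_of_disjoint dB]
      omega)
    have hYD : ∀ y ∈ Y \ (Y ∩ RB), y ∈ B0 := by
      intro y hy
      obtain ⟨h3, h4⟩ := Finset.mem_sdiff.1 hy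
      rcases Finset.mem_union.1 (hYs h3) with h | h
      · exact h
      · exact absurd (Finset.mem_inter.2 ⟨h3, h⟩) h4
    refine lemH H m hm A0 Y (Y ∩ RB) ?_ (by omega) hYc Finset.inter_subset_left ?_ ?_ ?_ ?_
    · refine Finset.disjoint_right.2 fun v hv => ?_
      rcases Finset.mem_union.1 (hYs hv) with h | h
      · exact Finset.disjoint_right.1 hd0 h
      · exact (hRA0 v (hRBs h)).1
    · have e1 : (Y ∩ RB).card ≤ Rs.card := Finset.card_le_card (Finset.inter_subset_right.trans hRBs)
      omega
    · intro y hy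
      have e1 := pB y (hYD y hy)
      have e2 : (A0.filter (fun x => ¬ H.Adj y x)).card ≤ (A.filter (fun x => ¬ H.Adj y x)).card :=
        Finset.card_le_card (Finset.filter_subset_filter _ A0A)
      omega
    · intro x hx
      have e1 := pA2 x hx
      have e2 : ((Y \ (Y ∩ RB)).filter (fun y => ¬ H.Adj y x)).card ≤ (B.filter (fun y => ¬ H.Adj x y)).card := by
        refine Finset.card_le_card fun y hy => ?_
        obtain ⟨h3, h4⟩ := Finset.mem_filter.1 hy
        exact Finset.mem_filter.2 ⟨B0B (hYD y h3), fun h => h4 h.symm⟩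
      omega
    · intro d hd
      have hd2 := Finset.mem_filter.1 (Finset.mem_inter.1 hd).2
      have e1 := hd2.2
      have e2 : A0.card ≤ (A0.filter (fun a => G.Adj d a)).card + (A0.filter (fun a => H.Adj d a)).card := by
        refine le_trans (Finset.card_le_card fun y hy => ?_) (Finset.card_union_le _ _)
        have hne : d ≠ y := fun h => (hRA0 d hd2.1).1 (h ▸ hy)
        rcases hGH d y hne with h | h
        · exact Finset.mem_union_left _ (Finset.mem_filter.2 ⟨hy, h⟩)
        · exact Finset.mem_union_right _ (Finset.mem_filter.2 ⟨hy, h⟩)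
      omega

def CFM {ι : Type} (G : SimpleGraph ι) (t : ℕ) : Prop :=
  ∃ (v0 : ι) (S : Finset ι) (f : ι → ι), Set.InjOn f S ∧
    (∀ v ∈ S, G.Adj v (f v) ∧ G.Reachable v0 v) ∧ t ≤ S.card

lemma hall_def {ι : Type} [Fintype ι] (G : SimpleGraph ι) (v0 : ι) (X : Finset ι)
    (hX : ∀ v, v ∈ X ↔ G.Reachable v0 v) (t : ℕ) :
    CFM G t ∨ ∃ A S : Finset ι, A ⊆ X ∧ S ⊆ X ∧ Disjoint A S ∧ (∀ a ∈ A, ∀ w, G.Adj a w → w ∈ S) ∧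
      S.card + X.card < A.card + t := by
  classical
  by_cases hXt : X.card < t
  · exact Or.inr ⟨∅, ∅, by simp, by simp, by simp, by simp, by simpa using hXt⟩
  push Not at hXt
  obtain ⟨d, hd⟩ := Nat.exists_eq_add_of_le hXt
  let T : {x // x ∈ X} → Finset (ι ⊕ Fin d) := fun x =>
    (univ.filter (fun w => G.Adj x.1 w)).disjSum univ
  by_cases hall : ∀ s : Finset {x // x ∈ X}, s.card ≤ (s.biUnion T).card
  · left
    obtain ⟨f, hf, hfT⟩ := (Finset.all_card_le_biUnion_card_iff_exists_injective T).1 hall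
    let S' : Finset {x // x ∈ X} := univ.filter (fun x => ∃ w, f x = Sum.inl w)
    let g : ι → ι := fun v => if h : v ∈ X then Sum.elim id (fun _ => v) (f ⟨v, h⟩) else v
    have hg : ∀ (x : {x // x ∈ X}) w, f x = Sum.inl w → g x.1 = w := by
      intro x w h
      simp only [g]
      rw [dif_pos x.2, h]; rfl
    refine ⟨v0, S'.image Subtype.val, g, ?_, ?_, ?_⟩
    · intro v hv v' hv' e
      simp only [Finset.coe_image, Set.mem_image, Finset.mem_coe] at hv hv'
      obtain ⟨x, hx, rfl⟩ := hv
      obtain ⟨x', hx', rfl⟩ := hv'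
      obtain ⟨w, hw⟩ := (Finset.mem_filter.1 hx).2
      obtain ⟨w', hw'⟩ := (Finset.mem_filter.1 hx').2
      rw [hg x w hw, hg x' w' hw'] at e
      rw [e, ← hw'] at hw
      rw [hf hw]
    · intro v hv
      obtain ⟨x, hx, rfl⟩ := Finset.mem_image.1 hv
      obtain ⟨w, hw⟩ := (Finset.mem_filter.1 hx).2
      refine ⟨?_, (hX _).1 x.2⟩
      have := hfT x
      rw [hw] at this
      rw [hg x w hw]
      simpa [T] using this
    · rw [Finset.card_image_of_injective _ Subtype.val_injective]
      have h1 : S'.card + (univ.filter (fun x => ¬ ∃ w, f x = Sum.inl w)).card = X.card := by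
        have := Finset.card_filter_add_card_filter_not (s := (univ : Finset {x // x ∈ X})) (fun x => ∃ w, f x = Sum.inl w)
        rw [Finset.card_univ, Fintype.card_coe] at this
        exact this
      have h2 : (univ.filter (fun x => ¬ ∃ w, f x = Sum.inl w)).card ≤ ((univ : Finset (Fin d)).map ⟨(Sum.inr : Fin d → ι ⊕ Fin d), Sum.inr_injective⟩).card := by
        refine Finset.card_le_card_of_injOn f ?_ hf.injOn
        intro x hx
        have := (Finset.mem_filter.1 hx).2
        cases hfx : f x with
        | inl w => exact absurd ⟨w, hfx⟩ this
        | inr w => simp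
      rw [Finset.card_map, Finset.card_univ, Fintype.card_fin] at h2
      omega
  · right
    push Not at hall
    obtain ⟨s, hs⟩ := hall
    have hsne : s.Nonempty := by
      rw [Finset.nonempty_iff_ne_empty]; rintro rfl; simp at hs
    set A := s.image Subtype.val with hA
    have hAc : A.card = s.card := Finset.card_image_of_injective _ Subtype.val_injective
    set NA : Finset ι := univ.filter (fun w => ∃ a ∈ A, G.Adj a w) with hNA
    have hbi : s.biUnion T = NA.disjSum univ := by
      ext z
      obtain ⟨x0, hx0⟩ := hsne
      cases z with
      | inl w =>
        simp only [T, Finset.mem_biUnion, Finset.inl_mem_disjSum, Finset.mem_filter, Finset.mem_univ, true_and, hNA, hA, Finset.mem_image]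
        constructor
        · rintro ⟨x, hx, h⟩; exact ⟨x.1, ⟨x, hx, rfl⟩, h⟩
        · rintro ⟨_, ⟨x, hx, rfl⟩, h⟩; exact ⟨x, hx, h⟩
      | inr w => 
        simp only [T, Finset.mem_biUnion, Finset.inr_mem_disjSum, Finset.mem_univ, and_true, iff_true]
        exact ⟨x0, hx0⟩
    rw [hbi, Finset.card_disjSum, Finset.card_univ, Fintype.card_fin] at hs
    have hAX : A ⊆ X := by
      intro v hv
      obtain ⟨x, _, rfl⟩ := Finset.mem_image.1 hv
      exact x.2
    have hNX : NA ⊆ X := by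
      intro w hw
      obtain ⟨a, ha, haw⟩ := (Finset.mem_filter.1 hw).2
      exact (hX w).2 (((hX a).1 (hAX ha)).trans haw.reachable)
    refine ⟨A \ NA, NA \ A, Finset.sdiff_subset.trans hAX, Finset.sdiff_subset.trans hNX, ?_, ?_, ?_⟩
    · exact Finset.disjoint_left.2 fun v hv hv' => (Finset.mem_sdiff.1 hv').2 (Finset.mem_sdiff.1 hv).1
    · intro a ha w haw
      obtain ⟨h1, h2⟩ := Finset.mem_sdiff.1 ha
      refine Finset.mem_sdiff.2 ⟨Finset.mem_filter.2 ⟨Finset.mem_univ _, a, h1, haw⟩, fun hw => h2 ?_⟩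
      exact Finset.mem_filter.2 ⟨Finset.mem_univ _, w, hw, haw.symm⟩
    · have e1 := Finset.card_sdiff_add_card_inter A NA
      have e2 := Finset.card_sdiff_add_card_inter NA A
      rw [Finset.inter_comm] at e2
      omega

section stab
variable {ι : Type} [Fintype ι] [DecidableEq ι] (H1 H2 : SimpleGraph ι) (e : ℕ)

lemma na_prod (hT : Nat.card {p : ι × ι // ¬ H1.Adj p.1 p.2 ∧ ¬ H2.Adj p.1 p.2} ≤ e ^ 2)
    (P Q : Finset ι) (h : ∀ a ∈ P, ∀ b ∈ Q, ¬ H1.Adj a b ∧ ¬ H2.Adj a b) : P.card ≤ e ∨ Q.card ≤ e := by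
  classical
  by_contra hc
  push Not at hc
  rw [Nat.card_eq_fintype_card, Fintype.card_subtype] at hT
  have h1 : (P ×ˢ Q).card ≤ (univ.filter (fun p : ι × ι => ¬ H1.Adj p.1 p.2 ∧ ¬ H2.Adj p.1 p.2)).card := by
    refine Finset.card_le_card fun p hp => ?_
    obtain ⟨h2, h3⟩ := Finset.mem_product.1 hp
    exact Finset.mem_filter.2 ⟨Finset.mem_univ _, h _ h2 _ h3⟩
  rw [Finset.card_product] at h1
  nlinarith

open Classical in
lemma na_vertex (hT : Nat.card {p : ι × ι // ¬ H1.Adj p.1 p.2 ∧ ¬ H2.Adj p.1 p.2} ≤ e ^ 2)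
    (P : Finset ι) (hP : e < P.card) :
    ∃ v ∈ P, (univ.filter (fun w => ¬ H1.Adj v w ∧ ¬ H2.Adj v w)).card ≤ e := by
  by_contra hc
  push Not at hc
  rw [Nat.card_eq_fintype_card, Fintype.card_subtype] at hT
  have h1 : (P.sigma (fun v => univ.filter (fun w => ¬ H1.Adj v w ∧ ¬ H2.Adj v w))).card ≤
      (univ.filter (fun p : ι × ι => ¬ H1.Adj p.1 p.2 ∧ ¬ H2.Adj p.1 p.2)).card := by
    refine Finset.card_le_card_of_injOn (fun z => (z.1, z.2)) ?_ ?_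
    · rintro ⟨a, b⟩ hz
      have h2 := (Finset.mem_filter.1 (Finset.mem_sigma.1 hz).2).2
      exact Finset.mem_filter.2 ⟨Finset.mem_univ _, h2⟩
    · rintro ⟨g, y⟩ - ⟨g', y'⟩ - e
      simpa using e
  rw [Finset.card_sigma] at h1
  have h2 : P.card * (e + 1) ≤ _ := Finset.card_nsmul_le_sum P _ (e + 1) (fun v hv => hc v hv)
  nlinarith

open Classical in
lemma stab_aux (hT : Nat.card {p : ι × ι // ¬ H1.Adj p.1 p.2 ∧ ¬ H2.Adj p.1 p.2} ≤ e ^ 2)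
    (t N : ℕ) (hN : Fintype.card ι = N) (ht : t + 3 * e < N) (v0 : ι)
    (hX : N ≤ (univ.filter (fun v => H1.Reachable v0 v)).card + 2 * e) :
    CFM H1 t ∨ CFM H2 t ∨ ∃ A B : Finset ι, Disjoint A B ∧ 2 * (N - t) ≤ A.card + 5 * e ∧
      N - t ≤ B.card + 4 * e ∧
      (((∀ a ∈ A, ∀ a' ∈ A, ¬ H2.Adj a a') ∧ (∀ a ∈ A, ∀ b ∈ B, ¬ H1.Adj a b)) ∨
       ((∀ a ∈ A, ∀ a' ∈ A, ¬ H1.Adj a a') ∧ (∀ a ∈ A, ∀ b ∈ B, ¬ H2.Adj a b))) := by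
  set X := univ.filter (fun v => H1.Reachable v0 v) with hXd
  rcases hall_def H1 v0 X (fun v => by simp [hXd]) t with h | ⟨A1, S1, hA1X, hS1X, hd1, hn1, hc1⟩
  · exact Or.inl h
  right
  have hXN : X.card ≤ N := hN ▸ Finset.card_le_univ X
  obtain ⟨y0, hy0, hy0c⟩ := na_vertex H1 H2 e hT A1 (by omega)
  set Y := univ.filter (fun v => H2.Reachable y0 v) with hYd
  rcases hall_def H2 y0 Y (fun v => by simp [hYd]) t with h | ⟨A2, S2, hA2Y, hS2Y, hd2, hn2, hc2⟩
  · exact Or.inl h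
  right
  have hYN : Y.card ≤ N := hN ▸ Finset.card_le_univ Y
  have hYcl : ∀ a ∈ Y, ∀ b, H2.Adj a b → b ∈ Y := by
    intro a ha b hab
    exact Finset.mem_filter.2 ⟨Finset.mem_univ _, ((Finset.mem_filter.1 ha).2).trans hab.reachable⟩
  have hout : ((univ \ S1) \ Y).card ≤ e := by
    refine le_trans (Finset.card_le_card fun w hw => ?_) hy0c
    obtain ⟨h1, h2⟩ := Finset.mem_sdiff.1 hw
    refine Finset.mem_filter.2 ⟨Finset.mem_univ _, fun h => (Finset.mem_sdiff.1 h1).2 (hn1 y0 hy0 w h), fun h => h2 ?_⟩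
    exact Finset.mem_filter.2 ⟨Finset.mem_univ _, h.reachable⟩
  have hA1Y : (A1 \ Y).card ≤ e := by
    refine le_trans (Finset.card_le_card fun w hw => ?_) hout
    obtain ⟨h1, h2⟩ := Finset.mem_sdiff.1 hw
    exact Finset.mem_sdiff.2 ⟨Finset.mem_sdiff.2 ⟨Finset.mem_univ _, Finset.disjoint_left.1 hd1 h1⟩, h2⟩
  have hdY : Disjoint A2 (univ \ Y) :=
    Finset.disjoint_left.2 fun v hv hv' => (Finset.mem_sdiff.1 hv').2 (hA2Y hv)
  set A3 := A2 ∪ (univ \ Y) with hA3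
  have hA3c : A3.card = A2.card + (N - Y.card) := by
    rw [hA3, Finset.card_union_of_disjoint hdY, Finset.card_sdiff_of_subset (Finset.subset_univ _), Finset.card_univ, hN]
  have key : ∀ a ∈ (A1 ∩ Y) \ S2, ∀ b ∈ A3, ¬ H2.Adj a b := by
    intro a ha b hb hab
    obtain ⟨h1, h2⟩ := Finset.mem_sdiff.1 ha
    have haY := (Finset.mem_inter.1 h1).2
    have hbY := hYcl a haY b hab
    rcases Finset.mem_union.1 hb with h | h
    · exact h2 (hn2 b h a hab.symm)
    · exact (Finset.mem_sdiff.1 h).2 hbY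
  have hprod := na_prod H1 H2 e hT ((A1 ∩ Y) \ S2) (A3 \ S1) (by
    intro a ha b hb
    obtain ⟨h1, h2⟩ := Finset.mem_sdiff.1 hb
    refine ⟨fun h => h2 (hn1 a ?_ b h), key a ha b h1⟩
    exact (Finset.mem_inter.1 (Finset.mem_sdiff.1 ha).1).1)
  have hd3 : Disjoint A3 S2 := by
    refine Finset.disjoint_left.2 fun v hv hv' => ?_
    rcases Finset.mem_union.1 hv with h | h
    · exact Finset.disjoint_left.1 hd2 h hv'
    · exact (Finset.mem_sdiff.1 h).2 (hS2Y hv')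
  rcases hprod with hp | hp
  · refine ⟨A2 \ S1, A1 ∩ S2, ?_, ?_, ?_, Or.inl ⟨?_, ?_⟩⟩
    · exact Finset.disjoint_left.2 fun v hv hv' => Finset.disjoint_left.1 hd2 (Finset.mem_sdiff.1 hv).1 (Finset.mem_inter.1 hv').2
    · have e1 : A1.card ≤ (A1 ∩ S2).card + ((A1 ∩ Y) \ S2).card + (A1 \ Y).card := by
        refine le_trans (Finset.card_le_card (t := (A1 ∩ S2 ∪ (A1 ∩ Y) \ S2) ∪ (A1 \ Y)) fun w hw => ?_)
          ((Finset.card_union_le _ _).trans (Nat.add_le_add_right (Finset.card_union_le _ _) _))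
        simp only [Finset.mem_union, Finset.mem_inter, Finset.mem_sdiff]
        tauto
      have e2 : A3.card ≤ (A2 \ S1).card + S1.card + ((univ \ S1) \ Y).card := by
        refine le_trans (Finset.card_le_card (t := (A2 \ S1 ∪ S1) ∪ ((univ \ S1) \ Y)) fun w hw => ?_)
          ((Finset.card_union_le _ _).trans (Nat.add_le_add_right (Finset.card_union_le _ _) _))
        simp only [hA3, Finset.mem_union, Finset.mem_sdiff, Finset.mem_univ, true_and] at hw ⊢
        tauto
      have e3 : (A1 ∩ S2).card ≤ S2.card := Finset.card_le_card Finset.inter_subset_right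
      omega
    · have e1 : A1.card ≤ (A1 ∩ S2).card + ((A1 ∩ Y) \ S2).card + (A1 \ Y).card := by
        refine le_trans (Finset.card_le_card (t := (A1 ∩ S2 ∪ (A1 ∩ Y) \ S2) ∪ (A1 \ Y)) fun w hw => ?_)
          ((Finset.card_union_le _ _).trans (Nat.add_le_add_right (Finset.card_union_le _ _) _))
        simp only [Finset.mem_union, Finset.mem_inter, Finset.mem_sdiff]
        tauto
      omega
    · intro a ha a' ha' h
      exact Finset.disjoint_left.1 hd2 (Finset.mem_sdiff.1 ha').1 (hn2 a (Finset.mem_sdiff.1 ha).1 a' h)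
    · intro a ha b hb h
      exact (Finset.mem_sdiff.1 ha).2 (hn1 b (Finset.mem_inter.1 hb).1 a h.symm)
  · refine ⟨(A1 ∩ Y) \ S2, A3 ∩ S1, ?_, ?_, ?_, Or.inr ⟨?_, ?_⟩⟩
    · exact Finset.disjoint_left.2 fun v hv hv' => Finset.disjoint_left.1 hd1
        (Finset.mem_inter.1 (Finset.mem_sdiff.1 hv).1).1 (Finset.mem_inter.1 hv').2
    · have e1 := Finset.card_sdiff_add_card_inter A3 S1
      have e2 : (A3 ∩ S1).card ≤ S1.card := Finset.card_le_card Finset.inter_subset_right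
      have e3 : A1.card ≤ ((A1 ∩ Y) \ S2).card + S2.card + (A1 \ Y).card := by
        refine le_trans (Finset.card_le_card (t := (((A1 ∩ Y) \ S2) ∪ S2) ∪ (A1 \ Y)) fun w hw => ?_)
          ((Finset.card_union_le _ _).trans (Nat.add_le_add_right (Finset.card_union_le _ _) _))
        simp only [Finset.mem_union, Finset.mem_inter, Finset.mem_sdiff]
        tauto
      omega
    · have e1 := Finset.card_sdiff_add_card_inter A3 S1
      omega
    · intro a ha a' ha' h
      exact Finset.disjoint_left.1 hd1 (Finset.mem_inter.1 (Finset.mem_sdiff.1 ha').1).1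
        (hn1 a (Finset.mem_inter.1 (Finset.mem_sdiff.1 ha).1).1 a' h)
    · intro a ha b hb h
      exact key a ha b (Finset.mem_inter.1 hb).1 h

lemma stab (hT : Nat.card {p : ι × ι // ¬ H1.Adj p.1 p.2 ∧ ¬ H2.Adj p.1 p.2} ≤ e ^ 2)
    (t N : ℕ) (hN : Fintype.card ι = N) (ht : t + 3 * e < N) :
    CFM H1 t ∨ CFM H2 t ∨ ∃ A B : Finset ι, Disjoint A B ∧ 2 * (N - t) ≤ A.card + 5 * e ∧
      N - t ≤ B.card + 4 * e ∧
      (((∀ a ∈ A, ∀ a' ∈ A, ¬ H2.Adj a a') ∧ (∀ a ∈ A, ∀ b ∈ B, ¬ H1.Adj a b)) ∨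
       ((∀ a ∈ A, ∀ a' ∈ A, ¬ H1.Adj a a') ∧ (∀ a ∈ A, ∀ b ∈ B, ¬ H2.Adj a b))) := by
  classical
  obtain ⟨v0, -, hv0⟩ := na_vertex H1 H2 e hT univ (by rw [Finset.card_univ]; omega)
  set X := univ.filter (fun v => H1.Reachable v0 v) with hXd
  set Y := univ.filter (fun v => H2.Reachable v0 v) with hYd
  have hout : ((univ \ X) \ Y).card ≤ e := by
    refine le_trans (Finset.card_le_card fun w hw => ?_) hv0
    obtain ⟨h1, h2⟩ := Finset.mem_sdiff.1 hw
    refine Finset.mem_filter.2 ⟨Finset.mem_univ _, fun h => (Finset.mem_sdiff.1 h1).2 ?_, fun h => h2 ?_⟩ <;>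
    exact Finset.mem_filter.2 ⟨Finset.mem_univ _, h.reachable⟩
  have hc : ∀ P Q R : Finset ι, (univ : Finset ι) ⊆ (P ∪ Q) ∪ R → N ≤ P.card + Q.card + R.card := by
    intro P Q R h
    have := (Finset.card_le_card h).trans ((Finset.card_union_le _ _).trans (Nat.add_le_add_right (Finset.card_union_le _ _) _))
    rwa [Finset.card_univ, hN] at this
  rcases na_prod H1 H2 e hT (X \ Y) (Y \ X) (by
    intro a ha b hb
    obtain ⟨h1, h2⟩ := Finset.mem_sdiff.1 ha
    obtain ⟨h3, h4⟩ := Finset.mem_sdiff.1 hb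
    refine ⟨fun h => h4 ?_, fun h => h2 ?_⟩
    · exact Finset.mem_filter.2 ⟨Finset.mem_univ _, (Finset.mem_filter.1 h1).2.trans h.reachable⟩
    · exact Finset.mem_filter.2 ⟨Finset.mem_univ _, (Finset.mem_filter.1 h3).2.trans h.symm.reachable⟩) with h | h
  · have hT' : Nat.card {p : ι × ι // ¬ H2.Adj p.1 p.2 ∧ ¬ H1.Adj p.1 p.2} ≤ e ^ 2 := by
      simp only [and_comm] at hT ⊢; exact hT
    rcases stab_aux H2 H1 e hT' t N hN ht v0 (by
      have := hc Y (X \ Y) ((univ \ X) \ Y) (fun w _ => by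
        simp only [Finset.mem_union, Finset.mem_sdiff, Finset.mem_univ, true_and]; tauto)
      have h5 : N ≤ Y.card + 2 * e := by omega
      convert h5) with h | h | ⟨A, B, h1, h2, h3, h4⟩
    · exact Or.inr (Or.inl h)
    · exact Or.inl h
    · exact Or.inr (Or.inr ⟨A, B, h1, h2, h3, h4.symm⟩)
  · refine stab_aux H1 H2 e hT t N hN ht v0 ?_
    have := hc X (Y \ X) ((univ \ X) \ Y) (fun w _ => by
      simp only [Finset.mem_union, Finset.mem_sdiff, Finset.mem_univ, true_and]; tauto)
    have h5 : N ≤ X.card + 2 * e := by omega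
    convert h5
end stab

lemma count_getVert {ι : Type} [DecidableEq ι] {G : SimpleGraph ι} (u : ι) {a b : ι} (p : G.Walk a b) :
    ((range (p.length + 1)).filter (fun i => p.getVert i = u)).card = p.support.count u := by
  induction p with
  | nil => 
    rw [Finset.card_filter]
    simp [List.count_cons]
    congr
  | cons h q ih =>
    rw [Finset.card_filter, SimpleGraph.Walk.length_cons, Finset.sum_range_succ']
    simp only [SimpleGraph.Walk.getVert_cons_succ, SimpleGraph.Walk.support_cons, SimpleGraph.Walk.getVert_zero]
    rw [List.count_cons, ← ih, Finset.card_filter]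
    simp only [beq_iff_eq]
    congr

lemma exc_walk {ι : Type} [DecidableEq ι] {G : SimpleGraph ι} {a b : ι} (h : G.Adj a b) (r : ℕ) :
    ∃ w : G.Walk a a, w.length = 2 * r ∧ ∀ u, w.support.tail.count u =
      (if u = a then r else 0) + (if u = b then r else 0) := by
  induction r with
  | zero => exact ⟨.nil, rfl, fun u => by simp⟩
  | succ r ih =>
    obtain ⟨w, hw, hc⟩ := ih
    refine ⟨.cons h (.cons h.symm w), by simp [hw]; ring, fun u => ?_⟩
    rw [SimpleGraph.Walk.support_cons, List.tail_cons, SimpleGraph.Walk.support_cons, List.count_cons,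
      ← SimpleGraph.Walk.cons_tail_support, List.count_cons, hc]
    simp only [beq_iff_eq, eq_comm (b := u)]
    split_ifs <;> omega

lemma cw_aux {ι : Type} [Fintype ι] [DecidableEq ι] {G : SimpleGraph ι} (v0 : ι) (S : Finset ι) (f : ι → ι)
    (h : ∀ v ∈ S, G.Adj v (f v) ∧ G.Reachable v0 v) :
    ∃ len : ι → ℕ, (∀ v, len v ≤ Fintype.card ι) ∧ ∀ r : ι → ℕ, ∃ w : G.Walk v0 v0,
      w.length = ∑ v ∈ S, 2 * (len v + r v) ∧ ∀ u, w.support.tail.count u ≤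
        ∑ v ∈ S, (2 * len v + ((if u = v then r v else 0) + (if u = f v then r v else 0))) := by
  classical
  induction S using Finset.induction_on with
  | empty => exact ⟨fun _ => 0, by simp, fun r => ⟨.nil, by simp, by simp⟩⟩
  | insert a S ha ih =>
    obtain ⟨len, hlen, hw⟩ := ih (fun v hv => h v (Finset.mem_insert_of_mem hv))
    obtain ⟨hadj, hre⟩ := h a (Finset.mem_insert_self _ _)
    obtain ⟨p, hp, hpl⟩ := hre.exists_path_of_dist
    have hplt := hp.length_lt
    refine ⟨Function.update len a p.length, ?_, fun r => ?_⟩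
    · intro v
      by_cases hv : v = a
      · subst hv; rw [Function.update_self]; exact hplt.le
      · rw [Function.update_of_ne hv]; exact hlen v
    · obtain ⟨w, hwl, hwc⟩ := hw r
      obtain ⟨x, hxl, hxc⟩ := exc_walk hadj (r a)
      refine ⟨((p.append x).append p.reverse).append w, ?_, fun u => ?_⟩
      · rw [Finset.sum_insert ha, Function.update_self]
        have : ∑ v ∈ S, 2 * (Function.update len a p.length v + r v) = ∑ v ∈ S, 2 * (len v + r v) :=
          Finset.sum_congr rfl fun v hv => by rw [Function.update_of_ne (fun h : v = a => ha (h ▸ hv))]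
        rw [this, ← hwl]
        simp only [SimpleGraph.Walk.length_append, SimpleGraph.Walk.length_reverse, hxl]
        ring
      · rw [Finset.sum_insert ha, Function.update_self]
        have : ∑ v ∈ S, (2 * Function.update len a p.length v + ((if u = v then r v else 0) + (if u = f v then r v else 0))) =
          ∑ v ∈ S, (2 * len v + ((if u = v then r v else 0) + (if u = f v then r v else 0))) :=
          Finset.sum_congr rfl fun v hv => by rw [Function.update_of_ne (fun h : v = a => ha (h ▸ hv))]
        rw [this]
        simp only [SimpleGraph.Walk.tail_support_append, List.count_append]
        have e1 := hwc u
        have e2 := hxc u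
        have e3 : p.support.tail.count u ≤ p.length := by
          refine List.count_le_length.trans ?_
          simp
        have e4 : p.reverse.support.tail.count u ≤ p.length := by
          refine List.count_le_length.trans ?_
          simp
        omega

lemma closed_walk {ι : Type} [Fintype ι] [DecidableEq ι] (G : SimpleGraph ι) (t m : ℕ) (ht : 0 < t) (h : CFM G t)
    (hm : Fintype.card ι * Fintype.card ι < m) :
    ∃ w : ℕ → ι, (∀ i, i + 1 < 2 * m → G.Adj (w i) (w (i + 1))) ∧ G.Adj (w (2 * m - 1)) (w 0) ∧
      ∀ u, ((range (2 * m)).filter (fun i => w i = u)).card ≤ 2 * (m / t) + 2 + 2 * (Fintype.card ι * Fintype.card ι) := by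
  obtain ⟨v0, S, f, hf, hS, hSc⟩ := h
  obtain ⟨len, hlen, hw⟩ := cw_aux v0 S f hS
  set N := Fintype.card ι
  have hSN : S.card ≤ N := Finset.card_le_univ S
  have hls : ∑ v ∈ S, len v ≤ N * N := by
    calc ∑ v ∈ S, len v ≤ S.card • N := Finset.sum_le_card_nsmul _ _ _ fun v _ => hlen v
      _ ≤ N * N := by rw [smul_eq_mul]; gcongr
  obtain ⟨M, hM⟩ := Nat.exists_eq_add_of_le (hls.trans hm.le)
  have hs0 : 0 < S.card := by omega
  obtain ⟨T, hTS, hTc⟩ := Finset.exists_subset_card_eq (show M % S.card ≤ S.card from (Nat.mod_lt _ hs0).le)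
  let r : ι → ℕ := fun v => M / S.card + if v ∈ T then 1 else 0
  have hr : ∑ v ∈ S, r v = M := by
    simp only [r]
    rw [Finset.sum_add_distrib, Finset.sum_const, smul_eq_mul, ← Finset.card_filter,
      Finset.filter_mem_eq_inter, Finset.inter_eq_right.2 hTS, hTc]
    exact Nat.div_add_mod M S.card
  have hrb : ∀ v, r v ≤ m / t + 1 := by
    intro v
    have e1 : M / S.card ≤ m / t := (Nat.div_le_div_right (by omega)).trans (Nat.div_le_div_left hSc ht)
    simp only [r]
    split_ifs <;> omega
  obtain ⟨w, hwl, hwc⟩ := hw r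
  have hwl' : w.length = 2 * m := by
    rw [hwl, ← Finset.mul_sum, Finset.sum_add_distrib, hr, ← hM]
  refine ⟨fun i => w.getVert (i + 1), fun i hi => w.adj_getVert_succ (by omega), ?_, fun u => ?_⟩
  · have e1 : 2 * m - 1 + 1 = w.length := by omega
    show G.Adj (w.getVert (2 * m - 1 + 1)) _
    rw [e1, SimpleGraph.Walk.getVert_length]
    have := w.adj_getVert_succ (i := 0) (by omega)
    rwa [SimpleGraph.Walk.getVert_zero] at this
  · have e1 : ((range (2 * m)).filter (fun i => w.getVert (i + 1) = u)).card = w.support.tail.count u := by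
      have e2 := count_getVert u w
      rw [Finset.card_filter, Finset.sum_range_succ', hwl', SimpleGraph.Walk.getVert_zero,
        ← SimpleGraph.Walk.cons_tail_support, List.count_cons] at e2
      rw [Finset.card_filter]
      simp only [beq_iff_eq] at e2
      exact Nat.add_right_cancel e2
    have e3 : ∑ v ∈ S, (if u = v then r v else 0) ≤ m / t + 1 := by
      rw [Finset.sum_ite_eq]
      split_ifs
      · exact hrb u
      · exact Nat.zero_le _
    have e4 : ∑ v ∈ S, (if u = f v then r v else 0) ≤ m / t + 1 := by
      rw [← Finset.sum_filter]
      have hc : (S.filter (fun v => u = f v)).card ≤ 1 := by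
        rw [Finset.card_le_one]
        intro a ha b hb
        obtain ⟨a1, a2⟩ := Finset.mem_filter.1 ha
        obtain ⟨b1, b2⟩ := Finset.mem_filter.1 hb
        exact hf a1 b1 (a2.symm.trans b2)
      calc _ ≤ (S.filter (fun v => u = f v)).card • (m / t + 1) := Finset.sum_le_card_nsmul _ _ _ fun v _ => hrb v
        _ ≤ 1 * (m / t + 1) := by rw [smul_eq_mul]; gcongr
        _ = _ := one_mul _
    have e5 := hwc u
    rw [Finset.sum_add_distrib, Finset.sum_add_distrib, ← Finset.mul_sum] at e5
    show ((range (2 * m)).filter (fun i => w.getVert (i + 1) = u)).card ≤ _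
    omega

lemma tree_count {V : Type} [Fintype V] (P : ℕ → (ℕ → V) → Prop) (x0 : V) (c k : ℕ)
    (h0 : P 0 (fun _ => x0))
    (hs : ∀ n x, n < k → P n x → ∃ O : Finset V, c ≤ O.card ∧ ∀ v ∈ O, P (n + 1) (Function.update x (n + 1) v))
    (n : ℕ) (hn : n ≤ k) :
    ∃ W : Finset (ℕ → V), (∀ x ∈ W, P n x ∧ ∀ i, n < i → x i = x0) ∧ c ^ n ≤ W.card := by
  classical
  induction n with
  | zero => exact ⟨{fun _ => x0}, by simp [h0], by simp⟩
  | succ n ih =>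
    obtain ⟨W, hW, hc⟩ := ih (by omega)
    have : ∀ x, ∃ O : Finset V, x ∈ W → (c ≤ O.card ∧ ∀ v ∈ O, P (n + 1) (Function.update x (n + 1) v)) := by
      intro x
      by_cases hx : x ∈ W
      · obtain ⟨O, hO⟩ := hs n x (by omega) (hW x hx).1
        exact ⟨O, fun _ => hO⟩
      · exact ⟨∅, fun h => absurd h hx⟩
    choose O hO using this
    refine ⟨(W.sigma O).image (fun z => Function.update z.1 (n + 1) z.2), ?_, ?_⟩
    · intro y hy
      obtain ⟨⟨x, v⟩, hz, rfl⟩ := Finset.mem_image.1 hy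
      obtain ⟨hx, hv⟩ := Finset.mem_sigma.1 hz
      refine ⟨(hO x hx).2 v hv, fun i hi => ?_⟩
      show Function.update x (n + 1) v i = x0
      rw [Function.update_of_ne (by omega)]
      exact (hW x hx).2 i (by omega)
    · rw [Finset.card_image_of_injOn, Finset.card_sigma]
      · calc c ^ (n + 1) = c ^ n * c := pow_succ _ _
          _ ≤ W.card * c := by gcongr
          _ = W.card • c := rfl
          _ ≤ _ := Finset.card_nsmul_le_sum _ _ _ fun x hx => (hO x hx).1
      · rintro ⟨x, v⟩ hz ⟨x', v'⟩ hz' e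
        obtain ⟨hx, -⟩ := Finset.mem_sigma.1 hz
        obtain ⟨hx', -⟩ := Finset.mem_sigma.1 hz'
        have e' : Function.update x (n + 1) v = Function.update x' (n + 1) v' := e
        have h1 : v = v' := by
          have := congrFun e' (n + 1)
          rwa [Function.update_self, Function.update_self] at this
        have h2 : x = x' := by
          funext i
          by_cases hi : i = n + 1
          · rw [(hW x hx).2 i (by omega), (hW x' hx').2 i (by omega)]
          · have := congrFun e' i
            rwa [Function.update_of_ne hi, Function.update_of_ne hi] at this
        subst h1 h2; rfl

lemma embed {V ι : Type} [Fintype V] [DecidableEq V] [DecidableEq ι] (G : SimpleGraph V) [DecidableRel G.Adj]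
    (C : ι → Finset V) (hC : ∀ a b, a ≠ b → Disjoint (C a) (C b)) (k : ℕ) (hk : 3 ≤ k) (w : ℕ → ι)
    (D q a c f : ℕ) (hD : 1 ≤ D) (haf : 2 * D * a ≤ f) (hqc : q + c ≤ a) (hcD : c * D ≤ a)
    (hvis : ∀ i < k, ((range k).filter (fun j => w j = w i)).card + f ≤ (C (w i)).card)
    (typ1 : ∀ i, i + 1 < k → ∀ T ⊆ C (w (i + 1)), q ≤ T.card →
      ((C (w i)).filter (fun v => D * (T.filter (fun u => G.Adj v u)).card < T.card)).card < q)
    (typ2 : ∀ T ⊆ C (w (k - 1)), q ≤ T.card →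
      ((C (w 0)).filter (fun v => D * (T.filter (fun u => G.Adj v u)).card < T.card)).card < q) :
    c ^ (k - 1) ≤ Nat.card {g : Fin k → V // IsCycleSeq G k g} := by
  classical
  have hDa : a ≤ D * a := Nat.le_mul_of_pos_left a hD
  have hDa2 : 2 * D * a = 2 * (D * a) := by ring
  have hcard : ∀ i < k, f ≤ (C (w i)).card := fun i hi => by have := hvis i hi; omega
  have ha : ∀ s t : ℕ, D * a ≤ t → ¬ D * s < t → a ≤ s := by
    intro s t h1 h2
    exact Nat.le_of_mul_le_mul_left (h1.trans (not_lt.1 h2)) hD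
  obtain ⟨x0, hx0, hx1, hx2⟩ : ∃ x0 ∈ C (w 0), 2 * a ≤ ((C (w 1)).filter (fun u => G.Adj x0 u)).card ∧
      a ≤ ((C (w (k - 1))).filter (fun u => G.Adj x0 u)).card := by
    have t1 := typ1 0 (by omega) (C (w 1)) subset_rfl (by have := hcard 1 (by omega); omega)
    have t2 := typ2 (C (w (k - 1))) subset_rfl (by have := hcard (k - 1) (by omega); omega)
    set B1 := (C (w 0)).filter (fun v => D * ((C (w 1)).filter (fun u => G.Adj v u)).card < (C (w 1)).card)
    set B2 := (C (w 0)).filter (fun v => D * ((C (w (k - 1))).filter (fun u => G.Adj v u)).card < (C (w (k - 1))).card)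
    have h1 : 0 < (C (w 0) \ (B1 ∪ B2)).card := by
      have e1 := Finset.le_card_sdiff (B1 ∪ B2) (C (w 0))
      have e2 := Finset.card_union_le B1 B2
      have := hcard 0 (by omega)
      omega
    obtain ⟨x, hx⟩ := Finset.card_pos.1 h1
    obtain ⟨h2, h3⟩ := Finset.mem_sdiff.1 hx
    rw [Finset.mem_union, not_or] at h3
    refine ⟨x, h2, ?_, ?_⟩
    · have h4 : ¬ D * ((C (w 1)).filter (fun u => G.Adj x u)).card < (C (w 1)).card := fun h => h3.1 (Finset.mem_filter.2 ⟨h2, h⟩)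
      have h5 := hcard 1 (by omega)
      have h6 : D * (2 * a) ≤ D * ((C (w 1)).filter (fun u => G.Adj x u)).card := by
        have : D * (2 * a) = 2 * D * a := by ring
        omega
      exact Nat.le_of_mul_le_mul_left h6 hD
    · have h4 : ¬ D * ((C (w (k - 1))).filter (fun u => G.Adj x u)).card < (C (w (k - 1))).card := fun h => h3.2 (Finset.mem_filter.2 ⟨h2, h⟩)
      have h5 := hcard (k - 1) (by omega)
      exact ha _ _ (by omega) h4
  obtain ⟨Z, hZs, hZc⟩ := Finset.exists_subset_card_eq hx2
  have hZC : Z ⊆ C (w (k - 1)) := hZs.trans (Finset.filter_subset _ _)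
  have hZadj : ∀ z ∈ Z, G.Adj x0 z := fun z hz => (Finset.mem_filter.1 (hZs hz)).2
  let P : ℕ → (ℕ → V) → Prop := fun n x =>
    x 0 = x0 ∧ (∀ i ≤ n, x i ∈ C (w i)) ∧ (∀ i < n, G.Adj (x i) (x (i + 1))) ∧
    (∀ i j, i < j → j ≤ n → x i ≠ x j) ∧ (∀ i ≤ n, i < k - 1 → x i ∉ Z) ∧ (n = k - 1 → x n ∈ Z) ∧
    (n + 1 < k - 1 → a ≤ (((C (w (n + 1)) \ Z) \ (range (n + 1)).image x).filter (fun v => G.Adj (x n) v)).card) ∧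
    (n + 1 = k - 1 → c ≤ (Z.filter (fun v => G.Adj (x n) v)).card)
  have hx0Z : x0 ∉ Z := fun h => G.loopless.1 _ (hZadj x0 h)
  have hP0 : P 0 (fun _ => x0) := by
    refine ⟨rfl, ?_, ?_, ?_, ?_, ?_, ?_, ?_⟩
    · intro i hi; obtain rfl : i = 0 := by omega
      exact hx0
    · intro i hi; omega
    · intro i j hi hj; omega
    · intro i _ _; exact hx0Z
    · intro h; omega
    · intro _
      have : ((C (w 1)).filter (fun u => G.Adj x0 u)) \ Z ⊆ (((C (w (0 + 1)) \ Z) \ (range (0 + 1)).image (fun _ => x0)).filter (fun v => G.Adj x0 v)) := by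
        intro v hv
        obtain ⟨h1, h2⟩ := Finset.mem_sdiff.1 hv
        obtain ⟨h3, h4⟩ := Finset.mem_filter.1 h1
        refine Finset.mem_filter.2 ⟨Finset.mem_sdiff.2 ⟨Finset.mem_sdiff.2 ⟨h3, h2⟩, fun h => ?_⟩, h4⟩
        obtain ⟨_, -, h5⟩ := Finset.mem_image.1 h
        exact G.loopless.1 _ (h5 ▸ h4)
      have e1 := Finset.card_le_card this
      have e2 := Finset.le_card_sdiff Z ((C (w 1)).filter (fun u => G.Adj x0 u))
      have e3 : a ≤ (((C (w (0 + 1)) \ Z) \ (range (0 + 1)).image (fun _ => x0)).filter (fun v => G.Adj x0 v)).card := by omega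
      exact e3
    · intro h
      have h1 : (1 : ℕ) = k - 1 := by omega
      have : Z.filter (fun v => G.Adj x0 v) = Z := Finset.filter_true_of_mem fun z hz => hZadj z hz
      show c ≤ (Z.filter (fun v => G.Adj x0 v)).card
      rw [this]; omega
  have hup : ∀ (x : ℕ → V) n v i, i ≤ n → Function.update x (n + 1) v i = x i := fun x n v i hi =>
    Function.update_of_ne (by omega) _ _
  have hstep : ∀ n x, n < k - 1 → P n x → ∃ O : Finset V, c ≤ O.card ∧ ∀ v ∈ O, P (n + 1) (Function.update x (n + 1) v) := by
    rintro n x hn ⟨p0, p1, p2, p3, p4, -, p6, p7⟩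
    have common : ∀ v, v ∈ C (w (n + 1)) → G.Adj (x n) v → (∀ i ≤ n, x i ≠ v) →
        (Function.update x (n + 1) v 0 = x0 ∧ (∀ i ≤ n + 1, Function.update x (n + 1) v i ∈ C (w i)) ∧
        (∀ i < n + 1, G.Adj (Function.update x (n + 1) v i) (Function.update x (n + 1) v (i + 1))) ∧
        (∀ i j, i < j → j ≤ n + 1 → Function.update x (n + 1) v i ≠ Function.update x (n + 1) v j)) := by
      intro v hv1 hv2 hv3
      refine ⟨by rw [hup x n v 0 (by omega)]; exact p0, ?_, ?_, ?_⟩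
      · intro i hi
        rcases Nat.lt_or_ge n i with h | h
        · obtain rfl : i = n + 1 := by omega
          rw [Function.update_self]; exact hv1
        · rw [hup x n v i h]; exact p1 i h
      · intro i hi
        rw [hup x n v i (by omega)]
        rcases Nat.lt_or_ge i n with h | h
        · rw [hup x n v (i + 1) (by omega)]; exact p2 i h
        · obtain rfl : i = n := by omega
          rw [Function.update_self]; exact hv2
      · intro i j hij hj
        rw [hup x n v i (by omega)]
        rcases Nat.lt_or_ge n j with h | h
        · obtain rfl : j = n + 1 := by omega
          rw [Function.update_self]; exact hv3 i (by omega)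
        · rw [hup x n v j h]; exact p3 i j hij h
    by_cases hlast : n + 1 = k - 1
    · refine ⟨Z.filter (fun v => G.Adj (x n) v), p7 hlast, fun v hv => ?_⟩
      obtain ⟨hv1, hv2⟩ := Finset.mem_filter.1 hv
      have hne : ∀ i ≤ n, x i ≠ v := fun i hi h => p4 i hi (by omega) (h ▸ hv1)
      obtain ⟨c1, c2, c3, c4⟩ := common v (by rw [hlast]; exact hZC hv1) hv2 hne
      refine ⟨c1, c2, c3, c4, ?_, ?_, ?_, ?_⟩
      · intro i hi hi2
        rw [hup x n v i (by omega)]; exact p4 i (by omega) hi2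
      · intro _; rw [Function.update_self]; exact hv1
      · intro h; omega
      · intro h; omega
    · have hn2 : n + 1 < k - 1 := by omega
      have p6' := p6 hn2
      set F := ((C (w (n + 1)) \ Z) \ (range (n + 1)).image x).filter (fun v => G.Adj (x n) v) with hF
      let T : Finset V := if n + 2 = k - 1 then Z else (C (w (n + 2)) \ Z) \ (range (n + 1)).image x
      have hTC : T ⊆ C (w (n + 2)) := by
        simp only [T]
        split_ifs with h
        · rw [h]; exact hZC
        · exact Finset.sdiff_subset.trans Finset.sdiff_subset
      have hTc : n + 2 ≠ k - 1 → D * a ≤ T.card := by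
        intro h
        simp only [T, if_neg h]
        set u := w (n + 2) with hu
        set I := (range (n + 1)).filter (fun i => w i = u) with hI
        have e1 : C u \ (Z ∪ I.image x) ⊆ (C u \ Z) \ (range (n + 1)).image x := by
          intro v hv
          obtain ⟨h1, h2⟩ := Finset.mem_sdiff.1 hv
          rw [Finset.mem_union, not_or] at h2
          refine Finset.mem_sdiff.2 ⟨Finset.mem_sdiff.2 ⟨h1, h2.1⟩, fun h3 => h2.2 ?_⟩
          obtain ⟨i, hi, rfl⟩ := Finset.mem_image.1 h3
          refine Finset.mem_image.2 ⟨i, Finset.mem_filter.2 ⟨hi, ?_⟩, rfl⟩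
          by_contra hne
          have := Finset.mem_range.1 hi
          exact Finset.disjoint_left.1 (hC _ _ hne) (p1 i (by omega)) h1
        have e2 := Finset.card_le_card e1
        have e3 := Finset.le_card_sdiff (Z ∪ I.image x) (C u)
        have e4 := Finset.card_union_le Z (I.image x)
        have e5 : (I.image x).card ≤ I.card := Finset.card_image_le
        have e6 : I.card ≤ ((range k).filter (fun j => w j = w (n + 2))).card := by
          refine Finset.card_le_card (Finset.filter_subset_filter _ ?_)
          intro i hi
          have := Finset.mem_range.1 hi
          exact Finset.mem_range.2 (by omega)
        have e7 := hvis (n + 2) (by omega)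
        rw [← hu] at e6 e7
        omega
      have hTq : q ≤ T.card := by
        by_cases h : n + 2 = k - 1
        · simp only [T, if_pos h]; omega
        · have := hTc h; omega
      have ht := typ1 (n + 1) (by omega) T hTC hTq
      set Bd := (C (w (n + 1))).filter (fun v => D * (T.filter (fun u => G.Adj v u)).card < T.card) with hBd
      refine ⟨F \ Bd, ?_, fun v hv => ?_⟩
      · have := Finset.le_card_sdiff Bd F
        omega
      obtain ⟨hv1, hv2⟩ := Finset.mem_sdiff.1 hv
      obtain ⟨hv3, hv4⟩ := Finset.mem_filter.1 hv1
      obtain ⟨hv5, hv6⟩ := Finset.mem_sdiff.1 hv3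
      obtain ⟨hv7, hv8⟩ := Finset.mem_sdiff.1 hv5
      have hne : ∀ i ≤ n, x i ≠ v := fun i hi h =>
        hv6 (Finset.mem_image.2 ⟨i, Finset.mem_range.2 (by omega), h⟩)
      have hv9 : ¬ D * (T.filter (fun u => G.Adj v u)).card < T.card := fun h => hv2 (Finset.mem_filter.2 ⟨hv7, h⟩)
      obtain ⟨c1, c2, c3, c4⟩ := common v hv7 hv4 hne
      refine ⟨c1, c2, c3, c4, ?_, ?_, ?_, ?_⟩
      · intro i hi hi2
        rcases Nat.lt_or_ge n i with h | h
        · obtain rfl : i = n + 1 := by omega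
          rw [Function.update_self]; exact hv8
        · rw [hup x n v i h]; exact p4 i h hi2
      · intro h; omega
      · intro h
        have h' : n + 2 ≠ k - 1 := by omega
        refine (ha _ _ (hTc h') hv9).trans (Finset.card_le_card fun u hu => ?_)
        obtain ⟨u1, u2⟩ := Finset.mem_filter.1 hu
        simp only [T, if_neg h'] at u1
        rw [Function.update_self]
        obtain ⟨u3, u4⟩ := Finset.mem_sdiff.1 u1
        refine Finset.mem_filter.2 ⟨Finset.mem_sdiff.2 ⟨u3, fun hh => ?_⟩, u2⟩
        obtain ⟨i, hi, h5⟩ := Finset.mem_image.1 hh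
        have hi' := Finset.mem_range.1 hi
        rcases Nat.lt_or_ge n i with h | h
        · obtain rfl : i = n + 1 := by omega
          rw [Function.update_self] at h5
          exact G.loopless.1 _ (h5 ▸ u2)
        · rw [hup x n v i h] at h5
          exact u4 (Finset.mem_image.2 ⟨i, Finset.mem_range.2 (by omega), h5⟩)
      · intro h
        have h' : n + 2 = k - 1 := by omega
        rw [Function.update_self]
        simp only [T, if_pos h'] at hv9
        rw [hZc, not_lt] at hv9
        have : D * c ≤ D * (Z.filter (fun u => G.Adj v u)).card := by
          rw [mul_comm D c]; exact hcD.trans hv9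
        exact Nat.le_of_mul_le_mul_left this hD
  obtain ⟨W, hW, hWc⟩ := tree_count P x0 c (k - 1) hP0 hstep (k - 1) le_rfl
  refine hWc.trans ?_
  rw [Nat.card_eq_fintype_card, Fintype.card_subtype]
  refine Finset.card_le_card_of_injOn (fun x => fun i : Fin k => x i.val) ?_ ?_
  · intro x hx
    obtain ⟨⟨p0, p1, p2, p3, p4, p5, -, -⟩, -⟩ := hW x hx
    simp only [Finset.coe_filter, Finset.mem_univ, true_and]
    refine ⟨fun i j e => ?_, fun i => ?_⟩
    · have hi := i.2
      have hj := j.2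
      rcases lt_trichotomy i.val j.val with h | h | h
      · exact absurd e (p3 _ _ h (by omega))
      · exact Fin.ext h
      · exact absurd e.symm (p3 _ _ h (by omega))
    · have hi := i.2
      show G.Adj (x i.val) (x ((i.val + 1) % k))
      by_cases hh : i.val + 1 < k
      · rw [Nat.mod_eq_of_lt hh]; exact p2 _ (by omega)
      · have e1 : i.val + 1 = k := by omega
        rw [e1, Nat.mod_self, p0, show i.val = k - 1 by omega]
        exact (hZadj _ (p5 rfl)).symm
  · intro x hx y hy e
    funext i
    by_cases hi : i < k
    · exact congrFun e ⟨i, hi⟩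
    · rw [(hW x hx).2 i (by omega), (hW y hy).2 i (by omega)]

lemma unif_compl {V : Type} [Fintype V] [DecidableEq V] (G : SimpleGraph V) [DecidableRel G.Adj]
    [DecidableRel Gᶜ.Adj] (ε : ℝ) (U W : Finset V) (hd : Disjoint U W) (hε : 0 < ε) (hU : U.Nonempty) (hW : W.Nonempty)
    (h : G.IsUniform ε U W) : Gᶜ.IsUniform ε U W := by
  intro U' hU' W' hW' h1 h2
  have p1 : U'.Nonempty := by
    rw [← Finset.card_pos]
    have : (0:ℝ) < U.card := by exact_mod_cast hU.card_pos
    have : (0:ℝ) < U'.card := lt_of_lt_of_le (by positivity) h1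
    exact_mod_cast this
  have p2 : W'.Nonempty := by
    rw [← Finset.card_pos]
    have : (0:ℝ) < W.card := by exact_mod_cast hW.card_pos
    have : (0:ℝ) < W'.card := lt_of_lt_of_le (by positivity) h2
    exact_mod_cast this
  have e1 := G.edgeDensity_add_edgeDensity_compl p1 p2 (hd.mono hU' hW')
  have e2 := G.edgeDensity_add_edgeDensity_compl hU hW hd
  have h3 := h hU' hW' h1 h2
  have e1' : ((G.edgeDensity U' W' : ℚ) : ℝ) + ((Gᶜ.edgeDensity U' W' : ℚ) : ℝ) = 1 := by
    have h9 := congrArg (Rat.cast : ℚ → ℝ) e1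
    rw [Rat.cast_add, Rat.cast_one] at h9
    convert h9 <;> rfl
  have e2' : ((G.edgeDensity U W : ℚ) : ℝ) + ((Gᶜ.edgeDensity U W : ℚ) : ℝ) = 1 := by
    have h9 := congrArg (Rat.cast : ℚ → ℝ) e2
    rw [Rat.cast_add, Rat.cast_one] at h9
    convert h9 <;> rfl
  rw [abs_lt] at h3 ⊢
  constructor <;> linarith

lemma typ_of_uniform {V : Type} [Fintype V] [DecidableEq V] (G : SimpleGraph V) [DecidableRel G.Adj]
    (ε η : ℝ) (U W : Finset V) (D q : ℕ) (hq : 0 < q) (hD : 1 ≤ D * (η - ε)) (hU : U.card * ε ≤ q) (hW : W.card * ε ≤ q)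
    (h : G.IsUniform ε U W) (hη : η ≤ (G.edgeDensity U W : ℝ)) (T : Finset V) (hT : T ⊆ W) (hTq : q ≤ T.card) :
    (U.filter (fun v => D * (T.filter (fun u => G.Adj v u)).card < T.card)).card < q := by
  by_contra hcon
  push Not at hcon
  set B := U.filter (fun v => D * (T.filter (fun u => G.Adj v u)).card < T.card) with hB
  have hBU : B ⊆ U := Finset.filter_subset _ _
  have h3 := h hBU hT (hU.trans (by exact_mod_cast hcon)) (hW.trans (by exact_mod_cast hTq))
  rw [abs_lt] at h3
  have hB0 : 0 < B.card := by omega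
  have hT0 : 0 < T.card := by omega
  have h4 : (G.interedges B T).card = ∑ v ∈ B, (T.filter (fun u => G.Adj v u)).card := by
    rw [SimpleGraph.interedges_def, Finset.card_filter, Finset.sum_product]
    refine Finset.sum_congr rfl fun v _ => ?_
    rw [Finset.card_filter]
  have h5 : D * (G.interedges B T).card < B.card * T.card := by
    rw [h4, Finset.mul_sum]
    calc _ < ∑ v ∈ B, T.card := Finset.sum_lt_sum_of_nonempty (Finset.card_pos.1 hB0) fun v hv => (Finset.mem_filter.1 hv).2
      _ = _ := by simp
  have h6 : ((G.edgeDensity B T : ℚ) : ℝ) = (G.interedges B T).card / (B.card * T.card) := by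
    rw [SimpleGraph.edgeDensity_def]; push_cast; rfl
  have h7 : (D:ℝ) * (G.interedges B T).card < B.card * T.card := by exact_mod_cast h5
  have h8 : (D:ℝ) * (G.edgeDensity B T : ℝ) < 1 := by
    rw [h6, ← mul_div_assoc, div_lt_one (by positivity)]; exact h7
  have h9 : (D:ℝ) * (η - ε) ≤ D * (G.edgeDensity B T : ℝ) := by
    apply mul_le_mul_of_nonneg_left _ (Nat.cast_nonneg _); linarith
  linarith

lemma sum_bound {V ι : Type} [Fintype V] [DecidableEq V] [Fintype ι] [DecidableEq ι] (C : ι → Finset V) (A B : Finset ι)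
    (p : V × V → Prop) [DecidablePred p] (Y : ℕ) (hY : ∀ a, (C a).card ≤ Y) (S : Finset (ι × ι)) (η : ℝ) (hη : 0 ≤ η)
    (h : ∀ a ∈ A, ∀ b ∈ B, (a, b) ∉ S → (((C a ×ˢ C b).filter p).card : ℝ) ≤ η * (Y:ℝ) ^ 2) :
    (((A.biUnion C ×ˢ B.biUnion C).filter p).card : ℝ) ≤ (S.card + η * (Fintype.card ι : ℝ) ^ 2) * (Y:ℝ) ^ 2 := by
  have h1 : (A.biUnion C ×ˢ B.biUnion C).filter p ⊆ (A ×ˢ B).biUnion (fun q => (C q.1 ×ˢ C q.2).filter p) := by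
    rintro ⟨x, y⟩ hxy
    obtain ⟨h2, h3⟩ := Finset.mem_filter.1 hxy
    obtain ⟨h4, h5⟩ := Finset.mem_product.1 h2
    obtain ⟨a, ha, hxa⟩ := Finset.mem_biUnion.1 h4
    obtain ⟨b, hb, hxb⟩ := Finset.mem_biUnion.1 h5
    exact Finset.mem_biUnion.2 ⟨(a, b), Finset.mem_product.2 ⟨ha, hb⟩, Finset.mem_filter.2 ⟨Finset.mem_product.2 ⟨hxa, hxb⟩, h3⟩⟩
  have h2 : (((A.biUnion C ×ˢ B.biUnion C).filter p).card : ℝ) ≤ ∑ q ∈ A ×ˢ B, (((C q.1 ×ˢ C q.2).filter p).card : ℝ) := by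
    exact_mod_cast (Finset.card_le_card h1).trans Finset.card_biUnion_le
  refine h2.trans ?_
  have h3 : ∀ q ∈ A ×ˢ B, (((C q.1 ×ˢ C q.2).filter p).card : ℝ) ≤ (if q ∈ S then 1 else 0) * (Y:ℝ)^2 + η * (Y:ℝ)^2 := by
    rintro ⟨a, b⟩ hab
    obtain ⟨ha, hb⟩ := Finset.mem_product.1 hab
    have hYY : 0 ≤ η * (Y:ℝ)^2 := by positivity
    by_cases hS : (a, b) ∈ S
    · rw [if_pos hS]
      have : ((C a ×ˢ C b).filter p).card ≤ Y ^ 2 := by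
        refine (Finset.card_filter_le _ _).trans ?_
        rw [Finset.card_product, sq]; exact Nat.mul_le_mul (hY a) (hY b)
      have : (((C a ×ˢ C b).filter p).card : ℝ) ≤ (Y:ℝ) ^ 2 := by exact_mod_cast this
      show (((C a ×ˢ C b).filter p).card : ℝ) ≤ _
      linarith
    · rw [if_neg hS]
      have := h a ha b hb hS
      show (((C a ×ˢ C b).filter p).card : ℝ) ≤ _
      linarith
  refine (Finset.sum_le_sum h3).trans ?_
  rw [Finset.sum_add_distrib, ← Finset.sum_mul, add_mul]
  refine add_le_add ?_ ?_
  · refine mul_le_mul_of_nonneg_right ?_ (by positivity)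
    rw [← Nat.cast_one, ← Nat.cast_zero]
    simp only [← Nat.cast_ite]
    rw [← Nat.cast_sum, ← Finset.card_filter]
    exact_mod_cast Finset.card_le_card fun q hq => (Finset.mem_filter.1 hq).2
  · rw [Finset.sum_const, nsmul_eq_mul, Finset.card_product]
    have a1 : (A.card : ℝ) ≤ Fintype.card ι := by exact_mod_cast Finset.card_le_univ A
    have a2 : (B.card : ℝ) ≤ Fintype.card ι := by exact_mod_cast Finset.card_le_univ B
    push_cast
    have : (A.card : ℝ) * B.card ≤ (Fintype.card ι : ℝ)^2 := by rw [sq]; gcongr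
    calc (A.card : ℝ) * B.card * (η * (Y:ℝ)^2) ≤ (Fintype.card ι : ℝ)^2 * (η * (Y:ℝ)^2) := by gcongr
      _ = _ := by ring

lemma emb_case {V ι : Type} [Fintype V] [DecidableEq V] [Fintype ι] [DecidableEq ι] (G : SimpleGraph V) [DecidableRel G.Adj]
    (H : SimpleGraph ι) (C : ι → Finset V) (hC : ∀ a b, a ≠ b → Disjoint (C a) (C b)) (m N L t : ℕ)
    (hN : Fintype.card ι = N) (hN0 : 1 ≤ N) (hL : ∀ a, L ≤ (C a).card) (hL2 : 3 * m ≤ N * (L + 1))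
    (hm : 10 ^ 16 * N ^ 3 ≤ m) (ht : 80003 * N ≤ 120000 * t) (hcfm : CFM H t)
    (typ : ∀ a b, H.Adj a b → ∀ q : ℕ, m ≤ 2 * 10 ^ 11 * (N * q) → ∀ T ⊆ C b, q ≤ T.card →
      ((C a).filter (fun v => 200000 * (T.filter (fun u => G.Adj v u)).card < T.card)).card < q) :
    ((m : ℝ) / (10 ^ 16 * N)) ^ (2 * m - 1) ≤ Nat.card {g : Fin (2 * m) → V // IsCycleSeq G (2 * m) g} := by
  have hN1 : (1:ℝ) ≤ N := by exact_mod_cast hN0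
  have hmR : (10:ℝ)^16 * N ^ 3 ≤ m := by exact_mod_cast hm
  have ht0 : 0 < t := by omega
  have hNN : N * N < m := by
    have : N * N * 1 ≤ N * N * N := Nat.mul_le_mul_left _ hN0
    have : N ^ 3 = N * N * N := by ring
    have : 0 < N * N := by positivity
    omega
  have hm1 : 2 ≤ m := by
    have : 0 < N * N := by positivity
    omega
  obtain ⟨w, hw1, hw2, hw3⟩ := closed_walk H t m ht0 hcfm (by rw [hN]; exact hNN)
  set c := m / (4 * 10 ^ 15 * N) with hc
  have hc1 : c * (4 * 10 ^ 15 * N) ≤ m := Nat.div_mul_le_self _ _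
  have hc2 : m < (c + 1) * (4 * 10 ^ 15 * N) := by
    rw [mul_comm]; exact Nat.lt_mul_div_succ m (by positivity)
  have hc1R : (c:ℝ) * (4 * 10 ^ 15 * N) ≤ m := by exact_mod_cast hc1
  have hc2R : (m:ℝ) < (c + 1) * (4 * 10 ^ 15 * N) := by exact_mod_cast hc2
  have hNpos : (0:ℝ) < N := by linarith
  have hy : ∃ y : ℝ, (m:ℝ) = y * N := ⟨m / N, by field_simp⟩
  obtain ⟨y, hy⟩ := hy
  have hcy : (c:ℝ) * (4 * 10 ^ 15) ≤ y := by
    refine le_of_mul_le_mul_right ?_ hNpos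
    linarith
  have hcy2 : y < (c + 1) * (4 * 10 ^ 15) := by
    refine lt_of_mul_lt_mul_right ?_ hNpos.le
    linarith
  have hyN : (10:ℝ)^16 * N ^ 2 ≤ y := by
    refine le_of_mul_le_mul_right ?_ hNpos
    have h9 : (10:ℝ)^16 * N ^ 2 * N = 10^16 * N ^ 3 := by ring
    rw [← hy, h9]; exact hmR
  have hN2 : (1:ℝ) ≤ (N:ℝ)^2 := by nlinarith
  have hc4 : 1 ≤ c := by
    have : (0:ℝ) < c := by linarith
    exact_mod_cast this
  have hLy : 3 * y ≤ L + 1 := by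
    have : (3:ℝ) * m ≤ N * (L + 1) := by exact_mod_cast hL2
    refine le_of_mul_le_mul_right ?_ hNpos
    rw [hy] at this; linarith
  have hty : 2 * ((m / t : ℕ) : ℝ) ≤ 240000 / 80003 * y := by
    have h1 : ((m / t : ℕ) : ℝ) * t ≤ m := by exact_mod_cast Nat.div_mul_le_self m t
    have h2 : (80003:ℝ) * N ≤ 120000 * t := by exact_mod_cast ht
    have h3 : (0:ℝ) ≤ ((m / t : ℕ) : ℝ) := Nat.cast_nonneg _
    have h4 : ((m / t : ℕ) : ℝ) * (80003 * N) ≤ ((m / t : ℕ) : ℝ) * (120000 * t) := mul_le_mul_of_nonneg_left h2 h3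
    have h5 : (((m / t : ℕ) : ℝ) * 80003) * N ≤ (120000 * y) * N := by rw [hy] at h1; linarith
    have := le_of_mul_le_mul_right h5 hNpos
    linarith
  have hq : ∀ q : ℕ, 100000 * c ≤ q → m ≤ 2 * 10 ^ 11 * (N * q) := by
    intro q hq
    have h1 : (100000:ℝ) * c ≤ q := by exact_mod_cast hq
    have h2 : (1:ℝ) ≤ c := by exact_mod_cast hc4
    have h3 : y ≤ 2 * 10 ^ 11 * q := by linarith
    have : (m:ℝ) ≤ 2 * 10 ^ 11 * (N * q) := by
      rw [hy]; calc y * N ≤ (2 * 10 ^ 11 * q) * N := by gcongr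
        _ = _ := by ring
    exact_mod_cast this
  have key := embed G C hC (2 * m) (by omega) w 200000 (199999 * c) (200000 * c) c (400000 * (200000 * c)) (by norm_num)
    (by omega) (by omega) (by omega) (by
      intro i hi
      refine le_trans ?_ (hL (w i))
      have h1 := hw3 (w i)
      rw [hN] at h1
      have h1R : ((((range (2 * m)).filter (fun j => w j = w i)).card : ℕ) : ℝ) ≤ 2 * ((m / t : ℕ) : ℝ) + 2 + 2 * (N * N) := by exact_mod_cast h1
      have : ((((range (2 * m)).filter (fun j => w j = w i)).card + 400000 * (200000 * c) : ℕ) : ℝ) ≤ L := by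
        push_cast
        nlinarith
      exact_mod_cast this)
    (fun i hi T hT hTq => typ _ _ (hw1 i hi) _ (hq _ (by omega)) T hT hTq)
    (fun T hT hTq => typ _ _ hw2.symm _ (hq _ (by omega)) T hT hTq)
  have keyR : (c:ℝ) ^ (2 * m - 1) ≤ Nat.card {g : Fin (2 * m) → V // IsCycleSeq G (2 * m) g} := by exact_mod_cast key
  refine le_trans ?_ keyR
  refine pow_le_pow_left₀ (by positivity) ?_ _
  rw [div_le_iff₀ (by positivity), hy]
  have h2 : (1:ℝ) ≤ c := by exact_mod_cast hc4
  calc y * N ≤ (c * 10 ^ 16) * N := by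
        refine mul_le_mul_of_nonneg_right ?_ hNpos.le
        linarith
    _ = _ := by ring

lemma ext_case {V ι : Type} [Fintype V] [DecidableEq V] [Fintype ι] [DecidableEq ι] (G1 G2 : SimpleGraph V)
    [DecidableRel G1.Adj] [DecidableRel G2.Adj] (hG : ∀ u v, u ≠ v → G1.Adj u v ∨ G2.Adj u v)
    (H1 H2 : SimpleGraph ι) (C : ι → Finset V) (hC : ∀ a b, a ≠ b → Disjoint (C a) (C b)) (m N L t e : ℕ)
    (hV : Fintype.card V = 3 * m - 1)
    (hN : Fintype.card ι = N) (hN0 : 10 ^ 13 ≤ N) (hL : ∀ a, L ≤ (C a).card) (hLY : ∀ a, (C a).card ≤ L + 1)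
    (hL2 : 3 * m ≤ N * (L + 1)) (hL3 : N * L ≤ 3 * m)
    (hm : 10 ^ 16 * N ^ 3 ≤ m) (ht : 120000 * t ≤ 80003 * N + 120000) (he : 10 ^ 6 * e ≤ N + 10 ^ 6)
    (hT : Nat.card {p : ι × ι // ¬ H1.Adj p.1 p.2 ∧ ¬ H2.Adj p.1 p.2} ≤ e ^ 2)
    (s1 : ∀ a b, H1.Adj a b → ¬ H2.Adj a b → (((C a ×ˢ C b).filter (fun p => ¬ G1.Adj p.1 p.2)).card : ℝ) ≤ 1 / 10 ^ 5 * ((L + 1 : ℕ) : ℝ) ^ 2)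
    (s2 : ∀ a b, H2.Adj a b → ¬ H1.Adj a b → (((C a ×ˢ C b).filter (fun p => ¬ G2.Adj p.1 p.2)).card : ℝ) ≤ 1 / 10 ^ 5 * ((L + 1 : ℕ) : ℝ) ^ 2)
    (A B : Finset ι) (hAB : Disjoint A B) (hA : 2 * (N - t) ≤ A.card + 5 * e) (hB : N - t ≤ B.card + 4 * e)
    (hAA : ∀ a ∈ A, ∀ a' ∈ A, ¬ H2.Adj a a') (hABn : ∀ a ∈ A, ∀ b ∈ B, ¬ H1.Adj a b) :
    ((m : ℝ) / 100) ^ (2 * m) ≤ Nat.card {f : Fin (2 * m) → V // IsCycleSeq G1 (2 * m) f} ∨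
    ((m : ℝ) / 100) ^ (2 * m) ≤ Nat.card {f : Fin (2 * m) → V // IsCycleSeq G2 (2 * m) f} := by
  classical
  have hNR : (10:ℝ)^13 ≤ N := by exact_mod_cast hN0
  have hNpos : (0:ℝ) < N := by linarith
  have hmR : (10:ℝ)^16 * N ^ 3 ≤ m := by exact_mod_cast hm
  obtain ⟨y, hy⟩ : ∃ y : ℝ, (m:ℝ) = y * N := ⟨m / N, by field_simp⟩
  have hyN : (10:ℝ)^16 * N ^ 2 ≤ y := by
    refine le_of_mul_le_mul_right ?_ hNpos
    have h9 : (10:ℝ)^16 * N ^ 2 * N = 10^16 * N ^ 3 := by ring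
    rw [← hy, h9]; exact hmR
  have hN2 : (10:ℝ)^13 * N ≤ (N:ℝ)^2 := by nlinarith
  have hLy : 3 * y ≤ L + 1 := by
    have : (3:ℝ) * m ≤ N * (L + 1) := by exact_mod_cast hL2
    refine le_of_mul_le_mul_right ?_ hNpos
    rw [hy] at this; linarith
  have hLy2 : (L:ℝ) ≤ 3 * y := by
    have : (N:ℝ) * L ≤ 3 * m := by exact_mod_cast hL3
    refine le_of_mul_le_mul_right ?_ hNpos
    rw [hy] at this; linarith
  have heR : (10:ℝ)^6 * e ≤ N + 10^6 := by exact_mod_cast he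
  have htR : (120000:ℝ) * t ≤ 80003 * N + 120000 := by exact_mod_cast ht
  have hsz : ∀ X : Finset ι, ((X.card : ℝ)) * L ≤ ((X.biUnion C).card : ℝ) := by
    intro X
    rw [Finset.card_biUnion (fun a _ b _ h => hC a b h)]
    have : X.card * L ≤ ∑ a ∈ X, (C a).card := by
      rw [← smul_eq_mul]; exact Finset.card_nsmul_le_sum _ _ _ fun a _ => hL a
    exact_mod_cast this
  have hAR : 2 * ((N:ℝ) - t) ≤ A.card + 5 * e := by
    have : 2 * N ≤ A.card + 5 * e + 2 * t := by omega
    have : (2:ℝ) * N ≤ A.card + 5 * e + 2 * t := by exact_mod_cast this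
    linarith
  have hBR : ((N:ℝ) - t) ≤ B.card + 4 * e := by
    have : N ≤ B.card + 4 * e + t := by omega
    have : (N:ℝ) ≤ B.card + 4 * e + t := by exact_mod_cast this
    linarith
  have hAc : (0.6666 : ℝ) * N ≤ A.card := by linarith
  have hBc : (0.3333 : ℝ) * N ≤ B.card := by linarith
  have hA1 : 7999 * m ≤ 4000 * (A.biUnion C).card := by
    have h1 := hsz A
    have h2 : (0.6666 : ℝ) * N * (3 * y - 1) ≤ A.card * L := by
      apply mul_le_mul hAc (by linarith) (by linarith) (by positivity)
    have : (7999:ℝ) * m ≤ 4000 * (A.biUnion C).card := by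
      rw [hy]; nlinarith
    exact_mod_cast this
  have hB1 : 3999 * m ≤ 4000 * (B.biUnion C).card := by
    have h1 := hsz B
    have h2 : (0.3333 : ℝ) * N * (3 * y - 1) ≤ B.card * L := by
      apply mul_le_mul hBc (by linarith) (by linarith) (by positivity)
    have : (3999:ℝ) * m ≤ 4000 * (B.biUnion C).card := by
      rw [hy]; nlinarith
    exact_mod_cast this
  have hS : ((univ.filter (fun p : ι × ι => ¬ H1.Adj p.1 p.2 ∧ ¬ H2.Adj p.1 p.2)).card : ℝ) ≤ (e:ℝ)^2 := by
    rw [Nat.card_eq_fintype_card, Fintype.card_subtype] at hT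
    exact_mod_cast hT
  have hfin : ∀ z : ℕ, (z:ℝ) ≤ ((univ.filter (fun p : ι × ι => ¬ H1.Adj p.1 p.2 ∧ ¬ H2.Adj p.1 p.2)).card + 1 / 10 ^ 5 * (Fintype.card ι : ℝ)^2) * ((L + 1 : ℕ) : ℝ)^2 →
      4000 * z ≤ m ^ 2 := by
    intro z hz
    rw [hN] at hz
    have e1 : (e:ℝ) ≤ N / 10 ^ 5 := by linarith
    have e2 : (e:ℝ)^2 ≤ (N / 10 ^ 5)^2 := by gcongr
    have e3 : ((L + 1 : ℕ) : ℝ) ≤ 3.1 * y := by push_cast; linarith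
    have e4 : (z:ℝ) ≤ ((N / 10 ^ 5)^2 + 1 / 10 ^ 5 * (N:ℝ)^2) * (3.1 * y)^2 := by
      refine hz.trans ?_
      gcongr
      exact hS.trans e2
    have : (4000:ℝ) * z ≤ (m:ℝ)^2 := by
      rw [hy]
      have : 0 ≤ (N:ℝ)^2 * y^2 := by positivity
      nlinarith
    exact_mod_cast this
  refine extremal G1 G2 hG m ?_ hV (A.biUnion C) (B.biUnion C) ?_ hA1 hB1 ?_ ?_
  · have : (100:ℝ) ≤ m := by nlinarith
    exact_mod_cast this
  · rw [Finset.disjoint_biUnion_left]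
    intro a ha
    rw [Finset.disjoint_biUnion_right]
    intro b hb
    exact hC a b fun h => Finset.disjoint_left.1 hAB ha (h ▸ hb)
  · refine hfin _ (sum_bound C A A _ (L + 1) hLY _ _ (by positivity) ?_)
    intro a ha b hb hab
    have h1 := hAA a ha b hb
    refine s1 a b ?_ h1
    by_contra h2
    exact hab (Finset.mem_filter.2 ⟨Finset.mem_univ _, h2, h1⟩)
  · refine hfin _ (sum_bound C A B _ (L + 1) hLY _ _ (by positivity) ?_)
    intro a ha b hb hab
    have h1 := hABn a ha b hb
    refine s2 a b ?_ h1
    by_contra h2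
    exact hab (Finset.mem_filter.2 ⟨Finset.mem_univ _, h1, h2⟩)

lemma sparse_pair {V : Type} [Fintype V] [DecidableEq V] (G G' : SimpleGraph V) [DecidableRel G.Adj] [DecidableRel G'.Adj]
    (hG : ∀ u v, u ≠ v → G.Adj u v ∨ G'.Adj u v) (U W : Finset V) (hd : Disjoint U W) (Y : ℕ) (hU : U.card ≤ Y) (hW : W.card ≤ Y)
    (η : ℝ) (h : (G'.edgeDensity U W : ℝ) < η) : (((U ×ˢ W).filter (fun p => ¬ G.Adj p.1 p.2)).card : ℝ) ≤ η * (Y:ℝ)^2 := by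
  have h1 : ((U ×ˢ W).filter (fun p => ¬ G.Adj p.1 p.2)).card ≤ (G'.interedges U W).card := by
    refine Finset.card_le_card fun p hp => ?_
    obtain ⟨h2, h3⟩ := Finset.mem_filter.1 hp
    obtain ⟨h4, h5⟩ := Finset.mem_product.1 h2
    rw [SimpleGraph.mem_interedges_iff]
    refine ⟨h4, h5, (hG p.1 p.2 ?_).resolve_left h3⟩
    intro h6
    exact Finset.disjoint_left.1 hd h4 (h6 ▸ h5)
  have h0 : ((G'.edgeDensity U W : ℚ) : ℝ) = (G'.interedges U W).card / (U.card * W.card) := by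
    rw [SimpleGraph.edgeDensity_def]; push_cast; rfl
  have h2 : ((G'.interedges U W).card : ℝ) ≤ η * (U.card * W.card) := by
    rcases Nat.eq_zero_or_pos (U.card * W.card) with h3 | h3
    · have := G'.card_interedges_le_mul U W
      have h4 : (G'.interedges U W).card = 0 := by omega
      have h5 : (U.card : ℝ) * W.card = 0 := by exact_mod_cast h3
      rw [h4, h5]; simp
    · have h4 : (0:ℝ) < U.card * W.card := by exact_mod_cast h3
      rw [h0, div_lt_iff₀ h4] at h
      exact h.le
  have h3 : 0 ≤ (G'.edgeDensity U W : ℝ) := by exact_mod_cast G'.edgeDensity_nonneg U W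
  have h4 : (U.card : ℝ) ≤ Y := by exact_mod_cast hU
  have h5 : (W.card : ℝ) ≤ Y := by exact_mod_cast hW
  have h6 : (((U ×ˢ W).filter (fun p => ¬ G.Adj p.1 p.2)).card : ℝ) ≤ (G'.interedges U W).card := by exact_mod_cast h1
  refine h6.trans (h2.trans ?_)
  have : 0 ≤ η := by linarith
  rw [sq]; gcongr

lemma core_large : ∃ m0 K : ℕ, 100 ≤ K ∧ 1000 ≤ m0 ∧ ∀ m, m0 ≤ m → ∀ (V : Type) [Fintype V] (R : SimpleGraph V), Fintype.card V = 3 * m - 1 →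
    ((m:ℝ) / K) ^ (2 * m - 1) ≤ Nat.card {g : Fin (2 * m) → V // IsCycleSeq R (2 * m) g} ∨
    ((m:ℝ) / K) ^ (2 * m - 1) ≤ Nat.card {g : Fin (2 * m) → V // IsCycleSeq Rᶜ (2 * m) g} := by
  classical
  obtain ⟨ε, hε⟩ : ∃ ε : ℝ, ε = 1 / 10 ^ 14 := ⟨_, rfl⟩
  obtain ⟨η, hη⟩ : ∃ η : ℝ, η = 1 / 10 ^ 5 := ⟨_, rfl⟩
  have hε0 : 0 < ε := by rw [hε]; positivity
  obtain ⟨l, hl⟩ : ∃ l : ℕ, l = 10 ^ 13 := ⟨_, rfl⟩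
  obtain ⟨M, hM⟩ : ∃ M : ℕ, M = SzemerediRegularity.bound ε l := ⟨_, rfl⟩
  have hlM : l ≤ M := hM ▸ SzemerediRegularity.le_bound ε l
  have hM3 : M ≤ M ^ 3 := Nat.le_self_pow (by norm_num) M
  refine ⟨10 ^ 16 * M ^ 3, 10 ^ 16 * M, by omega, by omega, ?_⟩
  intro m hm V _ R hV
  obtain ⟨P, hP, hPl, hPM, hPU⟩ := szemeredi_regularity R hε0 (l := l) (by rw [hV]; omega)
  rw [← hM] at hPM
  obtain ⟨N, hN⟩ : ∃ N, N = P.parts.card := ⟨_, rfl⟩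
  rw [← hN] at hPl hPM
  have hN0 : 10 ^ 13 ≤ N := hl ▸ hPl
  have hmN : 10 ^ 16 * N ^ 3 ≤ m := le_trans (Nat.mul_le_mul_left _ (Nat.pow_le_pow_left hPM 3)) hm
  let C : {U // U ∈ P.parts} → Finset V := Subtype.val
  have hcι : Fintype.card {U // U ∈ P.parts} = N := by rw [Fintype.card_coe, hN]
  obtain ⟨L, hLd⟩ : ∃ L, L = (3 * m - 1) / N := ⟨_, rfl⟩
  have hL : ∀ a, L ≤ (C a).card := by
    intro a
    have := hP.average_le_card_part a.2
    rw [Finset.card_univ, hV, ← hN, ← hLd] at this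
    exact this
  have hLY : ∀ a, (C a).card ≤ L + 1 := by
    intro a
    have := hP.card_part_le_average_add_one a.2
    rw [Finset.card_univ, hV, ← hN, ← hLd] at this
    exact this
  have hL2 : 3 * m ≤ N * (L + 1) := by
    have := Nat.lt_mul_div_succ (3 * m - 1) (show 0 < N by omega)
    rw [← hLd] at this
    omega
  have hL3 : N * L ≤ 3 * m := by
    have := Nat.mul_div_le (3 * m - 1) N
    rw [← hLd] at this
    omega
  have hC : ∀ a b, a ≠ b → Disjoint (C a) (C b) := by
    intro a b hab
    exact P.disjoint a.2 b.2 fun h => hab (Subtype.ext h)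
  have hne : ∀ a, (C a).Nonempty := fun a => P.nonempty_of_mem_parts a.2
  let H1 : SimpleGraph {U // U ∈ P.parts} :=
    { Adj := fun a b => a ≠ b ∧ R.IsUniform ε (C a) (C b) ∧ η ≤ (R.edgeDensity (C a) (C b) : ℝ)
      symm := ⟨fun a b h => ⟨h.1.symm, h.2.1.symm, by rw [SimpleGraph.edgeDensity_comm]; exact h.2.2⟩⟩
      loopless := ⟨fun a h => h.1 rfl⟩ }
  let H2 : SimpleGraph {U // U ∈ P.parts} :=
    { Adj := fun a b => a ≠ b ∧ R.IsUniform ε (C a) (C b) ∧ η ≤ (Rᶜ.edgeDensity (C a) (C b) : ℝ)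
      symm := ⟨fun a b h => ⟨h.1.symm, h.2.1.symm, by rw [SimpleGraph.edgeDensity_comm]; exact h.2.2⟩⟩
      loopless := ⟨fun a h => h.1 rfl⟩ }
  have hH1 : ∀ a b, H1.Adj a b ↔ a ≠ b ∧ R.IsUniform ε (C a) (C b) ∧ η ≤ (R.edgeDensity (C a) (C b) : ℝ) := fun a b => Iff.rfl
  have hH2 : ∀ a b, H2.Adj a b ↔ a ≠ b ∧ R.IsUniform ε (C a) (C b) ∧ η ≤ (Rᶜ.edgeDensity (C a) (C b) : ℝ) := fun a b => Iff.rfl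
  clear_value H1 H2
  have hNR : (10:ℝ)^13 ≤ N := by exact_mod_cast hN0
  have hqs : ∀ q : ℕ, m ≤ 2 * 10 ^ 11 * (N * q) → 0 < q ∧ ∀ a, (C a).card * ε ≤ (q:ℝ) := by
    intro q hq
    constructor
    · rcases Nat.eq_zero_or_pos q with h | h
      · exfalso
        have : 0 < N ^ 3 := by positivity
        rw [h] at hq; omega
      · exact h
    · intro a
      have h1 : (m:ℝ) ≤ 2 * 10 ^ 11 * (N * q) := by exact_mod_cast hq
      have h2 : ((C a).card : ℝ) ≤ L + 1 := by exact_mod_cast hLY a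
      have h3 : (N:ℝ) * L ≤ 3 * m := by exact_mod_cast hL3
      have h4 : (N:ℝ) ≤ m := by
        have : N ≤ N ^ 3 := Nat.le_self_pow (by norm_num) N
        have : N ≤ m := by omega
        exact_mod_cast this
      refine le_of_mul_le_mul_right (a := (N:ℝ)) ?_ (by linarith)
      have h5 : (N:ℝ) * (C a).card ≤ 4 * m := by
        calc (N:ℝ) * (C a).card ≤ N * (L + 1) := by gcongr
          _ ≤ 4 * m := by linarith
      have : (m:ℝ) ≥ 0 := Nat.cast_nonneg _
      rw [hε]; nlinarith
  have hRR : ∀ u v, u ≠ v → R.Adj u v ∨ Rᶜ.Adj u v := by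
    intro u v h
    by_cases h1 : R.Adj u v
    · exact Or.inl h1
    · exact Or.inr ⟨h, h1⟩
  have hRR' : ∀ u v, u ≠ v → Rᶜ.Adj u v ∨ R.Adj u v := fun u v h => (hRR u v h).symm
  have hDε : (1:ℝ) ≤ ((200000 : ℕ) : ℝ) * (η - ε) := by rw [hε, hη]; norm_num
  have typ1 : ∀ a b, H1.Adj a b → ∀ q : ℕ, m ≤ 2 * 10 ^ 11 * (N * q) → ∀ T ⊆ C b, q ≤ T.card →
      ((C a).filter (fun v => 200000 * (T.filter (fun u => R.Adj v u)).card < T.card)).card < q := by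
    intro a b hab q hq T hT hTq
    obtain ⟨-, h2, h3⟩ := (hH1 a b).1 hab
    obtain ⟨q0, hq2⟩ := hqs q hq
    exact typ_of_uniform R ε η (C a) (C b) 200000 q q0 hDε (hq2 a) (hq2 b) h2 h3 T hT hTq
  have typ2 : ∀ a b, H2.Adj a b → ∀ q : ℕ, m ≤ 2 * 10 ^ 11 * (N * q) → ∀ T ⊆ C b, q ≤ T.card →
      ((C a).filter (fun v => 200000 * (T.filter (fun u => Rᶜ.Adj v u)).card < T.card)).card < q := by
    intro a b hab q hq T hT hTq
    obtain ⟨h1, h2, h3⟩ := (hH2 a b).1 hab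
    obtain ⟨q0, hq2⟩ := hqs q hq
    exact typ_of_uniform Rᶜ ε η (C a) (C b) 200000 q q0 hDε (hq2 a) (hq2 b)
      (unif_compl R ε _ _ (hC a b h1) hε0 (hne a) (hne b) h2) h3 T hT hTq
  have s1 : ∀ a b, H1.Adj a b → ¬ H2.Adj a b → (((C a ×ˢ C b).filter (fun p => ¬ R.Adj p.1 p.2)).card : ℝ) ≤ 1 / 10 ^ 5 * ((L + 1 : ℕ) : ℝ) ^ 2 := by
    intro a b h1 h2
    obtain ⟨h3, h4, h5⟩ := (hH1 a b).1 h1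
    rw [hH2] at h2
    rw [← hη]
    refine sparse_pair R Rᶜ hRR (C a) (C b) (hC a b h3) (L + 1) (hLY a) (hLY b) η ?_
    by_contra h6
    exact h2 ⟨h3, h4, not_lt.1 h6⟩
  have s2 : ∀ a b, H2.Adj a b → ¬ H1.Adj a b → (((C a ×ˢ C b).filter (fun p => ¬ Rᶜ.Adj p.1 p.2)).card : ℝ) ≤ 1 / 10 ^ 5 * ((L + 1 : ℕ) : ℝ) ^ 2 := by
    intro a b h1 h2
    obtain ⟨h3, h4, h5⟩ := (hH2 a b).1 h1
    rw [hH1] at h2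
    rw [← hη]
    refine sparse_pair Rᶜ R hRR' (C a) (C b) (hC a b h3) (L + 1) (hLY a) (hLY b) η ?_
    by_contra h6
    exact h2 ⟨h3, h4, not_lt.1 h6⟩
  obtain ⟨e, he⟩ : ∃ e, e = N / 10 ^ 6 + 1 := ⟨_, rfl⟩
  obtain ⟨t, ht⟩ : ∃ t, t = 80003 * N / 120000 + 1 := ⟨_, rfl⟩
  have hT : Nat.card {p : {U // U ∈ P.parts} × {U // U ∈ P.parts} // ¬ H1.Adj p.1 p.2 ∧ ¬ H2.Adj p.1 p.2} ≤ e ^ 2 := by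
    have h0 : (univ.filter (fun p : {U // U ∈ P.parts} × {U // U ∈ P.parts} => ¬ H1.Adj p.1 p.2 ∧ ¬ H2.Adj p.1 p.2)) ⊆
        (univ : Finset {U // U ∈ P.parts}).image (fun a => (a, a)) ∪
        univ.filter (fun p : {U // U ∈ P.parts} × {U // U ∈ P.parts} => ((p.1.1, p.2.1) : Finset V × Finset V) ∈ P.nonUniforms R ε) := by
      rintro ⟨a, b⟩ hab
      obtain ⟨-, h1, h2⟩ := Finset.mem_filter.1 hab
      rw [Finset.mem_union]
      by_cases h : a = b
      · left; exact Finset.mem_image.2 ⟨a, Finset.mem_univ _, by rw [h]⟩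
      · right
        refine Finset.mem_filter.2 ⟨Finset.mem_univ _, ?_⟩
        rw [Finpartition.mk_mem_nonUniforms]
        refine ⟨a.2, b.2, fun h' => h (Subtype.ext h'), fun hu => ?_⟩
        have e1 := R.edgeDensity_add_edgeDensity_compl (hne a) (hne b) (hC a b h)
        have e2 : ((R.edgeDensity (C a) (C b) : ℚ) : ℝ) + ((Rᶜ.edgeDensity (C a) (C b) : ℚ) : ℝ) = 1 := by
          have h9 := congrArg (Rat.cast : ℚ → ℝ) e1
          rw [Rat.cast_add, Rat.cast_one] at h9
          convert h9 <;> rfl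
        simp only [hH1, hH2, not_and, not_le] at h1 h2
        have h3 := h1 h hu
        have h4 := h2 h hu
        rw [hη] at h3 h4
        norm_num at h3 h4
        linarith
    have h1 := (Finset.card_le_card h0).trans (Finset.card_union_le _ _)
    have h2 : ((univ : Finset {U // U ∈ P.parts}).image (fun a => (a, a))).card ≤ N := by
      refine Finset.card_image_le.trans ?_
      rw [Finset.card_univ, hcι]
    have h3 : (univ.filter (fun p : {U // U ∈ P.parts} × {U // U ∈ P.parts} => ((p.1.1, p.2.1) : Finset V × Finset V) ∈ P.nonUniforms R ε)).card
        ≤ (P.nonUniforms R ε).card := by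
      refine Finset.card_le_card_of_injOn (fun p => (p.1.1, p.2.1)) ?_ ?_
      · intro p hp; exact (Finset.mem_filter.1 hp).2
      · rintro ⟨a, b⟩ _ ⟨a', b'⟩ _ h
        have h4 := congrArg Prod.fst h
        have h5 := congrArg Prod.snd h
        exact Prod.ext (Subtype.ext h4) (Subtype.ext h5)
    have h4 : ((P.nonUniforms R ε).card : ℝ) ≤ (N:ℝ) * N * ε := by
      refine le_trans hPU ?_
      rw [← hN]
      refine mul_le_mul_of_nonneg_right ?_ hε0.le
      have : N * (N - 1) ≤ N * N := Nat.mul_le_mul_left _ (by omega)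
      exact_mod_cast this
    rw [Nat.card_eq_fintype_card, Fintype.card_subtype]
    have h5 : N ≤ 10 ^ 6 * e := by omega
    have h5R : (N:ℝ) ≤ 10 ^ 6 * e := by exact_mod_cast h5
    have h6 := h1.trans (Nat.add_le_add h2 h3)
    have h6R : ((univ.filter (fun p : {U // U ∈ P.parts} × {U // U ∈ P.parts} => ¬ H1.Adj p.1 p.2 ∧ ¬ H2.Adj p.1 p.2)).card : ℝ) ≤
      (N:ℝ) + (P.nonUniforms R ε).card := by exact_mod_cast h6
    have : ((univ.filter (fun p : {U // U ∈ P.parts} × {U // U ∈ P.parts} => ¬ H1.Adj p.1 p.2 ∧ ¬ H2.Adj p.1 p.2)).card : ℝ) ≤ (e:ℝ)^2 := by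
      have hεn : (N:ℝ) * N * ε = N * N * (1 / 10 ^ 14) := by rw [hε]
      rw [hεn] at h4
      have h7 : (N:ℝ)^2 ≤ (10 ^ 6 * e)^2 := by gcongr
      have h8 : (10:ℝ)^13 * N ≤ N ^ 2 := by nlinarith
      linarith
    exact_mod_cast this
  have hKN : ∀ X : ℝ, ((m : ℝ) / (10 ^ 16 * N)) ^ (2 * m - 1) ≤ X → ((m:ℝ) / ((10 ^ 16 * M : ℕ) : ℝ)) ^ (2 * m - 1) ≤ X := by
    intro X hX
    refine le_trans (pow_le_pow_left₀ (by positivity) ?_ _) hX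
    have : (N:ℝ) ≤ M := by exact_mod_cast hPM
    have : (0:ℝ) < N := by linarith
    push_cast
    gcongr
    norm_num
  have hm100 : (100:ℝ) ≤ m := by
    have : 100 ≤ m := by omega
    exact_mod_cast this
  have hKX : ∀ X : ℝ, ((m : ℝ) / 100) ^ (2 * m) ≤ X → ((m:ℝ) / ((10 ^ 16 * M : ℕ) : ℝ)) ^ (2 * m - 1) ≤ X := by
    intro X hX
    have h1 : (1:ℝ) ≤ m / 100 := by rw [le_div_iff₀ (by norm_num)]; linarith
    refine le_trans (le_trans (pow_le_pow_left₀ (by positivity) ?_ _) (pow_le_pow_right₀ h1 (Nat.sub_le _ _))) hX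
    have : 100 ≤ 10 ^ 16 * M := by omega
    have : (100:ℝ) ≤ ((10 ^ 16 * M : ℕ) : ℝ) := by exact_mod_cast this
    gcongr
  rcases stab H1 H2 e hT t N hcι (by omega) with h | h | ⟨A, B, hAB, hA, hB, ⟨h1, h2⟩ | ⟨h1, h2⟩⟩
  · left
    exact hKN _ (emb_case R H1 C hC m N L t hcι (by omega) hL hL2 hmN (by omega) h typ1)
  · right
    exact hKN _ (emb_case Rᶜ H2 C hC m N L t hcι (by omega) hL hL2 hmN (by omega) h typ2)
  · exact (ext_case R Rᶜ hRR H1 H2 C hC m N L t e hV hcι hN0 hL hLY hL2 hL3 hmN (by omega) (by omega) hT s1 s2 A B hAB hA hB h1 h2).imp (hKX _) (hKX _)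
  · have hT' : Nat.card {p : {U // U ∈ P.parts} × {U // U ∈ P.parts} // ¬ H2.Adj p.1 p.2 ∧ ¬ H1.Adj p.1 p.2} ≤ e ^ 2 := by
      simp only [and_comm]; simpa only [and_comm] using hT
    exact ((ext_case Rᶜ R hRR' H2 H1 C hC m N L t e hV hcι hN0 hL hLY hL2 hL3 hmN (by omega) (by omega) hT' s2 s1 A B hAB hA hB h1 h2).imp (hKX _) (hKX _)).symm

/-- There is a constant `c > 0` such that for every even `k ≥ 6`, every
two-coloring of `K_n` with `n = 3k/2 - 1` contains at least `(ck)^k`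
monochromatic copies of the cycle `C_k`. -/
theorem threshold_multiplicity_even_cycles :
    ∃ c : ℝ, 0 < c ∧ ∀ k : ℕ, 6 ≤ k → Even k →
      ∀ R : SimpleGraph (Fin (k + k / 2 - 1)),
        (c * k) ^ k ≤ ((cycleCount R k + cycleCount Rᶜ k : ℕ) : ℝ) := by
  obtain ⟨m0, K, hK, hm0, hcore⟩ := core_large
  have hKR : (100:ℝ) ≤ K := by exact_mod_cast hK
  have hm0R : (1000:ℝ) ≤ m0 := by exact_mod_cast hm0
  refine ⟨1 / (1000 * K * m0), by positivity, ?_⟩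
  intro k hk hev R
  obtain ⟨m, hm⟩ := hev
  obtain rfl : k = 2 * m := by omega
  have hm3 : 3 ≤ m := by omega
  have hcard : Fintype.card (Fin (2 * m + 2 * m / 2 - 1)) = 3 * m - 1 := by rw [Fintype.card_fin]; omega
  have hmR : (3:ℝ) ≤ m := by exact_mod_cast hm3
  have hone : ∀ G : SimpleGraph (Fin (2 * m + 2 * m / 2 - 1)), HasC G (2 * m) → 1 ≤ cycleCount G (2 * m) := by
    intro G hG
    have := cycleSeq_card_ge hG
    unfold cycleCount
    rw [Nat.le_div_iff_mul_le (by omega)]; omega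
  have hex := exists_mono_cycle m hm3 R hcard
  have h1 : 1 ≤ cycleCount R (2 * m) + cycleCount Rᶜ (2 * m) := by
    rcases hex with h | h
    · have := hone _ h; omega
    · have := hone _ h; omega
  rcases lt_or_ge m m0 with hlt | hge
  · have hltR : (m:ℝ) ≤ m0 := by exact_mod_cast hlt.le
    refine le_trans (pow_le_one₀ (by positivity) ?_) (by exact_mod_cast h1)
    rw [one_div, inv_mul_le_iff₀ (by positivity)]
    push_cast
    nlinarith
  · have hcnt : ∀ G : SimpleGraph (Fin (2 * m + 2 * m / 2 - 1)),
        ((m:ℝ) / K) ^ (2 * m - 1) ≤ Nat.card {g : Fin (2 * m) → Fin (2 * m + 2 * m / 2 - 1) // IsCycleSeq G (2 * m) g} →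
        2 * (1 / (1000 * K * m0) * ((2 * m : ℕ) : ℝ)) ^ (2 * m) ≤ 1 + (cycleCount G (2 * m) : ℝ) := by
      intro G hG
      unfold cycleCount
      set X := Nat.card {g : Fin (2 * m) → Fin (2 * m + 2 * m / 2 - 1) // IsCycleSeq G (2 * m) g} with hX
      have h2 : X < (2 * (2 * m)) * (X / (2 * (2 * m)) + 1) := Nat.lt_mul_div_succ X (by omega)
      have h2R : (X:ℝ) < (2 * (2 * m)) * (((X / (2 * (2 * m)) : ℕ) : ℝ) + 1) := by exact_mod_cast h2
      have hb : 1 / (1000 * K * m0) * ((2 * m : ℕ) : ℝ) = ((m:ℝ) / K) / (500 * m0) := by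
        push_cast; field_simp; norm_num
      rw [hb, div_pow]
      have hz : 8 * (m:ℝ)^2 ≤ (500 * (m0:ℝ))^(2 * m) := by
        have a1 : (m:ℝ) ≤ 2 ^ m := by exact_mod_cast Nat.lt_two_pow_self.le
        have a2 : (m:ℝ)^2 ≤ 4 ^ m := by
          calc (m:ℝ)^2 ≤ (2 ^ m)^2 := by gcongr
            _ = 4 ^ m := by rw [← pow_mul, mul_comm m 2, pow_mul]; norm_num
        have a3 : (8:ℝ) ≤ 8 ^ m := le_self_pow₀ (by norm_num) (by omega)
        calc 8 * (m:ℝ)^2 ≤ 8 ^ m * 4 ^ m := by gcongr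
          _ = 32 ^ m := by rw [← mul_pow]; norm_num
          _ ≤ ((500 * (m0:ℝ))^2) ^ m := by
            apply pow_le_pow_left₀ (by norm_num); nlinarith
          _ = _ := by rw [← pow_mul]
      have hs : ((m:ℝ) / K) ^ (2 * m) = ((m:ℝ) / K) ^ (2 * m - 1) * (m / K) := by
        rw [← pow_succ]; congr 1; omega
      have hmK : (m:ℝ) / K ≤ m := div_le_self (by positivity) (by linarith)
      rw [hs, ← mul_div_assoc, div_le_iff₀ (by positivity)]
      have hc : (0:ℝ) ≤ ((X / (2 * (2 * m)) : ℕ) : ℝ) := Nat.cast_nonneg _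
      calc 2 * (((m:ℝ) / K) ^ (2 * m - 1) * (m / K)) ≤ 2 * (((2 * (2 * m)) * (((X / (2 * (2 * m)) : ℕ) : ℝ) + 1)) * m) := by
            gcongr
            exact hG.trans h2R.le
        _ = (1 + ((X / (2 * (2 * m)) : ℕ) : ℝ)) * (8 * (m:ℝ)^2) := by ring
        _ ≤ _ := by gcongr
    have h1R : (1:ℝ) ≤ ((cycleCount R (2 * m) + cycleCount Rᶜ (2 * m) : ℕ) : ℝ) := by exact_mod_cast h1
    push_cast at h1R ⊢
    have n1 : (0:ℝ) ≤ (cycleCount R (2 * m) : ℝ) := Nat.cast_nonneg _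
    have n2 : (0:ℝ) ≤ (cycleCount Rᶜ (2 * m) : ℝ) := Nat.cast_nonneg _
    rcases hcore m hge _ R hcard with h | h
    · have := hcnt R h
      push_cast at this
      linarith
    · have := hcnt Rᶜ h
      push_cast at this
      linarith
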